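/- arXiv:2502.16031 — 9 statements merged into one kernel-verified Lean document; each statement's English description precedes it below -/
import Mathlib

section
/- Let G be a finitely generated group and let χ : G → (ℝ, +) be a nontrivial group homomorphism. If S and T are two finite generating sets of G, then the subgraph C_χ of the Cayley graph Cay(G; S) is connected if and only if the subgraph C_χ of the Cayley graph Cay(G; T) is connected. Concretely: (for every g ∈ G with χ(g) ≥ 0 there exist n ≥ 0 and s₁, …, sₙ ∈ S ∪ S⁻¹ with g = s₁⋯sₙ and χ(s₁⋯sᵢ) ≥ 0 for all 1 ≤ i ≤ n) if and only if (the same condition holds with T in place of S). -/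
/-- The subgraph `C_χ` of the Cayley graph `Cay(G; S)` spanned by the vertices
`{g : 0 ≤ χ g}` is connected: every `g` with `0 ≤ χ g` is a product `s₁ ⋯ sₙ` of
generators from `S ∪ S⁻¹` all of whose partial products `s₁ ⋯ sᵢ` have nonnegative
`χ`-value. -/
def CayleyConnected {G : Type*} [Group G] (S : Set G) (χ : G → ℝ) : Prop :=
  ∀ g : G, 0 ≤ χ g → ∃ l : List G, (∀ s ∈ l, s ∈ S ∪ S⁻¹) ∧ l.prod = g ∧
    ∀ i ≤ l.length, 0 ≤ χ (l.take i).prod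

/-- There is an `S`-path from `a` to `b` along which `χ` stays at least `c`. -/
def CayPath {G : Type*} [Group G] (S : Set G) (χ : G → ℝ) (c : ℝ) : G → G → Prop :=
  Relation.ReflTransGen (fun a b => a⁻¹ * b ∈ S ∪ S⁻¹ ∧ c ≤ χ a ∧ c ≤ χ b)

section CayAux

variable {G : Type*} [Group G] {S T : Set G} {χ : G → ℝ} {c : ℝ}

theorem cayPath_mono {d : ℝ} (h : d ≤ c) {a b : G} (p : CayPath S χ c a b) :
    CayPath S χ d a b :=
  Relation.ReflTransGen.mono (fun _ _ q => ⟨q.1, h.trans q.2.1, h.trans q.2.2⟩) _ _ p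

theorem cayPath_symm {a b : G} (p : CayPath S χ c a b) : CayPath S χ c b a := by
  have : Std.Symm (fun a b : G => a⁻¹ * b ∈ S ∪ S⁻¹ ∧ c ≤ χ a ∧ c ≤ χ b) := by
    refine ⟨fun a b q => ⟨?_, q.2.2, q.2.1⟩⟩
    have h : b⁻¹ * a = (a⁻¹ * b)⁻¹ := by group
    rw [h]
    rcases q.1 with q | q
    · right; simpa using q
    · left; exact q
  induction p with
  | refl => exact Relation.ReflTransGen.refl
  | tail _ q ih => exact Relation.ReflTransGen.head (this.symm _ _ q) ih

theorem cayPath_translate (hχ : ∀ a b : G, χ (a * b) = χ a + χ b) (x : G) {a b : G}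
    (p : CayPath S χ c a b) : CayPath S χ (χ x + c) (x * a) (x * b) := by
  refine Relation.ReflTransGen.lift (fun y => x * y) (fun u v q => ?_) _ _ p
  refine ⟨?_, ?_, ?_⟩
  · have h : (x * u)⁻¹ * (x * v) = u⁻¹ * v := by group
    rw [h]; exact q.1
  · rw [hχ]; linarith [q.2.1]
  · rw [hχ]; linarith [q.2.2]

theorem cay_one (hχ : ∀ a b : G, χ (a * b) = χ a + χ b) : χ 1 = 0 := by
  have := hχ 1 1
  simp only [mul_one] at this
  linarith

theorem cay_inv (hχ : ∀ a b : G, χ (a * b) = χ a + χ b) (g : G) : χ g⁻¹ = - χ g := by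
  have := hχ g g⁻¹
  rw [mul_inv_cancel, cay_one hχ] at this
  linarith

theorem cayPath_list (l : List G) (hl : ∀ s ∈ l, s ∈ S ∪ S⁻¹)
    (h : ∀ i ≤ l.length, 0 ≤ χ (l.take i).prod) : CayPath S χ 0 1 l.prod := by
  induction l using List.reverseRecOn with
  | nil => exact Relation.ReflTransGen.refl
  | append_singleton l s ih =>
    have h1 : 0 ≤ χ l.prod := by simpa using h l.length (by simp)
    have h2 : 0 ≤ χ (l ++ [s]).prod := by simpa using h (l ++ [s]).length le_rfl
    refine Relation.ReflTransGen.tail (ih (fun s hs => hl s (by simp [hs])) ?_) ⟨?_, h1, h2⟩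
    · intro i hi
      have := h i (by simp; omega)
      rwa [List.take_append_of_le_length hi] at this
    · have h3 : l.prod⁻¹ * (l ++ [s]).prod = s := by simp
      rw [h3]; exact hl s (by simp)

theorem cayPath_to_list (hχ : ∀ a b : G, χ (a * b) = χ a + χ b) {g : G}
    (p : CayPath S χ 0 1 g) : ∃ l : List G, (∀ s ∈ l, s ∈ S ∪ S⁻¹) ∧ l.prod = g ∧
    ∀ i ≤ l.length, 0 ≤ χ (l.take i).prod := by
  induction p with
  | refl => exact ⟨[], by simp, by simp, by simp [cay_one hχ]⟩
  | @tail a b _ q ih =>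
    obtain ⟨l, h1, h2, h3⟩ := ih
    have hp : (l ++ [a⁻¹ * b]).prod = b := by simp [h2]
    refine ⟨l ++ [a⁻¹ * b], ?_, hp, ?_⟩
    · intro s hs
      rcases List.mem_append.1 hs with hs | hs
      · exact h1 s hs
      · rw [List.mem_singleton.1 hs]; exact q.1
    · intro i hi
      by_cases hil : i ≤ l.length
      · rw [List.take_append_of_le_length hil]; exact h3 i hil
      · rw [List.take_of_length_le (by simp; omega), hp]; exact q.2.2

theorem cayPath_exists (hχ : ∀ a b : G, χ (a * b) = χ a + χ b)
    (hT : Subgroup.closure T = ⊤) (g : G) : ∃ c, CayPath T χ c 1 g := by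
  have hg : g ∈ Subgroup.closure T := by rw [hT]; trivial
  induction hg using Subgroup.closure_induction with
  | mem x hx =>
    refine ⟨min (χ 1) (χ x), Relation.ReflTransGen.single ⟨?_, min_le_left _ _, min_le_right _ _⟩⟩
    left; simpa using hx
  | one => exact ⟨0, Relation.ReflTransGen.refl⟩
  | mul x y _ _ hx hy =>
    obtain ⟨c, hc⟩ := hx
    obtain ⟨d, hd⟩ := hy
    have hd' := cayPath_translate hχ x hd
    rw [mul_one] at hd'
    exact ⟨min c (χ x + d), Relation.ReflTransGen.trans (cayPath_mono (min_le_left _ _) hc)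
      (cayPath_mono (min_le_right _ _) hd')⟩
  | inv x _ hx =>
    obtain ⟨c, hc⟩ := hx
    have h := cayPath_translate hχ x⁻¹ hc
    rw [mul_one, inv_mul_cancel] at h
    exact ⟨_, cayPath_symm h⟩

theorem cay_exists_pos (hχ : ∀ a b : G, χ (a * b) = χ a + χ b)
    (hT : Subgroup.closure T = ⊤) (hne : ∃ g : G, χ g ≠ 0) :
    ∃ t ∈ T ∪ T⁻¹, 0 < χ t := by
  by_contra hcon
  push Not at hcon
  obtain ⟨g, hg0⟩ := hne
  apply hg0
  have hg : g ∈ Subgroup.closure T := by rw [hT]; trivial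
  clear hg0
  induction hg using Subgroup.closure_induction with
  | mem x hx =>
    have h1 := hcon x (Or.inl hx)
    have h2 := hcon x⁻¹ (Or.inr (by simpa using hx))
    rw [cay_inv hχ] at h2
    linarith
  | one => exact cay_one hχ
  | mul x y _ _ hx hy => rw [hχ, hx, hy, add_zero]
  | inv x _ hx => rw [cay_inv hχ, hx, neg_zero]

theorem cay_pow (hχ : ∀ a b : G, χ (a * b) = χ a + χ b) (t : G) (n : ℕ) :
    χ (t ^ n) = n * χ t := by
  induction n with
  | zero => simp [cay_one hχ]
  | succ n ih => rw [pow_succ, hχ, ih]; push_cast; ring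

theorem cayPath_pow (hχ : ∀ a b : G, χ (a * b) = χ a + χ b) {t : G} (ht : t ∈ T ∪ T⁻¹)
    (hpos : 0 < χ t) (n : ℕ) : CayPath T χ 0 1 (t ^ n) := by
  induction n with
  | zero => rw [pow_zero]; exact Relation.ReflTransGen.refl
  | succ n ih =>
    refine Relation.ReflTransGen.tail ih ⟨?_, ?_, ?_⟩
    · have h : (t ^ n)⁻¹ * t ^ (n + 1) = t := by rw [pow_succ]; group
      rw [h]; exact ht
    · rw [cay_pow hχ]; positivity
    · rw [cay_pow hχ]; positivity

theorem cayleyConnected_of (hfin : S.Finite) (hT : Subgroup.closure T = ⊤)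
    (hχ : ∀ a b : G, χ (a * b) = χ a + χ b) (hne : ∃ g : G, χ g ≠ 0)
    (h : CayleyConnected S χ) : CayleyConnected T χ := by
  obtain ⟨K, hK⟩ : ∃ K, ∀ s ∈ S ∪ S⁻¹, CayPath T χ K 1 s := by
    have hf : (S ∪ S⁻¹).Finite := hfin.union hfin.inv
    have : ∀ᶠ c in Filter.atBot, ∀ s ∈ S ∪ S⁻¹, CayPath T χ c 1 s := by
      rw [Filter.eventually_all_finite hf]
      intro s _
      obtain ⟨c, hc⟩ := cayPath_exists hχ hT s
      filter_upwards [Filter.eventually_le_atBot c] with d hd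
      exact cayPath_mono hd hc
    exact this.exists
  have key : ∀ g, 0 ≤ χ g → CayPath T χ K 1 g := by
    intro g hg
    obtain ⟨l, h1, h2, h3⟩ := h g hg
    have p := cayPath_list l h1 h3
    rw [h2] at p
    clear h2 hg
    induction p with
    | refl => exact Relation.ReflTransGen.refl
    | @tail a b _ q ih =>
      have h4 := cayPath_translate hχ a (hK _ q.1)
      rw [mul_one, mul_inv_cancel_left] at h4
      exact Relation.ReflTransGen.trans ih (cayPath_mono (by linarith [q.2.1]) h4)
  obtain ⟨t, ht, hpos⟩ := cay_exists_pos hχ hT hne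
  obtain ⟨n, hn⟩ := Archimedean.arch (-K) hpos
  rw [nsmul_eq_mul] at hn
  intro g hg
  apply cayPath_to_list hχ
  have e1 := cayPath_pow hχ ht hpos n
  have e2 := cayPath_translate hχ (t ^ n) (key ((t ^ n)⁻¹ * g * t ^ n) (by
    rw [hχ, hχ, cay_inv hχ]; linarith))
  rw [mul_one, mul_assoc, mul_inv_cancel_left, cay_pow hχ] at e2
  have e3 := cayPath_translate hχ g e1
  rw [mul_one] at e3
  exact Relation.ReflTransGen.trans e1 (Relation.ReflTransGen.trans
    (cayPath_mono (by linarith) e2) (cayPath_symm (cayPath_mono (by linarith) e3)))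

end CayAux

/-- Connectivity of the subgraph `C_χ` of the Cayley graph of a finitely generated group
does not depend on the choice of finite generating set. -/
theorem cayleyConnected_independent_of_generating_set
    {G : Type*} [Group G] (S T : Finset G)
    (hS : Subgroup.closure (S : Set G) = ⊤) (hT : Subgroup.closure (T : Set G) = ⊤)
    (χ : G → ℝ) (hχ : ∀ a b : G, χ (a * b) = χ a + χ b) (hne : ∃ g : G, χ g ≠ 0) :
    CayleyConnected (S : Set G) χ ↔ CayleyConnected (T : Set G) χ := by
  exact ⟨cayleyConnected_of S.finite_toSet hT hχ hne, cayleyConnected_of T.finite_toSet hS hχ hne⟩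
end

section
/- Let G be a finitely presented group that contains no nonabelian free subgroup, and let S be a finite generating set of G. Then for every nontrivial homomorphism χ : G → (ℝ, +), at least one of the graphs C_χ and C_{−χ} is connected. Equivalently, Σ(G) ∪ −Σ(G) = S(G), where −Σ(G) is the image of Σ(G) under the antipodal map [χ] ↦ [−χ]. -/
/-- `G` is a finitely presented group: it is the quotient of a finitely generated free
group by the normal closure of finitely many relations. -/
def FinitelyPresentedGroup (G : Type*) [Group G] : Prop :=
  ∃ (n : ℕ) (rels : Set (FreeGroup (Fin n))), rels.Finite ∧ Nonempty (PresentedGroup rels ≃* G)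


namespace BNS

open Relation

universe u

variable {G : Type u} [Group G]

/-- Ping-pong: a set `E` and elements `x₁, x₂, y` as in an amalgam of indices `≥ 3`, `≥ 2`. -/
theorem ping_pong (E : Set G) (x : Bool → G) (y : G)
    (hx : ∀ i g, g ∈ E → x i * g ∉ E)
    (hxx : ∀ g, g ∈ E → (x false)⁻¹ * x true * g ∉ E)
    (hy : ∀ g, g ∉ E → y * g ∈ E) :
    ∃ φ : FreeGroup Bool →* G, Function.Injective φ := by
  have hE : E.Nonempty := by
    by_contra h
    rw [Set.not_nonempty_iff_eq_empty] at h
    have := hy 1 (by simp [h])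
    simp [h] at this
  have hxx' : ∀ g, g ∈ E → (x true)⁻¹ * x false * g ∉ E := by
    intro g hg h
    apply hxx _ h
    simpa [mul_assoc] using hg
  have hij : ∀ i j g, i ≠ j → g ∈ E → (x i)⁻¹ * x j * g ∉ E := by
    intro i j g hne hg
    cases i <;> cases j <;> first | exact absurd rfl hne | exact hxx g hg | exact hxx' g hg
  let X : Bool → Set G := fun i => {g | (x i)⁻¹ * (y⁻¹ * g) ∈ E}
  let Y : Bool → Set G := fun i => {g | y⁻¹ * ((x i)⁻¹ * g) ∉ E}
  -- `X i ⊆ E`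
  have hXE : ∀ i g, g ∈ X i → g ∈ E := by
    intro i g hg
    have h1 := hx i _ hg
    rw [mul_inv_cancel_left] at h1
    have := hy _ h1
    rwa [mul_inv_cancel_left] at this
  have hYE : ∀ i g, g ∈ Y i → (x i)⁻¹ * g ∈ E := by
    intro i g hg
    have := hy _ hg
    rwa [mul_inv_cancel_left] at this
  have key : Function.Injective (FreeGroup.lift
      (fun i : ULift.{u} Bool => y * x i.down * y⁻¹ * (x i.down)⁻¹)) := by
    refine FreeGroup.injective_lift_of_ping_pong (α := G) _ (fun i => X i.down)
      (fun i => Y i.down) ?_ ?_ ?_ ?_ ?_ ?_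
    · rintro ⟨i⟩
      obtain ⟨e, he⟩ := hE
      exact ⟨y * (x i * e), by simpa [X] using he⟩
    · rintro ⟨i⟩ ⟨j⟩ hne'
      have hne : i ≠ j := fun h => hne' (by rw [h])
      rw [Function.onFun, Set.disjoint_left]
      intro g hi hj
      apply hij i j _ hne hj
      simpa [mul_assoc, X] using hi
    · rintro ⟨i⟩ ⟨j⟩ hne'
      have hne : i ≠ j := fun h => hne' (by rw [h])
      rw [Function.onFun, Set.disjoint_left]
      intro g hi hj
      apply hij i j _ hne (hYE j g hj)
      simpa [mul_assoc] using hYE i g hi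
    · rintro ⟨i⟩ ⟨j⟩
      rw [Set.disjoint_left]
      intro g hi hj
      apply hx j _ (hYE j g hj)
      simpa using hXE i g hi
    · rintro ⟨i⟩ _ ⟨g, hg, rfl⟩
      simp only [Y, Set.mem_compl_iff, Set.mem_ofPred_eq, not_not] at hg
      simpa [X, mul_assoc] using hg
    · rintro ⟨i⟩ _ ⟨g, hg, rfl⟩
      simp only [X, Set.mem_compl_iff, Set.mem_ofPred_eq] at hg
      simpa [Y, mul_assoc] using hg
  let e := FreeGroup.freeGroupCongr (Equiv.ulift.{u}.symm : Bool ≃ ULift.{u} Bool)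
  exact ⟨(FreeGroup.lift _).comp e.toMonoidHom, key.comp e.injective⟩

/-- `g` and `h` are joined by a `T`-path inside `P`. -/
def Conn (T P : Set G) (g h : G) : Prop :=
  ReflTransGen (fun a b => a ∈ P ∧ b ∈ P ∧ a⁻¹ * b ∈ T) g h

theorem Conn.trans {T P : Set G} {a b c : G} (h : Conn T P a b) (h' : Conn T P b c) :
    Conn T P a c := ReflTransGen.trans h h'

theorem Conn.step {T P : Set G} {a b : G} (ha : a ∈ P) (hb : b ∈ P) (h : a⁻¹ * b ∈ T) :
    Conn T P a b := ReflTransGen.single ⟨ha, hb, h⟩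

theorem Conn.mono {T P Q : Set G} (hPQ : P ⊆ Q) {a b : G} (h : Conn T P a b) :
    Conn T Q a b := by
  induction h with
  | refl => exact ReflTransGen.refl
  | tail _ h ih => exact ih.trans (Conn.step (hPQ h.1) (hPQ h.2.1) h.2.2)

theorem Conn.symm {T P : Set G} (hT : ∀ t ∈ T, t⁻¹ ∈ T) {a b : G} (h : Conn T P a b) :
    Conn T P b a := by
  induction h with
  | refl => exact ReflTransGen.refl
  | tail _ h ih =>
    refine Conn.trans (Conn.step h.2.1 h.1 ?_) ih
    simpa using hT _ h.2.2

theorem Conn.translate {T P Q : Set G} (k : G) (hPQ : ∀ v ∈ P, k * v ∈ Q) {a b : G}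
    (h : Conn T P a b) : Conn T Q (k * a) (k * b) := by
  induction h with
  | refl => exact ReflTransGen.refl
  | tail _ h ih =>
    refine Conn.trans ih (Conn.step (hPQ _ h.1) (hPQ _ h.2.1) ?_)
    simpa [mul_assoc] using h.2.2

theorem Conn.of_closure {T : Set G} (hT : Subgroup.closure T = ⊤)
    (hinv : ∀ t ∈ T, t⁻¹ ∈ T) (g : G) : Conn T Set.univ 1 g := by
  have hg : g ∈ Subgroup.closure T := by rw [hT]; trivial
  induction hg using Subgroup.closure_induction_right with
  | one => exact ReflTransGen.refl
  | mul_right a b _ hb ih => exact ih.trans (Conn.step trivial trivial (by simpa using hb))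
  | mul_inv_cancel a b _ hb ih =>
    exact ih.trans (Conn.step trivial trivial (by simpa using hinv _ hb))

theorem Conn.toList {S : Set G} {χ : G → ℝ} (h1 : χ 1 = 0) {g : G}
    (h : Conn (S ∪ S⁻¹) {v | 0 ≤ χ v} 1 g) :
    ∃ l : List G, (∀ s ∈ l, s ∈ S ∪ S⁻¹) ∧ l.prod = g ∧
      ∀ i ≤ l.length, 0 ≤ χ (l.take i).prod := by
  induction h with
  | refl => exact ⟨[], by simp, by simp, by simp [h1]⟩
  | @tail b c _ h ih =>
    obtain ⟨l, hl, hp, hi⟩ := ih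
    refine ⟨l ++ [b⁻¹ * c], ?_, by simp [hp], ?_⟩
    · intro s hs
      rw [List.mem_append, List.mem_singleton] at hs
      rcases hs with hs | rfl
      · exact hl s hs
      · exact h.2.2
    · intro i hi'
      by_cases hle : i ≤ l.length
      · rw [List.take_append_of_le_length hle]; exact hi i hle
      · rw [List.take_of_length_le (by simp; omega)]
        simpa [hp] using h.2.1

/-- Each finitely presented group has a finite triangular generating set. -/
theorem exists_triangular (hfp : FinitelyPresentedGroup G) :
    ∃ T : Set G, T.Finite ∧ 1 ∈ T ∧ (∀ t ∈ T, t⁻¹ ∈ T) ∧ Subgroup.closure T = ⊤ ∧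
      ∀ c : G → G → ZMod 2,
        (∀ g h k, g⁻¹ * h ∈ T → h⁻¹ * k ∈ T → g⁻¹ * k ∈ T → c g h + c h k = c g k) →
        ∃ f : G → ZMod 2, ∀ g h, g⁻¹ * h ∈ T → f h = f g + c g h := by
  obtain ⟨n, rels, hfin, ⟨e⟩⟩ := hfp
  let π : FreeGroup (Fin n) →* G := e.toMonoidHom.comp (PresentedGroup.mk rels)
  have hπ : Function.Surjective π := e.surjective.comp (PresentedGroup.mk_surjective rels)
  have hker : ∀ w, π w = 1 ↔ w ∈ Subgroup.normalClosure rels := by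
    intro w
    simp only [π, MonoidHom.comp_apply, MulEquiv.coe_toMonoidHom]
    rw [EmbeddingLike.map_eq_one_iff]
    exact PresentedGroup.mk_eq_one_iff
  -- words
  let W : Set (List (Fin n × Bool)) := (FreeGroup.toWord '' rels) ∪ Set.range (fun i => [(i, true)])
  have hW : W.Finite := (hfin.image _).union (Set.finite_range _)
  let T₀ : Set G := ⋃ w ∈ W, (fun l => π (FreeGroup.mk l)) '' {l | l ∈ w.inits}
  have hT₀ : T₀.Finite := hW.biUnion fun w _ => (List.finite_toSet _).image _
  have hT₀mem : ∀ w ∈ W, ∀ l, l <+: w → π (FreeGroup.mk l) ∈ T₀ := by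
    intro w hw l hl
    refine Set.mem_biUnion hw ⟨l, ?_, rfl⟩
    simpa using hl
  let T : Set G := insert 1 (T₀ ∪ T₀⁻¹)
  have h1T : (1 : G) ∈ T := Set.mem_insert _ _
  have hinv : ∀ t ∈ T, t⁻¹ ∈ T := by
    intro t ht
    simp only [T, Set.mem_insert_iff, Set.mem_union, Set.mem_inv, inv_inv, inv_eq_one] at ht ⊢
    tauto
  have hsub : T₀ ⊆ T := fun t ht => by simp [T, ht]
  have hgen : ∀ i, π (FreeGroup.of i) ∈ T := fun i =>
    hsub (hT₀mem [(i, true)] (Or.inr ⟨i, rfl⟩) _ (List.prefix_refl _))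
  refine ⟨T, ?_, h1T, hinv, ?_, ?_⟩
  · exact (hT₀.union hT₀.inv).insert _
  · rw [eq_top_iff]
    have : (⊤ : Subgroup G) = Subgroup.map π ⊤ := by
      rw [← MonoidHom.range_eq_map, MonoidHom.range_eq_top.2 hπ]
    rw [this, ← FreeGroup.closure_range_of, MonoidHom.map_closure, Subgroup.closure_le]
    rintro _ ⟨_, ⟨i, rfl⟩, rfl⟩
    exact Subgroup.subset_closure (hgen i)
  · intro c hc
    have hc1 : ∀ g, c g g = 0 := by
      intro g
      have := hc g g g (by simpa using h1T) (by simpa using h1T) (by simpa using h1T)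
      simpa using this
    have hcs : ∀ g h, g⁻¹ * h ∈ T → c g h + c h g = 0 := by
      intro g h hh
      rw [hc g h g hh (by simpa using hinv _ hh) (by simpa using h1T), hc1]
    let σ : Fin n → Equiv.Perm (G × ZMod 2) := fun i =>
      { toFun := fun p => (p.1 * π (FreeGroup.of i), p.2 + c p.1 (p.1 * π (FreeGroup.of i)))
        invFun := fun p => (p.1 * (π (FreeGroup.of i))⁻¹, p.2 + c p.1 (p.1 * (π (FreeGroup.of i))⁻¹))
        left_inv := by
          rintro ⟨g, z⟩
          have := hcs g (g * π (FreeGroup.of i)) (by simpa using hgen i)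
          simp [add_assoc, this]
        right_inv := by
          rintro ⟨g, z⟩
          have := hcs g (g * (π (FreeGroup.of i))⁻¹) (by simpa using hinv _ (hgen i))
          simp [add_assoc, this] }
    let Φ : FreeGroup (Fin n) →* (Equiv.Perm (G × ZMod 2))ᵐᵒᵖ :=
      FreeGroup.lift (fun i => MulOpposite.op (σ i))
    let act : FreeGroup (Fin n) → G × ZMod 2 → G × ZMod 2 := fun w => (Φ w).unop
    have act_mul : ∀ a b p, act (a * b) p = act b (act a p) := by
      intro a b p
      simp [act]
    have act_one : ∀ p, act 1 p = p := by
      intro p; simp [act]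
    have act_letter : ∀ i b g z, act (FreeGroup.mk [(i, b)]) (g, z) =
        (g * π (FreeGroup.mk [(i, b)]), z + c g (g * π (FreeGroup.mk [(i, b)]))) := by
      intro i b g z
      cases b
      · have : FreeGroup.mk [(i, false)] = (FreeGroup.of i)⁻¹ := by
          simp [FreeGroup.of, FreeGroup.inv_mk, FreeGroup.invRev]
        rw [this]
        simp only [act, Φ, map_inv, FreeGroup.lift_apply_of, MulOpposite.unop_inv, MulOpposite.unop_op]
        rfl
      · change act (FreeGroup.of i) (g, z) = (g * π (FreeGroup.of i), z + c g (g * π (FreeGroup.of i)))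
        simp only [act, Φ, FreeGroup.lift_apply_of, MulOpposite.unop_op]
        rfl
    have letter_mem : ∀ i b, π (FreeGroup.mk [(i, b)]) ∈ T := by
      intro i b
      cases b
      · have : FreeGroup.mk [(i, false)] = (FreeGroup.of i)⁻¹ := by
          simp [FreeGroup.of, FreeGroup.inv_mk, FreeGroup.invRev]
        rw [this, map_inv]
        exact hinv _ (hgen i)
      · exact hgen i
    have act_pre : ∀ w ∈ W, ∀ l, l <+: w → ∀ g z, act (FreeGroup.mk l) (g, z) =
        (g * π (FreeGroup.mk l), z + c g (g * π (FreeGroup.mk l))) := by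
      intro w hw l
      induction l using List.reverseRecOn with
      | nil =>
        intro _ g z
        rw [← FreeGroup.one_eq_mk, act_one]
        simp [hc1]
      | append_singleton l a ih =>
        intro hl g z
        have hl' : l <+: w := (List.prefix_append l [a]).trans hl
        have m1 := hsub (hT₀mem w hw _ hl)
        have m2 := hsub (hT₀mem w hw _ hl')
        obtain ⟨i, b⟩ := a
        have m3 := letter_mem i b
        rw [← FreeGroup.mul_mk] at m1 ⊢
        rw [act_mul, ih hl', act_letter, map_mul] 
        rw [map_mul] at m1
        have := hc g (g * π (FreeGroup.mk l)) (g * (π (FreeGroup.mk l) * π (FreeGroup.mk [(i, b)])))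
          (by simpa using m2) (by simpa [mul_assoc] using m3) (by simpa using m1)
        rw [← this]
        simp [mul_assoc, add_assoc]
    have hΦ : ∀ w, π w = 1 → Φ w = 1 := by
      intro w hw
      rw [hker] at hw
      have : Subgroup.normalClosure rels ≤ Φ.ker := by
        apply Subgroup.normalClosure_le_normal
        intro r hr
        have hr1 : π r = 1 := (hker r).2 (Subgroup.subset_normalClosure hr)
        rw [SetLike.mem_coe, MonoidHom.mem_ker]
        apply MulOpposite.unop_injective
        ext1 ⟨g, z⟩
        have := act_pre r.toWord (Or.inl ⟨r, hr, rfl⟩) r.toWord (List.prefix_refl _) g z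
        rw [FreeGroup.mk_toWord, hr1] at this
        simpa [hc1, act] using this
      exact this hw
    have hact : ∀ v w, π v = π w → act v = act w := by
      intro v w h
      have h1 : Φ (v * w⁻¹) = 1 := hΦ _ (by simp [h])
      have h2 : Φ v = Φ w := by
        rw [map_mul, map_inv, mul_inv_eq_one] at h1
        exact h1
      simp [act, h2]
    have act_fst : ∀ w g z, (act w (g, z)).1 = g * π w := by
      intro w
      induction w using FreeGroup.induction_on with
      | C1 => simp [act_one]
      | of i => intro g z; exact congrArg Prod.fst (act_letter i true g z)
      | inv_of i _ =>
        intro g z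
        have := congrArg Prod.fst (act_letter i false g z)
        have h' : FreeGroup.mk [(i, false)] = (FreeGroup.of i)⁻¹ := by
          simp [FreeGroup.of, FreeGroup.inv_mk, FreeGroup.invRev]
        rw [h'] at this
        exact this
      | mul a b iha ihb =>
        intro g z
        rw [act_mul, ← Prod.mk.eta (p := act a (g, z)), ihb, iha, map_mul, mul_assoc]
    choose ρ hρ using hπ
    let f : G → ZMod 2 := fun g => (act (ρ g) (1, 0)).2
    have hf : ∀ w, act w (1, 0) = (π w, f (π w)) := by
      intro w
      ext1
      · rw [act_fst, one_mul]
      · simp only [f]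
        rw [hact (ρ (π w)) w (hρ _)]
    have hf0 : ∀ g h, g⁻¹ * h ∈ T₀ → f h = f g + c g h := by
      intro g h hh
      simp only [T₀, Set.mem_iUnion] at hh
      obtain ⟨w, hw, l, hl, hlg⟩ := hh
      have hl' : l <+: w := by simpa using hl
      have h1 := act_pre w hw l hl' g (f g)
      have hlg' : π (FreeGroup.mk l) = g⁻¹ * h := hlg
      have h2 := hf (ρ g * FreeGroup.mk l)
      rw [act_mul, hf, hρ, h1, map_mul, hρ, hlg'] at h2
      have h3 := congrArg Prod.snd h2
      simpa using h3.symm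
    refine ⟨f, ?_⟩
    intro g h hh
    have hh' := hh
    simp only [T, Set.mem_insert_iff, Set.mem_union, Set.mem_inv] at hh
    rcases hh with hh | hh | hh
    · have : h = g := by rw [inv_mul_eq_one] at hh; exact hh.symm
      rw [this, hc1, add_zero]
    · exact hf0 g h hh
    · have := hf0 h g (by simpa using hh)
      rw [this, add_assoc, add_comm (c h g), hcs g h hh', add_zero]

/-- The standing assumptions on a generating set and a character. -/
structure Setup (T : Set G) (χ : G → ℝ) (L : ℝ) : Prop where
  mul : ∀ a b, χ (a * b) = χ a + χ b
  one : 1 ∈ T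
  inv : ∀ t ∈ T, t⁻¹ ∈ T
  conn : ∀ g, Conn T Set.univ 1 g
  bd : ∀ t ∈ T, |χ t| ≤ L
  pos : ∃ t ∈ T, χ t = L
  Lpos : 0 < L

namespace Setup

variable {T : Set G} {χ : G → ℝ} {L : ℝ}

theorem map_one (hs : Setup T χ L) : χ 1 = 0 := by
  have := hs.mul 1 1
  rw [mul_one] at this
  linarith

theorem map_inv (hs : Setup T χ L) (g : G) : χ g⁻¹ = - χ g := by
  have := hs.mul g g⁻¹
  rw [mul_inv_cancel, hs.map_one] at this
  linarith

theorem neg (hs : Setup T χ L) : Setup T (fun g => - χ g) L where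
  mul a b := by rw [hs.mul]; ring
  one := hs.one
  inv := hs.inv
  conn := hs.conn
  bd t ht := by rw [abs_neg]; exact hs.bd t ht
  pos := by
    obtain ⟨t, ht, h⟩ := hs.pos
    exact ⟨t⁻¹, hs.inv t ht, by rw [hs.map_inv, h, neg_neg]⟩
  Lpos := hs.Lpos

/-- Adjacent vertices have close heights. -/
theorem close (hs : Setup T χ L) {g h : G} (hgh : g⁻¹ * h ∈ T) : |χ h - χ g| ≤ L := by
  have := hs.bd _ hgh
  rwa [hs.mul, hs.map_inv, neg_add_eq_sub] at this

/-- The elements of the kernel joined to `1` inside `χ⁻¹ I`. -/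
def Stab (hs : Setup T χ L) (I : Set ℝ) : Subgroup G where
  carrier := {n | χ n = 0 ∧ Conn T (χ ⁻¹' I) 1 n}
  one_mem' := ⟨hs.map_one, ReflTransGen.refl⟩
  mul_mem' := by
    rintro a b ⟨ha, ha'⟩ ⟨hb, hb'⟩
    refine ⟨by rw [hs.mul, ha, hb, add_zero], ha'.trans ?_⟩
    have := hb'.translate (Q := χ ⁻¹' I) a (fun v hv => by simpa [hs.mul, ha] using hv)
    rwa [mul_one] at this
  inv_mem' := by
    rintro a ⟨ha, ha'⟩
    refine ⟨by rw [hs.map_inv, ha, neg_zero], Conn.symm hs.inv ?_⟩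
    have := ha'.translate (Q := χ ⁻¹' I) a⁻¹ (fun v hv => by
      simpa [hs.mul, hs.map_inv, ha] using hv)
    rwa [mul_one, inv_mul_cancel] at this

theorem mem_stab (hs : Setup T χ L) {I : Set ℝ} {n : G} :
    n ∈ hs.Stab I ↔ χ n = 0 ∧ Conn T (χ ⁻¹' I) 1 n := Iff.rfl

theorem mem_stab_neg (hs : Setup T χ L) {I J : Set ℝ} (hIJ : ∀ r, -r ∈ I ↔ r ∈ J) {n : G} :
    n ∈ hs.neg.Stab I ↔ n ∈ hs.Stab J := by
  rw [mem_stab, mem_stab]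
  have : (fun g => - χ g) ⁻¹' I = χ ⁻¹' J := by
    ext v
    exact hIJ _
  rw [this, neg_eq_zero]

theorem stab_mono (hs : Setup T χ L) {I J : Set ℝ} (h : I ⊆ J) : hs.Stab I ≤ hs.Stab J :=
  fun _ hn => ⟨hn.1, hn.2.mono (Set.preimage_mono h)⟩

theorem inv_mul_mem_stab (hs : Setup T χ L) {I : Set ℝ} {m n : G} (hm : χ m = 0) (hn : χ n = 0)
    (h : Conn T (χ ⁻¹' I) m n) : m⁻¹ * n ∈ hs.Stab I := by
  refine ⟨by rw [hs.mul, hs.map_inv, hm, hn]; simp, ?_⟩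
  have := h.translate (Q := χ ⁻¹' I) m⁻¹ (fun v hv => by simpa [hs.mul, hs.map_inv, hm] using hv)
  rwa [inv_mul_cancel] at this

theorem exists_list (hs : Setup T χ L) (g : G) :
    ∃ l : List G, (∀ t ∈ l, t ∈ T) ∧ (l.map χ).sum = χ g := by
  induction hs.conn g with
  | refl => exact ⟨[], by simp, by simp [hs.map_one]⟩
  | @tail b c _ h ih =>
    obtain ⟨l, hl, hsum⟩ := ih
    refine ⟨(b⁻¹ * c) :: l, ?_, ?_⟩
    · intro t ht
      rcases List.mem_cons.1 ht with rfl | ht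
      · exact h.2.2
      · exact hl t ht
    · rw [List.map_cons, List.sum_cons, hsum, hs.mul, hs.map_inv]
      ring

/-- Reordering a word, one reaches the kernel without leaving a suitable region. -/
theorem retract (hs : Setup T χ L) (P : Set G)
    (hP : ∀ v ∈ P, ∀ t ∈ T, χ v * χ t < 0 → v * t ∈ P) {v : G} (hv : v ∈ P) :
    ∃ n, χ n = 0 ∧ Conn T P v n := by
  classical
  obtain ⟨l, hl, hsum⟩ := hs.exists_list v⁻¹
  rw [hs.map_inv] at hsum
  obtain ⟨k, hk⟩ : ∃ k, l.length = k := ⟨_, rfl⟩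
  induction k generalizing l v with
  | zero =>
    rw [List.length_eq_zero_iff] at hk
    subst hk
    refine ⟨v, ?_, ReflTransGen.refl⟩
    simpa using hsum.symm
  | succ k ih =>
    by_cases h0 : χ v = 0
    · exact ⟨v, h0, ReflTransGen.refl⟩
    obtain ⟨t, htl, ht⟩ : ∃ t ∈ l, χ v * χ t < 0 := by
      by_contra! hcon
      have h1 : 0 ≤ (l.map (fun t => χ v * χ t)).sum := by
        apply List.sum_nonneg
        intro x hx
        obtain ⟨t, ht, rfl⟩ := List.mem_map.1 hx
        exact hcon t ht
      rw [List.sum_map_mul_left, hsum] at h1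
      have := mul_self_pos.2 h0
      linarith
    have hvt := hP v hv t (hl t htl) ht
    obtain ⟨n, hn, hc⟩ := ih hvt (l.erase t) (fun s hs' => hl s (List.mem_of_mem_erase hs')) (by
      have := ((List.perm_cons_erase htl).map χ).sum_eq
      rw [List.map_cons, List.sum_cons, hsum] at this
      rw [hs.mul]
      linarith) (by rw [List.length_erase_of_mem htl, hk]; rfl)
    exact ⟨n, hn, Conn.trans (Conn.step hv hvt (by simpa using hl t htl)) hc⟩

theorem retract_strip (hs : Setup T χ L) {v : G} (hv : χ v ∈ Set.Icc (-L) L) :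
    ∃ n, χ n = 0 ∧ Conn T (χ ⁻¹' Set.Icc (-L) L) v n := by
  refine hs.retract _ ?_ hv
  intro v hv t ht hneg
  have hb := abs_le.1 (hs.bd t ht)
  simp only [Set.mem_preimage, Set.mem_Icc] at hv ⊢
  rw [hs.mul]
  rcases mul_neg_iff.1 hneg with h | h
  · constructor <;> linarith
  · constructor <;> linarith

theorem retract_up (hs : Setup T χ L) {v : G} (hv : -L ≤ χ v) :
    ∃ n, χ n = 0 ∧ Conn T (χ ⁻¹' Set.Ici (-L)) v n := by
  refine hs.retract _ ?_ hv
  intro v hv t ht hneg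
  have hb := abs_le.1 (hs.bd t ht)
  simp only [Set.mem_preimage, Set.mem_Ici] at hv ⊢
  rw [hs.mul]
  rcases mul_neg_iff.1 hneg with h | h <;> linarith

/-- The kernel is generated by the upper and lower stabilizers. -/
theorem generate (hs : Setup T χ L) (M : Subgroup G) (h1 : hs.Stab (Set.Ici (-L)) ≤ M)
    (h2 : hs.Stab (Set.Iic L) ≤ M) {n : G} (hn : χ n = 0) : n ∈ M := by
  have hL := hs.Lpos
  have key : ∀ v, (∃ m ∈ M, χ m = 0 ∧ 0 ≤ χ v ∧ Conn T (χ ⁻¹' Set.Ici (-L)) m v) ∨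
      (∃ m ∈ M, χ m = 0 ∧ χ v ≤ 0 ∧ Conn T (χ ⁻¹' Set.Iic L) m v) := by
    intro v
    induction hs.conn v with
    | refl => exact Or.inl ⟨1, M.one_mem, hs.map_one, hs.map_one.ge, ReflTransGen.refl⟩
    | @tail b c _ h ih =>
      have hcl := abs_le.1 (hs.close h.2.2)
      rcases ih with ⟨m, hm, hm0, hb, hc⟩ | ⟨m, hm, hm0, hb, hc⟩
      · by_cases h0 : 0 ≤ χ c
        · refine Or.inl ⟨m, hm, hm0, h0, hc.trans (Conn.step ?_ ?_ h.2.2)⟩ <;>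
            simp only [Set.mem_preimage, Set.mem_Ici] <;> linarith
        · push Not at h0
          obtain ⟨k, hk, hbk⟩ := hs.retract_strip (v := b) ⟨by linarith, by linarith⟩
          have h3 := h1 (hs.inv_mul_mem_stab hm0 hk
            (hc.trans (hbk.mono (Set.preimage_mono Set.Icc_subset_Ici_self))))
          have hkM : k ∈ M := by simpa using M.mul_mem hm h3
          refine Or.inr ⟨k, hkM, hk, h0.le, ((hbk.mono
            (Set.preimage_mono Set.Icc_subset_Iic_self)).symm hs.inv).trans
              (Conn.step ?_ ?_ h.2.2)⟩ <;>
            simp only [Set.mem_preimage, Set.mem_Iic] <;> linarith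
      · by_cases h0 : χ c ≤ 0
        · refine Or.inr ⟨m, hm, hm0, h0, hc.trans (Conn.step ?_ ?_ h.2.2)⟩ <;>
            simp only [Set.mem_preimage, Set.mem_Iic] <;> linarith
        · push Not at h0
          obtain ⟨k, hk, hbk⟩ := hs.retract_strip (v := b) ⟨by linarith, by linarith⟩
          have h3 := h2 (hs.inv_mul_mem_stab hm0 hk
            (hc.trans (hbk.mono (Set.preimage_mono Set.Icc_subset_Iic_self))))
          have hkM : k ∈ M := by simpa using M.mul_mem hm h3
          refine Or.inl ⟨k, hkM, hk, h0.le, ((hbk.mono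
            (Set.preimage_mono Set.Icc_subset_Ici_self)).symm hs.inv).trans
              (Conn.step ?_ ?_ h.2.2)⟩ <;>
            simp only [Set.mem_preimage, Set.mem_Ici] <;> linarith
  rcases key n with ⟨m, hm, hm0, _, hc⟩ | ⟨m, hm, hm0, _, hc⟩
  · simpa using M.mul_mem hm (h1 (hs.inv_mul_mem_stab hm0 hn hc))
  · simpa using M.mul_mem hm (h2 (hs.inv_mul_mem_stab hm0 hn hc))

theorem conn_one_pow {U : Set G} {t : G} (ht : t ∈ U) (P : Set G) (k : ℕ) (g : G)
    (h : ∀ i ≤ k, g * t ^ i ∈ P) : Conn U P g (g * t ^ k) := by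
  induction k with
  | zero => rw [pow_zero, mul_one]; exact ReflTransGen.refl
  | succ k ih =>
    refine (ih fun i hi => h i (by omega)).trans (Conn.step (h k (by omega)) (h _ le_rfl) ?_)
    rw [pow_succ]
    simpa [mul_assoc] using ht

theorem map_pow (hs : Setup T χ L) (g : G) (k : ℕ) : χ (g ^ k) = k * χ g := by
  induction k with
  | zero => simp [hs.map_one]
  | succ k ih => rw [pow_succ, hs.mul, ih]; push_cast; ring

/-- `N₊` shrinks under conjugation by a positive generator: `t N₊ t⁻¹ ≤ N₊`. -/
theorem conj_up (hs : Setup T χ L) {t : G} (ht : t ∈ T) (htL : χ t = L) {n : G}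
    (hn : n ∈ hs.Stab (Set.Ici (-L))) : t * n * t⁻¹ ∈ hs.Stab (Set.Ici (-L)) := by
  have hL := hs.Lpos
  have hn0 := hn.1
  refine ⟨by rw [hs.mul, hs.mul, hs.map_inv, hn0]; ring, ?_⟩
  have h1 := hn.2.translate (Q := χ ⁻¹' Set.Ici (-L)) t (fun v hv => by
    simp only [Set.mem_preimage, Set.mem_Ici, hs.mul] at hv ⊢; linarith)
  have h2 : Conn T (χ ⁻¹' Set.Ici (-L)) 1 t := by
    refine Conn.step ?_ ?_ (by simpa using ht) <;>
      simp only [Set.mem_preimage, Set.mem_Ici, hs.map_one] <;> linarith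
  have h3 : Conn T (χ ⁻¹' Set.Ici (-L)) (t * n) (t * n * t⁻¹) := by
    refine Conn.step ?_ ?_ (by rw [inv_mul_cancel_left]; exact hs.inv t ht) <;>
      simp only [Set.mem_preimage, Set.mem_Ici, hs.mul, hs.map_inv] <;> linarith
  rw [mul_one] at h1
  exact (h2.trans h1).trans h3

/-- If `N₊` is invariant then it is the whole kernel. -/
theorem up_eq_of_conj (hs : Setup T χ L) {t : G} (ht : t ∈ T) (htL : χ t = L)
    (h : ∀ n ∈ hs.Stab (Set.Ici (-L)), t⁻¹ * n * t ∈ hs.Stab (Set.Ici (-L)))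
    {n : G} (hn : χ n = 0) : n ∈ hs.Stab (Set.Ici (-L)) := by
  have hL := hs.Lpos
  have hb : ∀ g, ∃ k : ℕ, Conn T (χ ⁻¹' Set.Ici (-(k * L))) 1 g := by
    intro g
    induction hs.conn g with
    | refl => exact ⟨0, ReflTransGen.refl⟩
    | @tail b c _ hbc ih =>
      obtain ⟨k, hk⟩ := ih
      obtain ⟨m, hm⟩ := exists_nat_gt ((|χ b| + |χ c|) / L)
      rw [div_lt_iff₀ hL] at hm
      have hb := abs_le.1 (le_refl |χ b|)
      have hc := abs_le.1 (le_refl |χ c|)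
      have := abs_nonneg (χ b)
      have := abs_nonneg (χ c)
      have hk0 : 0 ≤ (k : ℝ) * L := by positivity
      have hm0 : 0 ≤ (m : ℝ) * L := by positivity
      refine ⟨k + m, (hk.mono ?_).trans (Conn.step ?_ ?_ hbc.2.2)⟩
      · apply Set.preimage_mono
        apply Set.Ici_subset_Ici.2
        push_cast
        linarith
      · simp only [Set.mem_preimage, Set.mem_Ici]; push_cast; linarith
      · simp only [Set.mem_preimage, Set.mem_Ici]; push_cast; linarith
  obtain ⟨k, hk⟩ := hb n
  have hpow : ∀ i : ℕ, ∀ n ∈ hs.Stab (Set.Ici (-L)),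
      (t ^ i)⁻¹ * n * t ^ i ∈ hs.Stab (Set.Ici (-L)) := by
    intro i
    induction i with
    | zero => intro n hn; simpa using hn
    | succ i ih =>
      intro n hn
      have := h _ (ih n hn)
      simpa [pow_succ, mul_assoc] using this
  have h1 : t ^ k * n * (t ^ k)⁻¹ ∈ hs.Stab (Set.Ici (-L)) := by
    refine ⟨by rw [hs.mul, hs.mul, hs.map_inv, hn]; ring, ?_⟩
    have h2 := hk.translate (Q := χ ⁻¹' Set.Ici (-L)) (t ^ k) (fun v hv => by
      simp only [Set.mem_preimage, Set.mem_Ici, hs.mul, hs.map_pow, htL] at hv ⊢; linarith)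
    have h3 : Conn T (χ ⁻¹' Set.Ici (-L)) 1 (t ^ k) := by
      have := conn_one_pow ht (χ ⁻¹' Set.Ici (-L)) k 1 (fun i _ => by
        simp only [Set.mem_preimage, Set.mem_Ici, hs.mul, hs.map_pow, htL, hs.map_one]
        have : 0 ≤ (i : ℝ) * L := by positivity
        linarith)
      rwa [one_mul] at this
    have h4 : Conn T (χ ⁻¹' Set.Ici (-L)) (t ^ k * n * (t ^ k)⁻¹) (t ^ k * n) := by
      have := conn_one_pow ht (χ ⁻¹' Set.Ici (-L)) k (t ^ k * n * (t ^ k)⁻¹) (fun i _ => by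
        simp only [Set.mem_preimage, Set.mem_Ici, hs.mul, hs.map_inv, hs.map_pow, htL, hn]
        have : 0 ≤ (i : ℝ) * L := by positivity
        linarith)
      simpa using this
    rw [mul_one] at h2
    exact (h3.trans h2).trans (h4.symm hs.inv)
  simpa [mul_assoc] using hpow k _ h1

/-- If `N₊` is the whole kernel then `C_χ` is connected, for each generating set. -/
theorem connected_of_up (hs : Setup T χ L) (hT : T.Finite) (S : Set G)
    (hS : Subgroup.closure S = ⊤)
    (h : ∀ n, χ n = 0 → n ∈ hs.Stab (Set.Ici (-L))) : CayleyConnected S χ := by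
  have hL := hs.Lpos
  have hSinv : ∀ s ∈ S ∪ S⁻¹, s⁻¹ ∈ S ∪ S⁻¹ := by
    intro s hs
    simp only [Set.mem_union, Set.mem_inv, inv_inv] at hs ⊢
    tauto
  have hS' : Subgroup.closure (S ∪ S⁻¹) = ⊤ :=
    top_le_iff.1 (hS ▸ Subgroup.closure_mono Set.subset_union_left)
  have hbd : ∀ g : G, ∃ C : ℝ, 0 ≤ C ∧ Conn (S ∪ S⁻¹) (χ ⁻¹' Set.Ici (-C)) 1 g := by
    intro g
    induction Conn.of_closure hS' hSinv g with
    | refl => exact ⟨0, le_rfl, ReflTransGen.refl⟩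
    | @tail b c _ hbc ih =>
      obtain ⟨C, hC, hk⟩ := ih
      have hb := abs_le.1 (le_refl |χ b|)
      have hc := abs_le.1 (le_refl |χ c|)
      have := abs_nonneg (χ b)
      have := abs_nonneg (χ c)
      refine ⟨C + |χ b| + |χ c|, by positivity, (hk.mono ?_).trans (Conn.step ?_ ?_ hbc.2.2)⟩
      · apply Set.preimage_mono
        apply Set.Ici_subset_Ici.2
        linarith
      · simp only [Set.mem_preimage, Set.mem_Ici]; linarith
      · simp only [Set.mem_preimage, Set.mem_Ici]; linarith
  choose C hC0 hC using hbd
  obtain ⟨D, hD⟩ := (hT.image C).bddAbove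
  have hD' : ∀ t ∈ T, C t ≤ D := fun t ht => hD ⟨t, ht, rfl⟩
  have hconv : ∀ {a b : G}, Conn T (χ ⁻¹' Set.Ici (-L)) a b →
      Conn (S ∪ S⁻¹) (χ ⁻¹' Set.Ici (-L - D)) a b := by
    intro a b hab
    induction hab with
    | refl => exact ReflTransGen.refl
    | @tail b c _ hbc ih =>
      refine ih.trans ?_
      have := (hC (b⁻¹ * c)).translate (Q := χ ⁻¹' Set.Ici (-L - D)) b (fun v hv => by
        have h1 := hD' _ hbc.2.2
        have h2 := hbc.1
        simp only [Set.mem_preimage, Set.mem_Ici, hs.mul] at hv h2 ⊢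
        linarith)
      simpa using this
  obtain ⟨s, hsS, hspos⟩ : ∃ s ∈ S ∪ S⁻¹, 0 < χ s := by
    by_contra! hcon
    have h0 : ∀ g, χ g = 0 := by
      intro g
      induction Conn.of_closure hS' hSinv g with
      | refl => exact hs.map_one
      | @tail b c _ hbc ih =>
        have h1 := hcon _ hbc.2.2
        have h2 := hcon _ (hSinv _ hbc.2.2)
        rw [hs.map_inv, hs.mul, hs.map_inv] at h2
        rw [hs.mul, hs.map_inv] at h1
        linarith
    obtain ⟨t, _, ht⟩ := hs.pos
    rw [h0] at ht
    linarith
  intro g hg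
  refine Conn.toList hs.map_one ?_
  obtain ⟨k, hk⟩ := exists_nat_gt ((L + D) / χ s)
  rw [div_lt_iff₀ hspos] at hk
  have hi : ∀ i : ℕ, 0 ≤ (i : ℝ) * χ s := fun i => by positivity
  have h1 : Conn (S ∪ S⁻¹) {v | 0 ≤ χ v} 1 (s ^ k) := by
    have := conn_one_pow hsS {v | 0 ≤ χ v} k 1 (fun i _ => by
      change 0 ≤ χ _
      rw [hs.mul, hs.map_pow, hs.map_one, zero_add]
      exact hi i)
    rwa [one_mul] at this
  have h2 : Conn (S ∪ S⁻¹) {v | 0 ≤ χ v} g (g * s ^ k) := by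
    refine conn_one_pow hsS {v | 0 ≤ χ v} k g (fun i _ => ?_)
    change 0 ≤ χ _
    rw [hs.mul, hs.map_pow]
    have := hi i
    linarith
  have hg' : χ ((s ^ k)⁻¹ * g * s ^ k) = χ g := by
    rw [hs.mul, hs.mul, hs.map_inv]; ring
  obtain ⟨n, hn, hc⟩ := hs.retract_up (v := (s ^ k)⁻¹ * g * s ^ k) (by linarith)
  have h3 := hconv ((h n hn).2.trans (hc.symm hs.inv))
  have h4 := h3.translate (Q := {v | 0 ≤ χ v}) (s ^ k) (fun v hv => by
    change 0 ≤ χ _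
    simp only [Set.mem_preimage, Set.mem_Ici] at hv
    rw [hs.mul, hs.map_pow]
    linarith)
  have h5 : s ^ k * ((s ^ k)⁻¹ * g * s ^ k) = g * s ^ k := by group
  rw [mul_one, h5] at h4
  exact (h1.trans h4).trans (h2.symm hSinv)

/-- The component of `1` in the strip. -/
def K (T : Set G) (χ : G → ℝ) (L : ℝ) : Set G := {v | Conn T (χ ⁻¹' Set.Icc (-L) L) 1 v}

open Classical in
/-- The indicator of the lower half. -/
noncomputable def low (χ : G → ℝ) (g : G) : ZMod 2 := if χ g < 0 then 1 else 0

open Classical in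
/-- The crossing cocycle of the strip component `K`. -/
noncomputable def cross (T : Set G) (χ : G → ℝ) (L : ℝ) (g h : G) : ZMod 2 :=
  if g ∈ K T χ L ∧ h ∈ K T χ L then low χ g + low χ h else 0

theorem K_strip (hs : Setup T χ L) {v : G} (hv : v ∈ K T χ L) : χ v ∈ Set.Icc (-L) L := by
  have hL := hs.Lpos
  rcases ReflTransGen.cases_tail hv with h | ⟨b, _, h⟩
  · rw [h, hs.map_one]; constructor <;> linarith
  · exact h.2.1

theorem K_step {g h : G} (hgh : g⁻¹ * h ∈ T) (hg : χ g ∈ Set.Icc (-L) L)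
    (hh : χ h ∈ Set.Icc (-L) L) (hK : g ∈ K T χ L) : h ∈ K T χ L :=
  Conn.trans hK (Conn.step hg hh hgh)

theorem inv_adj (hs : Setup T χ L) {g h : G} (hgh : g⁻¹ * h ∈ T) : h⁻¹ * g ∈ T := by
  simpa using hs.inv _ hgh

theorem low_eq (hs : Setup T χ L) {g h : G} (hgh : g⁻¹ * h ∈ T) (hg : χ g ∉ Set.Icc (-L) L) :
    low χ h = low χ g := by
  have hL := hs.Lpos
  have hcl := abs_le.1 (hs.close hgh)
  rw [Set.mem_Icc, not_and_or, not_le, not_le] at hg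
  rcases hg with hg | hg
  · rw [low, low, if_pos (by linarith), if_pos (by linarith)]
  · rw [low, low, if_neg (by linarith), if_neg (by linarith)]

theorem cross_eq_zero {g h : G} (h' : low χ g = low χ h) : cross T χ L g h = 0 := by
  rw [cross, h', CharTwo.add_self_eq_zero, ite_self]

theorem triangle (hs : Setup T χ L) (g h k : G) (hgh : g⁻¹ * h ∈ T) (hhk : h⁻¹ * k ∈ T)
    (hgk : g⁻¹ * k ∈ T) :
    cross T χ L g h + cross T χ L h k = cross T χ L g k := by
  by_cases hall : χ g ∈ Set.Icc (-L) L ∧ χ h ∈ Set.Icc (-L) L ∧ χ k ∈ Set.Icc (-L) L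
  · obtain ⟨hg, hh, hk⟩ := hall
    by_cases hK : g ∈ K T χ L
    · have hhK := K_step hgh hg hh hK
      have hkK := K_step hgk hg hk hK
      rw [cross, cross, cross, if_pos ⟨hK, hhK⟩, if_pos ⟨hhK, hkK⟩, if_pos ⟨hK, hkK⟩]
      generalize low χ g = a
      generalize low χ h = b
      generalize low χ k = d
      revert a b d
      decide
    · have hhK : h ∉ K T χ L := fun h' => hK (K_step (hs.inv_adj hgh) hh hg h')
      rw [cross, cross, cross, if_neg (fun h' => hK h'.1), if_neg (fun h' => hhK h'.1),
        if_neg (fun h' => hK h'.1), add_zero]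
  · have h3 : low χ g = low χ h ∧ low χ g = low χ k := by
      by_cases hg : χ g ∈ Set.Icc (-L) L
      · by_cases hh : χ h ∈ Set.Icc (-L) L
        · have hk : χ k ∉ Set.Icc (-L) L := fun hk => hall ⟨hg, hh, hk⟩
          have h1 := hs.low_eq (hs.inv_adj hgk) hk
          have h2 := hs.low_eq (hs.inv_adj hhk) hk
          exact ⟨h1.trans h2.symm, h1⟩
        · have h1 := hs.low_eq (hs.inv_adj hgh) hh
          have h2 := hs.low_eq hhk hh
          exact ⟨h1, h1.trans h2.symm⟩
      · exact ⟨(hs.low_eq hgh hg).symm, (hs.low_eq hgk hg).symm⟩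
    rw [cross_eq_zero h3.1, cross_eq_zero h3.2, cross_eq_zero (h3.1.symm.trans h3.2), add_zero]

theorem one_mem_K : (1 : G) ∈ K T χ L := ReflTransGen.refl

section half

variable {f : G → ZMod 2}

open Classical in
theorem f_up (hs : Setup T χ L) (hf1 : f 1 = 0)
    (hf : ∀ g h, g⁻¹ * h ∈ T → f h = f g + cross T χ L g h) {v : G}
    (hv : Conn T (χ ⁻¹' Set.Ici (-L)) 1 v) : f v = if v ∈ K T χ L then low χ v else 0 := by
  have hL := hs.Lpos
  induction hv with
  | refl => rw [if_pos one_mem_K, hf1, low, hs.map_one, if_neg (lt_irrefl _)]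
  | @tail b c _ h ih =>
    obtain ⟨hb, hc, hbc⟩ := h
    have hcl := abs_le.1 (hs.close hbc)
    rw [hf b c hbc, ih, cross]
    by_cases hbK : b ∈ K T χ L <;> by_cases hcK : c ∈ K T χ L
    · rw [if_pos hbK, if_pos hcK, if_pos ⟨hbK, hcK⟩, ← add_assoc, CharTwo.add_self_eq_zero,
        zero_add]
    · have hcs : ¬ χ c ≤ L := fun h => hcK (K_step hbc (hs.K_strip hbK) ⟨hc, h⟩ hbK)
      rw [if_pos hbK, if_neg hcK, if_neg (fun h => hcK h.2), low, if_neg (by linarith), add_zero]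
    · have hbs : ¬ χ b ≤ L := fun h =>
        hbK (K_step (hs.inv_adj hbc) (hs.K_strip hcK) ⟨hb, h⟩ hcK)
      rw [if_neg hbK, if_pos hcK, if_neg (fun h => hbK h.1), low, if_neg (by linarith), add_zero]
    · rw [if_neg hbK, if_neg hcK, if_neg (fun h => hbK h.1), add_zero]

open Classical in
theorem f_down (hs : Setup T χ L) (hf1 : f 1 = 0)
    (hf : ∀ g h, g⁻¹ * h ∈ T → f h = f g + cross T χ L g h) {v : G}
    (hv : Conn T (χ ⁻¹' Set.Iic L) 1 v) : f v = if v ∈ K T χ L then low χ v else 1 := by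
  have hL := hs.Lpos
  induction hv with
  | refl => rw [if_pos one_mem_K, hf1, low, hs.map_one, if_neg (lt_irrefl _)]
  | @tail b c _ h ih =>
    obtain ⟨hb, hc, hbc⟩ := h
    have hcl := abs_le.1 (hs.close hbc)
    rw [hf b c hbc, ih, cross]
    by_cases hbK : b ∈ K T χ L <;> by_cases hcK : c ∈ K T χ L
    · rw [if_pos hbK, if_pos hcK, if_pos ⟨hbK, hcK⟩, ← add_assoc, CharTwo.add_self_eq_zero,
        zero_add]
    · have hcs : ¬ -L ≤ χ c := fun h => hcK (K_step hbc (hs.K_strip hbK) ⟨h, hc⟩ hbK)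
      rw [if_pos hbK, if_neg hcK, if_neg (fun h => hcK h.2), low, if_pos (by linarith), add_zero]
    · have hbs : ¬ -L ≤ χ b := fun h =>
        hbK (K_step (hs.inv_adj hbc) (hs.K_strip hcK) ⟨h, hb⟩ hcK)
      rw [if_neg hbK, if_pos hcK, if_neg (fun h => hbK h.1), low, if_pos (by linarith), add_zero]
    · rw [if_neg hbK, if_neg hcK, if_neg (fun h => hbK h.1), add_zero]

theorem f_const (hs : Setup T χ L)
    (hf : ∀ g h, g⁻¹ * h ∈ T → f h = f g + cross T χ L g h) {n : G} (hn : χ n = 0)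
    (hnK : n ∉ K T χ L) {v : G} (hv : v ∈ K T χ L) : f (n⁻¹ * v) = f n⁻¹ := by
  have hcon : ∀ b ∈ K T χ L, n⁻¹ * b ∉ K T χ L := by
    intro b hb hK
    apply hnK
    have h1 := Conn.translate (Q := χ ⁻¹' Set.Icc (-L) L) n (fun v hv => by
      simpa [hs.mul, hn] using hv) hK
    rw [mul_one, mul_inv_cancel_left] at h1
    exact Conn.trans hb (h1.symm hs.inv)
  induction hv with
  | refl => rw [mul_one]
  | @tail b c hb h ih =>
    rw [hf (n⁻¹ * b) (n⁻¹ * c) (by simpa [mul_assoc] using h.2.2), ih, cross,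
      if_neg (fun h' => hcon b hb h'.1), add_zero]

theorem nest (hs : Setup T χ L) (hf1 : f 1 = 0)
    (hf : ∀ g h, g⁻¹ * h ∈ T → f h = f g + cross T χ L g h) {n : G} (hn : χ n = 0)
    (hnK : n ∉ K T χ L) {ε : ZMod 2} (h1 : f n = ε) (h2 : f n⁻¹ = ε) (g : G) :
    ¬ (f g = ε + 1 ∧ f (n⁻¹ * g) = ε + 1) := by
  have hε : ε ≠ ε + 1 := (by decide : ∀ e : ZMod 2, e ≠ e + 1) ε
  have hn' : χ n⁻¹ = 0 := by rw [hs.map_inv, hn, neg_zero]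
  have hnK' : n⁻¹ ∉ K T χ L := by
    intro h
    have : n⁻¹ ∈ hs.Stab (Set.Icc (-L) L) := ⟨hn', h⟩
    rw [inv_mem_iff] at this
    exact hnK this.2
  induction hs.conn g with
  | refl =>
    rintro ⟨_, h⟩
    rw [mul_one, h2] at h
    exact hε h
  | @tail b c _ h ih =>
    rintro ⟨hc1, hc2⟩
    have hbc := h.2.2
    by_cases hcK : c ∈ K T χ L
    · rw [hs.f_const hf hn hnK hcK, h2] at hc2
      exact hε hc2
    by_cases hcK' : n⁻¹ * c ∈ K T χ L
    · have := hs.f_const hf hn' hnK' hcK'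
      rw [inv_inv, mul_inv_cancel_left, h1, hc1] at this
      exact hε this.symm
    apply ih
    have e1 := hf b c hbc
    have e2 := hf (n⁻¹ * b) (n⁻¹ * c) (by simpa [mul_assoc] using hbc)
    rw [cross, if_neg (fun h' => hcK h'.2), add_zero] at e1
    rw [cross, if_neg (fun h' => hcK' h'.2), add_zero] at e2
    exact ⟨e1.symm.trans hc1, e2.symm.trans hc2⟩

/-- Ping-pong with half-spaces. -/
theorem free_of_types {ε : ZMod 2} {a b y : G}
    (ha : ∀ g, ¬ (f g = ε + 1 ∧ f (a⁻¹⁻¹ * g) = ε + 1))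
    (hb : ∀ g, ¬ (f g = ε + 1 ∧ f (b⁻¹⁻¹ * g) = ε + 1))
    (hab : ∀ g, ¬ (f g = ε + 1 ∧ f ((a⁻¹ * b)⁻¹⁻¹ * g) = ε + 1))
    (hy : ∀ g, ¬ (f g = ε ∧ f (y⁻¹⁻¹ * g) = ε)) :
    ∃ φ : FreeGroup Bool →* G, Function.Injective φ := by
  simp only [inv_inv] at ha hb hab hy
  have hz : ∀ z : ZMod 2, z ≠ ε + 1 → z = ε :=
    (by decide : ∀ e z : ZMod 2, z ≠ e + 1 → z = e) ε
  have hz' : ∀ z : ZMod 2, z ≠ ε → z = ε + 1 :=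
    (by decide : ∀ e z : ZMod 2, z ≠ e → z = e + 1) ε
  refine ping_pong {g | f g = ε + 1} (fun i => cond i b a) y ?_ ?_ ?_
  · rintro (_ | _) g hg hg'
    · exact ha g ⟨hg, hg'⟩
    · exact hb g ⟨hg, hg'⟩
  · intro g hg hg'
    exact hab g ⟨hg, hg'⟩
  · intro g hg
    exact hz' _ fun h => hy g ⟨hz _ hg, h⟩

theorem main (hs : Setup T χ L) (hT : T.Finite) (S : Set G) (hS : Subgroup.closure S = ⊤)
    (hf1 : f 1 = 0) (hf : ∀ g h, g⁻¹ * h ∈ T → f h = f g + cross T χ L g h)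
    (hp : ¬ CayleyConnected S χ) (hm : ¬ CayleyConnected S (fun g => - χ g)) :
    ∃ φ : FreeGroup Bool →* G, Function.Injective φ := by
  have hL := hs.Lpos
  obtain ⟨t, ht, htL⟩ := hs.pos
  set Np := hs.Stab (Set.Ici (-L)) with hNp
  set Nm := hs.Stab (Set.Iic L) with hNm
  set A := hs.Stab (Set.Icc (-L) L) with hA
  have hneg : ∀ n, n ∈ hs.neg.Stab (Set.Ici (-L)) ↔ n ∈ Nm := fun n =>
    hs.mem_stab_neg (fun r => by simp)
  have hAp : A ≤ Np := hs.stab_mono Set.Icc_subset_Ici_self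
  have hAm : A ≤ Nm := hs.stab_mono Set.Icc_subset_Iic_self
  have hAK : ∀ n, χ n = 0 → n ∉ A → n ∉ K T χ L := fun n h0 hn hK => hn ⟨h0, hK⟩
  have fp : ∀ n ∈ Np, n ∉ A → f n = 0 := by
    intro n hn hnA
    rw [hs.f_up hf1 hf hn.2, if_neg (hAK n hn.1 hnA)]
  have fm : ∀ n ∈ Nm, n ∉ A → f n = 1 := by
    intro n hn hnA
    rw [hs.f_down hf1 hf hn.2, if_neg (hAK n hn.1 hnA)]
  have inter : ∀ n, n ∈ Np → n ∈ Nm → n ∈ A := by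
    intro n h1 h2
    by_contra h3
    have := (fp n h1 h3).symm.trans (fm n h2 h3)
    exact absurd this (by decide)
  have typ : ∀ n ∈ Np, n ∉ A → ∀ g, ¬ (f g = 0 + 1 ∧ f (n⁻¹ * g) = 0 + 1) := by
    intro n hn hnA
    exact hs.nest hf1 hf hn.1 (hAK n hn.1 hnA) (fp n hn hnA)
      (fp _ (Np.inv_mem hn) (fun h => hnA (inv_mem_iff.1 h)))
  have tym : ∀ n ∈ Nm, n ∉ A → ∀ g, ¬ (f g = 1 + 1 ∧ f (n⁻¹ * g) = 1 + 1) := by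
    intro n hn hnA
    exact hs.nest hf1 hf hn.1 (hAK n hn.1 hnA) (fm n hn hnA)
      (fm _ (Nm.inv_mem hn) (fun h => hnA (inv_mem_iff.1 h)))
  obtain ⟨np, hnp0, hnp⟩ : ∃ n, χ n = 0 ∧ n ∉ Np := by
    by_contra! hcon
    exact hp (hs.connected_of_up hT S hS hcon)
  obtain ⟨nm, hnm0, hnm⟩ : ∃ n, χ n = 0 ∧ n ∉ Nm := by
    by_contra! hcon
    exact hm (hs.neg.connected_of_up hT S hS
      (fun n hn => (hneg n).2 (hcon n (by simpa using hn))))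
  obtain ⟨x, hx, hxA⟩ : ∃ x ∈ Np, x ∉ A := by
    by_contra! hcon
    exact hnm (hs.generate Nm (fun n hn => hAm (hcon n hn)) le_rfl hnm0)
  obtain ⟨y, hy, hyA⟩ : ∃ y ∈ Nm, y ∉ A := by
    by_contra! hcon
    exact hnp (hs.generate Np le_rfl (fun n hn => hAp (hcon n hn)) hnp0)
  have ht' : t⁻¹ ∈ T := hs.inv t ht
  have htL' : - χ t⁻¹ = L := by rw [hs.map_inv, neg_neg, htL]
  have cp : ∀ n ∈ Np, t * n * t⁻¹ ∈ Np := fun n hn => hs.conj_up ht htL hn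
  have cm : ∀ n ∈ Nm, t⁻¹ * n * t ∈ Nm := by
    intro n hn
    have := hs.neg.conj_up ht' htL' ((hneg n).2 hn)
    rw [inv_inv] at this
    exact (hneg _).1 this
  obtain ⟨z, hz, hz'⟩ : ∃ z ∈ Nm, t * z * t⁻¹ ∉ Nm := by
    by_contra! hcon
    refine hnm ((hneg _).1 (hs.neg.up_eq_of_conj ht' htL' ?_ (by simpa using hnm0)))
    intro n hn
    rw [inv_inv]
    exact (hneg _).2 (hcon n ((hneg _).1 hn))
  by_cases h3p : ∃ a ∈ Np, ∃ b ∈ Np, a ∉ A ∧ b ∉ A ∧ a⁻¹ * b ∉ A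
  · obtain ⟨a, ha, b, hb, haA, hbA, hab⟩ := h3p
    have tp : ∀ n ∈ Np, n ∉ A → ∀ g, ¬ (f g = 0 + 1 ∧ f (n⁻¹⁻¹ * g) = 0 + 1) := fun n hn hnA =>
      typ _ (Np.inv_mem hn) (fun h => hnA (inv_mem_iff.1 h))
    exact free_of_types (f := f) (ε := 0) (tp a ha haA) (tp b hb hbA)
      (tp _ (Np.mul_mem (Np.inv_mem ha) hb) hab)
      (tym _ (Nm.inv_mem hy) (fun h => hyA (inv_mem_iff.1 h)))
  by_cases h3m : ∃ a ∈ Nm, ∃ b ∈ Nm, a ∉ A ∧ b ∉ A ∧ a⁻¹ * b ∉ A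
  · obtain ⟨a, ha, b, hb, haA, hbA, hab⟩ := h3m
    have tm : ∀ n ∈ Nm, n ∉ A → ∀ g, ¬ (f g = 1 + 1 ∧ f (n⁻¹⁻¹ * g) = 1 + 1) := fun n hn hnA =>
      tym _ (Nm.inv_mem hn) (fun h => hnA (inv_mem_iff.1 h))
    have ty := typ _ (Np.inv_mem hx) (fun h => hxA (inv_mem_iff.1 h))
    rw [zero_add] at ty
    exact free_of_types (f := f) (ε := 1) (tm a ha haA) (tm b hb hbA)
      (tm _ (Nm.mul_mem (Nm.inv_mem ha) hb) hab) ty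
  exfalso
  push Not at h3p h3m
  -- both indices equal to two
  have hB : ∀ b ∈ Np, t⁻¹ * b * t ∈ Nm → b ∈ A := by
    intro b hb hb'
    by_contra hbA
    have hxt : t * x * t⁻¹ ∉ A := by
      intro h
      have := cm _ (hAm h)
      have e : t⁻¹ * (t * x * t⁻¹) * t = x := by group
      rw [e] at this
      exact hxA (inter x hx this)
    have h1 := cm _ (hAm (h3p b hb _ (cp x hx) hbA hxt))
    have h2 := Nm.mul_mem hb' h1
    have e : t⁻¹ * b * t * (t⁻¹ * (b⁻¹ * (t * x * t⁻¹)) * t) = x := by group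
    rw [e] at h2
    exact hxA (inter x hx h2)
  have hB' : ∀ w ∈ A, t * w * t⁻¹ ∈ A := by
    intro w hw
    refine hB _ (cp w (hAp hw)) ?_
    have e : t⁻¹ * (t * w * t⁻¹) * t = w := by group
    rw [e]
    exact hAm hw
  have hzA : z ∉ A := fun h => hz' (hAm (hB' z h))
  have hyt : t⁻¹ * y * t ∉ A := by
    intro h
    have := hB' _ h
    have e : t * (t⁻¹ * y * t) * t⁻¹ = y := by group
    rw [e] at this
    exact hyA this
  have h1 := hAm (hB' _ (h3m z hz _ (cm y hy) hzA hyt))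
  have h2 := Nm.mul_mem hy (Nm.inv_mem h1)
  have e : y * (t * (z⁻¹ * (t⁻¹ * y * t)) * t⁻¹)⁻¹ = t * z * t⁻¹ := by group
  rw [e] at h2
  exact hz' h2

end half

end Setup
end BNS

/-- Theorem C of Bieri–Neumann–Strebel: if a finitely presented group `G` contains no
nonabelian free subgroup, then for every nontrivial homomorphism `χ : G → ℝ` at least one
of the graphs `C_χ` and `C_(-χ)` is connected; equivalently `Σ(G) ∪ -Σ(G) = S(G)`. -/
theorem bns_union_antipodal_of_no_free_subgroup
    {G : Type*} [Group G] (hfp : FinitelyPresentedGroup G)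
    (hfree : ¬ ∃ (H : Subgroup G) (ι : Type) (_ : FreeGroup ι ≃* H), ¬ ∀ a b : H, a * b = b * a)
    (S : Finset G) (hS : Subgroup.closure (S : Set G) = ⊤) :
    ∀ (χ : G → ℝ), (∀ a b : G, χ (a * b) = χ a + χ b) → (∃ g : G, χ g ≠ 0) →
      CayleyConnected (S : Set G) χ ∨ CayleyConnected (S : Set G) (fun g => -χ g) := by
  intro χ hχ hne
  by_contra hcon
  rw [not_or] at hcon
  obtain ⟨T, hT, h1T, hinv, hgen, hsc⟩ := BNS.exists_triangular hfp
  have h1 : χ 1 = 0 := by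
    have := hχ 1 1
    rw [mul_one] at this
    linarith
  have hχinv : ∀ g, χ g⁻¹ = - χ g := by
    intro g
    have := hχ g g⁻¹
    rw [mul_inv_cancel, h1] at this
    linarith
  obtain ⟨t, ht, hmax⟩ := hT.exists_maximalFor χ T ⟨1, h1T⟩
  have hle : ∀ s ∈ T, χ s ≤ χ t := fun s hs => by
    rcases le_total (χ s) (χ t) with h | h
    · exact h
    · exact hmax hs h
  have hconn : ∀ g, BNS.Conn T Set.univ 1 g := BNS.Conn.of_closure hgen hinv
  have hs : BNS.Setup T χ (χ t) :=
    { mul := hχ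
      one := h1T
      inv := hinv
      conn := hconn
      bd := fun s hs => by
        rw [abs_le]
        have := hle _ (hinv s hs)
        rw [hχinv] at this
        exact ⟨by linarith, hle s hs⟩
      pos := ⟨t, ht, rfl⟩
      Lpos := by
        by_contra hneg
        obtain ⟨g, hg⟩ := hne
        apply hg
        clear hg
        induction hconn g with
        | refl => exact h1
        | @tail b c _ hbc ih =>
          have h2 := hle _ hbc.2.2
          have h3 := hle _ (hinv _ hbc.2.2)
          rw [hχinv, hχ, hχinv] at h3
          rw [hχ, hχinv] at h2
          linarith }
  obtain ⟨f, hf⟩ := hsc _ hs.triangle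
  obtain ⟨φ, hφ⟩ := hs.main hT (S : Set G) hS (f := fun g => f g - f 1) (sub_self _)
    (fun g h hgh => by rw [hf g h hgh]; ring) hcon.1 hcon.2
  refine hfree ⟨φ.range, Bool, MonoidHom.ofInjective hφ, fun hcomm => ?_⟩
  have h2 := hcomm ⟨φ (FreeGroup.of true), ⟨_, rfl⟩⟩ ⟨φ (FreeGroup.of false), ⟨_, rfl⟩⟩
  have h3 := congrArg Subtype.val h2
  simp only [Subgroup.coe_mul, ← map_mul] at h3
  have h4 := congrArg FreeGroup.toWord (hφ h3)
  revert h4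
  decide
end

section
/- Let G be a finitely generated group with finite generating set S, and let N be a normal subgroup of G such that the quotient G/N is abelian and nontrivial. Then N is finitely generated if and only if for every nontrivial homomorphism χ : G → (ℝ, +) with χ(N) = {0}, the graph C_χ is connected. Equivalently, N is finitely generated if and only if S(G, N) ⊆ Σ(G), where S(G, N) = {[χ] ∈ S(G) : χ(N) = 0}. -/
open Filter Topology

/-- Paths in the Cayley graph through vertices satisfying `P`. -/
def BnsPath {G : Type*} [Group G] (A : Set G) (P : G → Prop) : G → G → Prop :=
  Relation.ReflTransGen (fun x y => (∃ s ∈ A, y = x * s) ∧ P x ∧ P y)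

section paths
variable {G : Type*} [Group G]

lemma bns_symm {A : Set G} (hA : ∀ s ∈ A, s⁻¹ ∈ A) {P : G → Prop} {x y : G}
    (h : BnsPath A P x y) : BnsPath A P y x := by
  induction h with
  | refl => exact Relation.ReflTransGen.refl
  | tail _ h ih =>
    obtain ⟨⟨s, hs, rfl⟩, ha, hb⟩ := h
    exact Relation.ReflTransGen.head ⟨⟨s⁻¹, hA s hs, by group⟩, hb, ha⟩ ih

lemma bns_translate {A : Set G} {P Q : G → Prop} (v : G) (hPQ : ∀ x, P x → Q (v * x)) {x y : G}
    (h : BnsPath A P x y) : BnsPath A Q (v * x) (v * y) := by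
  induction h with
  | refl => exact Relation.ReflTransGen.refl
  | tail _ h ih =>
    obtain ⟨⟨s, hs, rfl⟩, ha, hb⟩ := h
    exact Relation.ReflTransGen.tail ih ⟨⟨s, hs, by group⟩, hPQ _ ha, hPQ _ hb⟩

lemma bns_end {A : Set G} {P : G → Prop} {x y : G}
    (h : BnsPath A P x y) (hx : P x) : P y := by
  induction h with
  | refl => exact hx
  | tail _ h _ => exact h.2.2

lemma bns_step {A : Set G} {P : G → Prop} {x s : G} (hs : s ∈ A) (hx : P x) (hy : P (x * s)) :
    BnsPath A P x (x * s) :=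
  Relation.ReflTransGen.single ⟨⟨s, hs, rfl⟩, hx, hy⟩

lemma bns_of_list {A : Set G} {P : G → Prop} (l : List G) : ∀ (g : G), (∀ s ∈ l, s ∈ A) →
    (∀ i ≤ l.length, P (g * (l.take i).prod)) → BnsPath A P g (g * l.prod) := by
  induction l with
  | nil => intro g _ _; rw [List.prod_nil, mul_one]; exact Relation.ReflTransGen.refl
  | cons a l ih =>
    intro g hl hP
    have h0 := hP 0 (by simp)
    have h1 := hP 1 (by simp)
    simp only [List.take_zero, List.prod_nil, mul_one] at h0
    simp at h1
    have h2 := ih (g * a) (fun s hs => hl s (by simp [hs])) (by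
      intro i hi
      have := hP (i + 1) (by simpa using hi)
      simpa [mul_assoc] using this)
    rw [List.prod_cons, ← mul_assoc]
    exact (bns_step (hl a (by simp)) h0 h1).trans h2

lemma bns_to_list {A : Set G} {P : G → Prop} (h1 : P 1) {y : G} (h : BnsPath A P 1 y) :
    ∃ l : List G, (∀ s ∈ l, s ∈ A) ∧ l.prod = y ∧ ∀ i ≤ l.length, P (l.take i).prod := by
  induction h with
  | refl => exact ⟨[], by simp, by simp, by simpa using h1⟩
  | tail _ h ih =>
    obtain ⟨l, hl, hp, ht⟩ := ih
    obtain ⟨⟨s, hs, rfl⟩, hx, hy⟩ := h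
    refine ⟨l ++ [s], ?_, by simp [hp], ?_⟩
    · intro a ha
      rcases List.mem_append.1 ha with h | h
      · exact hl a h
      · simp at h; exact h ▸ hs
    · intro i hi
      rcases Nat.lt_or_ge l.length i with h | h
      · rw [List.take_of_length_le (by simp; omega)]
        simpa [hp] using hy
      · rw [List.take_append_of_le_length h]
        exact ht i h

end paths

section forward
variable {G : Type*} [Group G]

lemma bns_forward (S : Finset G) (hS : Subgroup.closure (S : Set G) = ⊤)
    (N : Subgroup G) [N.Normal]
    (hab : ∀ a b : G, a * b * a⁻¹ * b⁻¹ ∈ N) (hN : N.FG) (χ : G → ℝ)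
    (hχ : ∀ a b : G, χ (a * b) = χ a + χ b) (t : G) (ht : t ∈ (S : Set G) ∪ (S : Set G)⁻¹)
    (hpos : 0 < χ t)
    (hχN : ∀ n ∈ N, χ n = 0) : CayleyConnected (S : Set G) χ := by
  set A : Set G := (S : Set G) ∪ (S : Set G)⁻¹ with hAdef
  have hA : ∀ s ∈ A, s⁻¹ ∈ A := by
    intro s hs
    rcases hs with h | h
    · right; simpa using h
    · left; simpa using h
  have hone : χ 1 = 0 := by have := hχ 1 1; simp at this; exact this
  -- positive and negative monoids
  set Mp := Submonoid.closure {s | s ∈ A ∧ 0 ≤ χ s} with hMp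
  set Mn := Submonoid.closure {s | s ∈ A ∧ χ s ≤ 0} with hMn
  have hMp1 : ∀ a ∈ Mp, 0 ≤ χ a ∧ ∀ y, 0 ≤ χ y → BnsPath A (fun x => 0 ≤ χ x) y (y * a) := by
    intro a ha
    induction ha using Submonoid.closure_induction with
    | mem s hs =>
      refine ⟨hs.2, fun y hy => bns_step hs.1 hy ?_⟩
      have := hs.2
      rw [hχ]; linarith
    | one => exact ⟨hone.ge, fun y _ => by rw [mul_one]; exact Relation.ReflTransGen.refl⟩
    | mul a b _ _ iha ihb =>
      refine ⟨by rw [hχ]; linarith [iha.1, ihb.1], fun y hy => ?_⟩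
      rw [← mul_assoc]
      exact (iha.2 y hy).trans (ihb.2 (y * a) (by rw [hχ]; linarith [iha.1]))
  have hMn1 : ∀ a ∈ Mn, χ a ≤ 0 ∧ ∀ y, 0 ≤ χ (y * a) →
      BnsPath A (fun x => 0 ≤ χ x) y (y * a) := by
    intro a ha
    induction ha using Submonoid.closure_induction with
    | mem s hs =>
      refine ⟨hs.2, fun y hy => bns_step hs.1 ?_ hy⟩
      have := hs.2
      rw [hχ] at hy; linarith
    | one => exact ⟨hone.le, fun y _ => by rw [mul_one]; exact Relation.ReflTransGen.refl⟩
    | mul a b _ _ iha ihb =>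
      refine ⟨by rw [hχ]; linarith [iha.1, ihb.1], fun y hy => ?_⟩
      rw [← mul_assoc] at hy ⊢
      have : 0 ≤ χ (y * a) := by rw [hχ] at hy; linarith [ihb.1]
      exact (iha.2 y this).trans (ihb.2 (y * a) hy)
  -- everything is a * b * n; work in the quotient
  have hcomm : ∀ x y : G ⧸ N, x * y = y * x := by
    intro x y
    induction x using QuotientGroup.induction_on with | H x => ?_
    induction y using QuotientGroup.induction_on with | H y => ?_
    rw [← QuotientGroup.mk_mul, ← QuotientGroup.mk_mul, QuotientGroup.eq]
    have := hab y⁻¹ x⁻¹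
    simpa [mul_assoc] using this
  have hletter : ∀ s ∈ A, ∃ a ∈ Mp, ∃ b ∈ Mn, (s : G ⧸ N) = (a : G ⧸ N) * (b : G ⧸ N) := by
    intro s hs
    rcases le_total 0 (χ s) with h | h
    · exact ⟨s, Submonoid.subset_closure ⟨hs, h⟩, 1, one_mem _, by simp⟩
    · exact ⟨1, one_mem _, s, Submonoid.subset_closure ⟨hs, h⟩, by simp⟩
  have hdec : ∀ x : G, ∃ a ∈ Mp, ∃ b ∈ Mn, (x : G ⧸ N) = (a : G ⧸ N) * (b : G ⧸ N) := by
    intro x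
    have hx : x ∈ Subgroup.closure (S : Set G) := by rw [hS]; trivial
    rw [← Subgroup.mem_toSubmonoid, Subgroup.closure_toSubmonoid] at hx
    induction hx using Submonoid.closure_induction with
    | mem s hs => exact hletter s hs
    | one => exact ⟨1, one_mem _, 1, one_mem _, by simp⟩
    | mul x y _ _ ihx ihy =>
      obtain ⟨a, ha, b, hb, h⟩ := ihx
      obtain ⟨a', ha', b', hb', h'⟩ := ihy
      refine ⟨a * a', mul_mem ha ha', b * b', mul_mem hb hb', ?_⟩
      rw [QuotientGroup.mk_mul, h, h', QuotientGroup.mk_mul, QuotientGroup.mk_mul]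
      rw [mul_assoc, mul_assoc, ← mul_assoc (b : G ⧸ N), hcomm (b : G ⧸ N) a', mul_assoc]
  -- arbitrary words with bounded depth
  have hword : ∀ x : G, ∀ y : G, ∀ᶠ D : ℝ in atTop, BnsPath A (fun x => -D ≤ χ x) y (y * x) := by
    intro x
    have hx : x ∈ Subgroup.closure (S : Set G) := by rw [hS]; trivial
    induction hx using Subgroup.closure_induction with
    | mem s hs =>
      intro y
      filter_upwards [eventually_ge_atTop (-χ y), eventually_ge_atTop (-χ (y * s))] with D h1 h2
      exact bns_step (Or.inl hs) (by linarith) (by linarith)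
    | one =>
      intro y
      exact Eventually.of_forall fun D => by rw [mul_one]; exact Relation.ReflTransGen.refl
    | mul a b _ _ iha ihb =>
      intro y
      filter_upwards [iha y, ihb (y * a)] with D h1 h2
      rw [← mul_assoc]; exact h1.trans h2
    | inv a _ ih =>
      intro y
      filter_upwards [ih (y * a⁻¹)] with D h1
      have := bns_symm hA h1
      simpa using this
  obtain ⟨T, hT⟩ := hN
  have hD : ∀ᶠ D : ℝ in atTop, ∀ τ ∈ T, BnsPath A (fun x => -D ≤ χ x) 1 (1 * τ) :=
    (Filter.eventually_all_finset T).2 fun τ _ => hword τ 1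
  obtain ⟨D, hD, hD0⟩ := (hD.and (eventually_ge_atTop 0)).exists
  have hNpath : ∀ n ∈ N, ∀ y, 0 ≤ χ y → BnsPath A (fun x => -D ≤ χ x) y (y * n) := by
    intro n hn
    rw [← hT] at hn
    induction hn using Subgroup.closure_induction with
    | mem s hs =>
      intro y hy
      have := bns_translate (Q := fun x => -D ≤ χ x) y (fun x hx => by rw [hχ]; linarith)
        (hD s hs)
      simpa using this
    | one => intro y _; rw [mul_one]; exact Relation.ReflTransGen.refl
    | mul a b ha _ iha ihb =>
      intro y hy
      rw [← mul_assoc]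
      rw [hT] at ha
      exact (iha y hy).trans (ihb _ (by rw [hχ, hχN a ha]; linarith))
    | inv a ha ih =>
      intro y hy
      rw [hT] at ha
      have := bns_symm hA (ih (y * a⁻¹) (by rw [hχ, hχN _ (inv_mem ha)]; linarith))
      simpa using this
  have hmono : ∀ x y, BnsPath A (fun x => 0 ≤ χ x) x y → BnsPath A (fun x => -D ≤ χ x) x y := by
    intro x y h
    have := bns_translate (Q := fun x => -D ≤ χ x) 1
      (fun x (hx : 0 ≤ χ x) => by rw [one_mul]; linarith) h
    simpa using this
  have hdeep : ∀ x, 0 ≤ χ x → BnsPath A (fun x => -D ≤ χ x) 1 x := by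
    intro x hx
    obtain ⟨a, ha, b, hb, h⟩ := hdec x
    rw [← QuotientGroup.mk_mul, eq_comm, QuotientGroup.eq] at h
    have hxe : x = a * b * ((a * b)⁻¹ * x) := by group
    have hv : χ x = χ (a * b) := by
      conv_lhs => rw [hxe]
      rw [hχ, hχN _ h, add_zero]
    have h1 := (hMp1 a ha).2 1 hone.ge
    rw [one_mul] at h1
    have h2 := (hMn1 b hb).2 a (by linarith)
    have h3 := hNpath _ h (a * b) (by linarith)
    rw [← hxe] at h3
    exact (hmono _ _ (h1.trans h2)).trans h3
  intro g hg
  refine bns_to_list (P := fun x => 0 ≤ χ x) hone.ge ?_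
  obtain ⟨k, hk⟩ := exists_nat_ge (D / χ t)
  have hk' : D ≤ χ (t ^ k) := by
    have : ∀ m : ℕ, χ (t ^ m) = m * χ t := by
      intro m
      induction m with
      | zero => simp [hone]
      | succ m ih => rw [pow_succ, hχ, ih]; push_cast; ring
    rw [this]
    exact (div_le_iff₀ hpos).1 hk
  have htp : t ∈ Mp := Submonoid.subset_closure ⟨ht, hpos.le⟩
  have htk : t ^ k ∈ Mp := pow_mem htp k
  have h1 := (hMp1 _ htk).2 1 hone.ge
  rw [one_mul] at h1
  have h3 := bns_symm hA ((hMp1 _ htk).2 g hg)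
  have hinv : χ (t ^ k)⁻¹ = - χ (t ^ k) := by
    have := hχ (t ^ k)⁻¹ (t ^ k)
    rw [inv_mul_cancel, hone] at this
    linarith
  have h2 := bns_translate (Q := fun x => 0 ≤ χ x) (t ^ k)
    (fun x hx => by rw [hχ]; linarith) (hdeep ((t ^ k)⁻¹ * g * t ^ k) (by
      rw [hχ, hχ, hinv]; linarith))
  have e : t ^ k * ((t ^ k)⁻¹ * g * t ^ k) = g * t ^ k := by group
  rw [mul_one, e] at h2
  exact (h1.trans h2).trans h3

end forward

section backward
variable {G : Type*} [Group G]

lemma bns_backward (S : Finset G) (hS : Subgroup.closure (S : Set G) = ⊤)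
    {ι : Type*} [Fintype ι] (p : G → ι → ℤ) (hp : ∀ a b, p (a * b) = p a + p b)
    (hsurj : Function.Surjective p)
    (hχ : ∀ u : ι → ℝ, u ≠ 0 → CayleyConnected (S : Set G) (fun g => ∑ i, u i * (p g i : ℝ)))
    (K : Subgroup G) (hK : ∀ g, g ∈ K ↔ p g = 0) : K.FG := by
  classical
  set A : Set G := (S : Set G) ∪ (S : Set G)⁻¹ with hAdef
  have hA : ∀ s ∈ A, s⁻¹ ∈ A := by
    intro s hs
    rcases hs with h | h
    · right; simpa using h
    · left; simpa using h
  have hAfin : A.Finite := S.finite_toSet.union S.finite_toSet.inv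
  have hp1 : p 1 = 0 := by have := hp 1 1; simp at this; exact this
  have hpinv : ∀ a, p a⁻¹ = - p a := by
    intro a
    have := hp a⁻¹ a
    rw [inv_mul_cancel, hp1] at this
    exact eq_neg_of_add_eq_zero_left this.symm
  let B : (ι → ℝ) → G → ℝ := fun u g => ∑ i, u i * (p g i : ℝ)
  have hB : ∀ u a b, B u (a * b) = B u a + B u b := by
    intro u a b
    simp only [B, hp, Pi.add_apply, Int.cast_add, mul_add, Finset.sum_add_distrib]
  have hBc : ∀ x, Continuous fun u => B u x := by
    intro x; simp only [B]; fun_prop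
  have hB1 : ∀ u, B u 1 = 0 := by intro u; simp [B, hp1]
  have hBinv : ∀ u a, B u a⁻¹ = - B u a := by intro u a; simp [B, hpinv]
  let q : G → ℤ := fun g => ∑ i, (p g i) ^ 2
  have hq0 : ∀ g, 0 ≤ q g := fun g => Finset.sum_nonneg fun i _ => sq_nonneg _
  let good : ℝ → (ι → ℝ) → G → Prop := fun k u x => (q x : ℝ) < 2 * (k * B u x)
  have hgood : ∀ u x, 0 < B u x → ∀ᶠ z : ℝ × (ι → ℝ) in atTop ×ˢ 𝓝 u, good z.1 z.2 x := by
    intro u x h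
    have h1 : Tendsto (fun z : ℝ × (ι → ℝ) => z.1 * B z.2 x) (atTop ×ˢ 𝓝 u) atTop :=
      Filter.Tendsto.atTop_mul_pos h tendsto_fst
        (((hBc x).tendsto u).comp tendsto_snd)
    filter_upwards [h1.eventually_gt_atTop ((q x : ℝ) / 2)] with z hz
    simp only [good]; linarith
  have hgoodpath : ∀ u x y, BnsPath A (fun g => 0 < B u g) x y →
      ∀ᶠ z : ℝ × (ι → ℝ) in atTop ×ˢ 𝓝 u, BnsPath A (good z.1 z.2) x y := by
    intro u x y h
    induction h with
    | refl => exact Eventually.of_forall fun _ => Relation.ReflTransGen.refl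
    | tail _ h ih =>
      obtain ⟨hs, h1, h2⟩ := h
      filter_upwards [ih, hgood u _ h1, hgood u _ h2] with z hz h1 h2
      exact Relation.ReflTransGen.tail hz ⟨hs, h1, h2⟩
  let PP : ℝ × (ι → ℝ) → Prop := fun z => ∃ t ∈ A, good z.1 z.2 t ∧
    ∀ s ∈ A, 0 ≤ B z.2 s → BnsPath A (good z.1 z.2) t (s * t)
  have hlocal : ∀ u : ι → ℝ, u ≠ 0 → ∀ᶠ z in atTop ×ˢ 𝓝 u, PP z := by
    intro u hu
    have hex : ∃ t ∈ A, 0 < B u t := by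
      by_contra! hcon
      have hz : ∀ g, B u g = 0 := by
        intro g
        have hg : g ∈ Subgroup.closure (S : Set G) := by rw [hS]; trivial
        induction hg using Subgroup.closure_induction with
        | mem s hs =>
          have h1 := hcon s (Or.inl hs)
          have h2 := hcon s⁻¹ (hA s (Or.inl hs))
          rw [hBinv] at h2
          linarith
        | one => exact hB1 u
        | mul a b _ _ ha hb => rw [hB, ha, hb, add_zero]
        | inv a _ ha => rw [hBinv, ha, neg_zero]
      apply hu
      funext i
      obtain ⟨g, hg⟩ := hsurj (Pi.single i 1)
      have := hz g
      simp only [B, hg] at this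
      rw [Finset.sum_eq_single i] at this
      · simpa using this
      · intro j _ hj; simp [Pi.single_eq_of_ne hj]
      · simp
    obtain ⟨t, ht, hpos⟩ := hex
    have hall : ∀ᶠ z : ℝ × (ι → ℝ) in atTop ×ˢ 𝓝 u, ∀ s ∈ A, 0 ≤ B z.2 s →
        BnsPath A (good z.1 z.2) t (s * t) := by
      refine (Filter.eventually_all_finite hAfin).2 fun s hs => ?_
      rcases lt_or_ge (B u s) 0 with h | h
      · have : ∀ᶠ z : ℝ × (ι → ℝ) in atTop ×ˢ 𝓝 u, B z.2 s < 0 :=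
          tendsto_snd.eventually (((hBc s).tendsto u).eventually_lt_const h)
        filter_upwards [this] with z hz hz'
        exact absurd hz' (not_le.2 hz)
      · have hpath : BnsPath A (fun g => 0 < B u g) t (s * t) := by
          obtain ⟨l, hl, hprod, htake⟩ := hχ u hu (t⁻¹ * s * t) (by
            change 0 ≤ B u (t⁻¹ * s * t)
            rw [hB, hB, hBinv]; linarith)
          have := bns_of_list (A := A) (P := fun g => 0 < B u g) l t hl (by
            intro i hi
            have h2 : 0 ≤ B u (l.take i).prod := htake i hi
            rw [hB]; linarith)
          rw [hprod] at this
          simpa [mul_assoc] using this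
        filter_upwards [hgoodpath u _ _ hpath] with z hz _
        exact hz
    filter_upwards [hall, hgood u t hpos] with z hz h1
    exact ⟨t, ht, h1, hz⟩
  have hcpt : IsCompact (Metric.sphere (0 : ι → ℝ) 1) := isCompact_sphere _ _
  have hmem : {z | PP z} ∈ (atTop : Filter ℝ) ×ˢ 𝓝ˢ (Metric.sphere (0 : ι → ℝ) 1) := by
    refine hcpt.mem_prod_nhdsSet_of_forall fun u hu => hlocal u ?_
    rintro rfl
    simp at hu
  obtain ⟨k, hk0, hkP⟩ : ∃ k : ℝ, 0 < k ∧ ∀ u ∈ Metric.sphere (0 : ι → ℝ) 1, PP (k, u) := by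
    obtain ⟨U, hU, V, hV, hUV⟩ := Filter.mem_prod_iff.1 hmem
    obtain ⟨k, hk, hk0⟩ := ((show ∀ᶠ k in atTop, k ∈ U from hU).and (eventually_gt_atTop 0)).exists
    exact ⟨k, hk0, fun u hu => hUV (Set.mk_mem_prod hk (subset_of_mem_nhdsSet hV hu))⟩
  obtain ⟨R, hR⟩ := exists_nat_ge ((Fintype.card ι : ℝ) * k ^ 2)
  -- key local lemma
  have hqmul : ∀ v x, q (v * x) = q v + 2 * (∑ i, p v i * p x i) + q x := by
    intro v x
    simp only [q, hp, Pi.add_apply, Finset.mul_sum, ← Finset.sum_add_distrib]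
    exact Finset.sum_congr rfl fun i _ => by ring
  have hkey : ∀ v : G, (R : ℤ) < q v → ∃ t ∈ A, q (v * t) ≤ q v - 1 ∧
      ∀ s ∈ A, q (v * s) ≤ q v →
        BnsPath A (fun g => q g ≤ q v - 1) (v * t) (v * (s * t)) := by
    intro v hv
    let w : ι → ℝ := fun i => (p v i : ℝ)
    have hqw : (q v : ℝ) ≤ (Fintype.card ι : ℝ) * ‖w‖ ^ 2 := by
      have : ∀ i ∈ Finset.univ, ((p v i : ℝ)) ^ 2 ≤ ‖w‖ ^ 2 := by
        intro i _
        have := norm_le_pi_norm w i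
        rw [← sq_abs]
        exact pow_le_pow_left₀ (abs_nonneg _) this 2
      have h2 := Finset.sum_le_card_nsmul _ _ _ this
      simp only [q]
      push_cast
      simpa using h2
    have hkw : k < ‖w‖ := by
      by_contra! hcon
      have h1 : ‖w‖ ^ 2 ≤ k ^ 2 := pow_le_pow_left₀ (norm_nonneg _) hcon 2
      have h2 : (Fintype.card ι : ℝ) * ‖w‖ ^ 2 ≤ (Fintype.card ι : ℝ) * k ^ 2 := by gcongr
      have h3 : ((R : ℤ) : ℝ) < (q v : ℝ) := by exact_mod_cast hv
      push_cast at h3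
      linarith
    have hM : 0 < ‖w‖ := hk0.trans hkw
    let u : ι → ℝ := (-‖w‖⁻¹) • w
    have hu : u ∈ Metric.sphere (0 : ι → ℝ) 1 := by
      rw [mem_sphere_zero_iff_norm, norm_smul, norm_neg, norm_inv, norm_norm]
      exact inv_mul_cancel₀ hM.ne'
    have hBu : ∀ x, ‖w‖ * B u x = - ((∑ i, p v i * p x i : ℤ) : ℝ) := by
      intro x
      simp only [B]
      push_cast
      rw [Finset.mul_sum, ← Finset.sum_neg_distrib]
      refine Finset.sum_congr rfl fun i _ => ?_
      have hui : u i = -‖w‖⁻¹ * (p v i : ℝ) := rfl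
      rw [hui]
      field_simp
    have hgq : ∀ x, good k u x → q (v * x) ≤ q v - 1 := by
      intro x hx
      simp only [good] at hx
      have h0 : (0 : ℝ) ≤ q x := by exact_mod_cast hq0 x
      have h1 : 0 < B u x := by
        by_contra! h
        have := mul_nonpos_of_nonneg_of_nonpos hk0.le h
        linarith
      have h2 : k * B u x < ‖w‖ * B u x := mul_lt_mul_of_pos_right hkw h1
      rw [hBu] at h2
      have h3 : (q x : ℝ) < 2 * - ((∑ i, p v i * p x i : ℤ) : ℝ) := by linarith
      have h4 : q x < 2 * - (∑ i, p v i * p x i) := by exact_mod_cast h3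
      rw [hqmul]
      linarith
    obtain ⟨t, ht, hgt, hs⟩ := hkP u hu
    refine ⟨t, ht, hgq t hgt, fun s hsA hsq => ?_⟩
    refine bns_translate v hgq (hs s hsA ?_)
    rw [hqmul] at hsq
    have h1 : (∑ i, p v i * p s i) ≤ 0 := by linarith [hq0 s]
    have h2 : 0 ≤ ‖w‖ * B u s := by
      rw [hBu]
      have : ((∑ i, p v i * p s i : ℤ) : ℝ) ≤ 0 := by exact_mod_cast h1
      linarith
    exact nonneg_of_mul_nonneg_right h2 hM
  -- descent
  have hdesc : ∀ r : ℤ, (R : ℤ) < r → ∀ g h, q g ≤ r - 1 → q h ≤ r - 1 →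
      BnsPath A (fun x => q x ≤ r) g h → BnsPath A (fun x => q x ≤ r - 1) g h := by
    intro r hr g h hg hh hpath
    have hinv : g = h ∨ ∃ a, BnsPath A (fun x => q x ≤ r - 1) g a ∧ ∃ s ∈ A, h = a * s := by
      clear hh
      induction hpath with
      | refl => exact Or.inl rfl
      | @tail v b _ hvb ih =>
        obtain ⟨⟨s, hs, rfl⟩, hv, hb⟩ := hvb
        right
        rcases ih with rfl | ⟨a, ha, s', hs', hva⟩
        · exact ⟨g, Relation.ReflTransGen.refl, s, hs, rfl⟩
        have haq : q a ≤ r - 1 := bns_end (P := fun x => q x ≤ r - 1) ha hg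
        rcases lt_or_ge (q v) r with hlt | hge
        · refine ⟨v, ha.trans ?_, s, hs, rfl⟩
          rw [hva]
          exact bns_step hs' haq (by rw [← hva]; omega)
        · have hvr : q v = r := le_antisymm hv hge
          obtain ⟨t, ht, htq, hts⟩ := hkey v (by omega)
          rw [hvr] at htq hts
          have hav : a = v * s'⁻¹ := by rw [hva]; group
          have h1 := hts s'⁻¹ (hA _ hs') (by rw [← hav]; omega)
          have h2 := hts s hs hb
          have e1 : v * (s'⁻¹ * t) = a * t := by rw [hav]; group
          rw [e1] at h1
          have h3 := bns_end h1 htq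
          refine ⟨v * (s * t), ((ha.trans (bns_step ht haq h3)).trans (bns_symm hA h1)).trans h2,
            t⁻¹, hA _ ht, by group⟩
    rcases hinv with rfl | ⟨a, ha, s, hs, rfl⟩
    · exact Relation.ReflTransGen.refl
    · exact ha.trans (bns_step hs (bns_end (P := fun x => q x ≤ r - 1) ha hg) hh)
  have hdescm : ∀ m : ℕ, ∀ h, q h ≤ R → BnsPath A (fun x => q x ≤ (R : ℤ) + m) 1 h →
      BnsPath A (fun x => q x ≤ R) 1 h := by
    intro m
    have hq1 : q 1 = 0 := by simp [q, hp1]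
    induction m with
    | zero => intro h _ hpath; simpa using hpath
    | succ m ih =>
      intro h hh hpath
      refine ih h hh ?_
      have := hdesc ((R : ℤ) + (m + 1 : ℕ)) (by push_cast; omega) 1 h
        (by rw [hq1]; push_cast; omega) (by push_cast; omega) hpath
      have e : (R : ℤ) + (m + 1 : ℕ) - 1 = R + m := by push_cast; ring
      rwa [e] at this
  have hword : ∀ x : G, ∀ y : G, ∀ᶠ m : ℕ in atTop,
      BnsPath A (fun x => q x ≤ (R : ℤ) + m) y (y * x) := by
    have hev : ∀ y, ∀ᶠ m : ℕ in atTop, q y ≤ (R : ℤ) + m := by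
      intro y
      filter_upwards [eventually_ge_atTop (q y).toNat] with m hm
      omega
    intro x
    have hx : x ∈ Subgroup.closure (S : Set G) := by rw [hS]; trivial
    induction hx using Subgroup.closure_induction with
    | mem s hs =>
      intro y
      filter_upwards [hev y, hev (y * s)] with D h1 h2
      exact bns_step (Or.inl hs) h1 h2
    | one =>
      intro y
      exact Eventually.of_forall fun D => by rw [mul_one]; exact Relation.ReflTransGen.refl
    | mul a b _ _ iha ihb =>
      intro y
      filter_upwards [iha y, ihb (y * a)] with D h1 h2
      rw [← mul_assoc]; exact h1.trans h2
    | inv a _ ih =>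
      intro y
      filter_upwards [ih (y * a⁻¹)] with D h1
      have := bns_symm hA h1
      simpa using this
  have hconn : ∀ x ∈ K, BnsPath A (fun x => q x ≤ R) 1 x := by
    intro x hx
    obtain ⟨m, hm⟩ := (hword x 1).exists
    rw [one_mul] at hm
    refine hdescm m x ?_ hm
    have : q x = 0 := by simp [q, (hK x).1 hx]
    omega
  -- generators of K
  choose c hc using hsurj
  let Z : Set (ι → ℤ) := {z | ∑ i, (z i) ^ 2 ≤ (R : ℤ)}
  have hZ : Z.Finite := by
    refine (Set.finite_Icc (fun _ : ι => -(R : ℤ)) (fun _ => (R : ℤ))).subset ?_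
    intro z hz
    have h1 : ∀ i, (z i) ^ 2 ≤ (R : ℤ) := fun i =>
      (Finset.single_le_sum (f := fun i => (z i) ^ 2) (fun i _ => sq_nonneg _)
        (Finset.mem_univ i)).trans hz
    exact ⟨fun i => by have := h1 i; simp only; nlinarith,
      fun i => by have := h1 i; simp only; nlinarith⟩
  let Y : Set G := insert (c 0) ((fun w : (ι → ℤ) × G => c w.1 * w.2 * (c (w.1 + p w.2))⁻¹) ''
    (Z ×ˢ A))
  have hY : Y.Finite := ((hZ.prod hAfin).image _).insert _
  rw [Subgroup.fg_iff]
  refine ⟨Y, le_antisymm ?_ ?_, hY⟩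
  · rw [Subgroup.closure_le]
    rintro y (rfl | ⟨⟨z, s⟩, _, rfl⟩)
    · exact (hK _).2 (hc 0)
    · refine (hK _).2 ?_
      simp only [hp, hpinv, hc]
      abel
  · intro x hx
    have h0 : c 0 ∈ Subgroup.closure Y := Subgroup.subset_closure (Set.mem_insert _ _)
    have hmain : ∀ y, BnsPath A (fun x => q x ≤ R) 1 y →
        y * (c (p y))⁻¹ ∈ Subgroup.closure Y := by
      intro y hy
      induction hy with
      | refl => rw [hp1, one_mul]; exact inv_mem h0
      | @tail v b _ hvb ih =>
        obtain ⟨⟨s, hs, rfl⟩, hv, _⟩ := hvb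
        have h1 : c (p v) * s * (c (p v + p s))⁻¹ ∈ Subgroup.closure Y :=
          Subgroup.subset_closure (Set.mem_insert_of_mem _ ⟨(p v, s), ⟨hv, hs⟩, rfl⟩)
        have := mul_mem ih h1
        rw [hp]
        convert this using 1
        group
    have := mul_mem (hmain x (hconn x hx)) h0
    rw [(hK x).1 hx] at this
    simpa using this

end backward

/-- Theorem B1 of Bieri–Neumann–Strebel: for a normal subgroup `N` of a finitely generated
group `G` with `G/N` abelian and nontrivial, `N` is finitely generated iff every nontrivial
homomorphism `χ : G → ℝ` vanishing on `N` has `C_χ` connected, i.e. iff `S(G, N) ⊆ Σ(G)`. -/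
theorem normal_subgroup_fg_iff_bns
    {G : Type*} [Group G] (S : Finset G) (hS : Subgroup.closure (S : Set G) = ⊤)
    (N : Subgroup G) [N.Normal]
    (hab : ∀ a b : G, a * b * a⁻¹ * b⁻¹ ∈ N) (hnt : N ≠ ⊤) :
    N.FG ↔ ∀ (χ : G → ℝ), (∀ a b : G, χ (a * b) = χ a + χ b) → (∃ g : G, χ g ≠ 0) →
      (∀ n ∈ N, χ n = 0) → CayleyConnected (S : Set G) χ := by
  constructor
  · intro hN χ hχ hne hχN
    have hone : χ 1 = 0 := by have := hχ 1 1; simp at this; exact this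
    have hinv : ∀ a, χ a⁻¹ = - χ a := by
      intro a
      have := hχ a⁻¹ a
      rw [inv_mul_cancel, hone] at this
      linarith
    have hex : ∃ t ∈ (S : Set G) ∪ (S : Set G)⁻¹, 0 < χ t := by
      by_contra! hcon
      obtain ⟨g, hg⟩ := hne
      apply hg
      have hg : g ∈ Subgroup.closure (S : Set G) := by rw [hS]; trivial
      induction hg using Subgroup.closure_induction with
      | mem s hs =>
        have h1 := hcon s (Or.inl hs)
        have h2 := hcon s⁻¹ (Or.inr (by simpa using hs))
        rw [hinv] at h2
        linarith
      | one => exact hone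
      | mul a b _ _ ha hb => simp_all
      | inv a _ ha => simp_all
    obtain ⟨t, ht, hpos⟩ := hex
    exact bns_forward S hS N hab hN χ hχ t ht hpos hχN
  · intro h
    have hcomm : ∀ x y : G ⧸ N, x * y = y * x := by
      intro x y
      induction x using QuotientGroup.induction_on with | H x => ?_
      induction y using QuotientGroup.induction_on with | H y => ?_
      rw [← QuotientGroup.mk_mul, ← QuotientGroup.mk_mul, QuotientGroup.eq]
      have := hab y⁻¹ x⁻¹
      simpa [mul_assoc] using this
    let _ : CommGroup (G ⧸ N) := { (inferInstance : Group (G ⧸ N)) with mul_comm := hcomm }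
    have hGfg : Group.FG G := ⟨⟨S, hS⟩⟩
    have : Group.FG (G ⧸ N) := QuotientGroup.fg N
    obtain ⟨ι, j, _, _, pr, hpr, e, ⟨E⟩⟩ := CommGroup.equiv_free_prod_prod_multiplicative_zmod (G ⧸ N)
    let φ : G →* (j → Multiplicative ℤ) :=
      (MonoidHom.fst _ _).comp (E.toMonoidHom.comp (QuotientGroup.mk' N))
    let f : G →* ((i : ι) → Multiplicative (ZMod (pr i ^ e i))) :=
      (MonoidHom.snd _ _).comp (E.toMonoidHom.comp (QuotientGroup.mk' N))
    have hφ : ∀ g, φ g = (E (g : G ⧸ N)).1 := fun g => rfl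
    have hf : ∀ g, f g = (E (g : G ⧸ N)).2 := fun g => rfl
    let p : G → j → ℤ := fun g i => Multiplicative.toAdd (φ g i)
    have hp : ∀ a b, p (a * b) = p a + p b := by
      intro a b
      funext i
      simp [p]
    have hpN : ∀ n ∈ N, p n = 0 := by
      intro n hn
      funext i
      have h1 : (n : G ⧸ N) = 1 := (QuotientGroup.eq_one_iff n).2 hn
      simp [p, hφ, h1]
    have hpK : ∀ g, g ∈ φ.ker ↔ p g = 0 := by
      intro g
      rw [MonoidHom.mem_ker]
      constructor
      · intro hg; funext i; simp [p, hg]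
      · intro hg
        funext i
        have := congrFun hg i
        exact Multiplicative.toAdd.injective this
    have hsurj : Function.Surjective p := by
      intro z
      obtain ⟨x, hx⟩ := E.surjective (fun i => Multiplicative.ofAdd (z i), 1)
      obtain ⟨g, rfl⟩ := QuotientGroup.mk_surjective x
      refine ⟨g, ?_⟩
      funext i
      simp [p, hφ, hx]
    have hKfg : φ.ker.FG := by
      classical
      refine bns_backward S hS p hp hsurj (fun u hu => ?_) φ.ker hpK
      refine h _ (fun a b => ?_) ?_ (fun n hn => by simp [hpN n hn])
      · simp only [hp, Pi.add_apply, Int.cast_add, mul_add, Finset.sum_add_distrib]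
      · obtain ⟨i, hi⟩ := Function.ne_iff.1 hu
        obtain ⟨g, hg⟩ := hsurj (Pi.single i 1)
        refine ⟨g, ?_⟩
        rw [Finset.sum_eq_single i]
        · simpa [hg] using hi
        · intro k _ hk; simp [hg, Pi.single_eq_of_ne hk]
        · simp
    have hle : N ≤ φ.ker := fun n hn => (hpK n).2 (hpN n hn)
    have : Group.FG φ.ker := (Group.fg_iff_subgroup_fg _).2 hKfg
    have : ∀ i, NeZero (pr i ^ e i) := fun i => ⟨pow_ne_zero _ (hpr i).ne_zero⟩
    have : ∀ i, Finite (Multiplicative (ZMod (pr i ^ e i))) := fun i =>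
      inferInstanceAs (Finite (ZMod (pr i ^ e i)))
    have hNK : N.subgroupOf φ.ker = (f.comp φ.ker.subtype).ker := by
      ext ⟨x, hx⟩
      rw [Subgroup.mem_subgroupOf, MonoidHom.mem_ker]
      have hx1 : (E (x : G ⧸ N)).1 = 1 := hx
      change x ∈ N ↔ (E (x : G ⧸ N)).2 = 1
      rw [← QuotientGroup.eq_one_iff, ← map_eq_one_iff E E.injective, Prod.ext_iff]
      simp [hx1]
    have : (N.subgroupOf φ.ker).FiniteIndex := by
      rw [hNK]
      infer_instance
    have hfg : Group.FG (N.subgroupOf φ.ker) := inferInstance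
    have hfg2 : Group.FG N :=
      Group.fg_of_surjective (f := (Subgroup.subgroupOfEquivOfLe hle).toMonoidHom)
        (Subgroup.subgroupOfEquivOfLe hle).surjective
    exact (Group.fg_iff_subgroup_fg _).1 hfg2
end

section
/- Let G be a finitely generated group with finite generating set S. Then the commutator subgroup G' = [G, G] is finitely generated if and only if for every nontrivial homomorphism χ : G → (ℝ, +) the graph C_χ is connected, i.e., if and only if Σ(G) = S(G). -/
namespace BNSAux

open Filter Topology

section
variable {G : Type*} [Group G]

/-- One edge of the Cayley graph inside the vertex set `P`. -/
def StepIn (T P : Set G) (a b : G) : Prop := a ∈ P ∧ b ∈ P ∧ ∃ s ∈ T, b = a * s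

/-- Connectedness by a path inside `P`. -/
def Conn (T P : Set G) (a b : G) : Prop := Relation.ReflTransGen (StepIn T P) a b

theorem Conn.refl {T P : Set G} (a : G) : Conn T P a a := Relation.ReflTransGen.refl

theorem Conn.trans {T P : Set G} {a b c : G} (h : Conn T P a b) (h' : Conn T P b c) :
    Conn T P a c := Relation.ReflTransGen.trans h h'

theorem Conn.edge {T P : Set G} {a s : G} (hs : s ∈ T) (ha : a ∈ P) (hb : a * s ∈ P) :
    Conn T P a (a * s) := Relation.ReflTransGen.single ⟨ha, hb, s, hs, rfl⟩

theorem Conn.mem {T P : Set G} {a b : G} (ha : a ∈ P) (h : Conn T P a b) : b ∈ P := by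
  induction h with
  | refl => exact ha
  | tail _ h _ => exact h.2.1

theorem Conn.translate {T P P' : Set G} {a b : G} (g : G) (hP : ∀ x ∈ P, g * x ∈ P')
    (h : Conn T P a b) : Conn T P' (g * a) (g * b) := by
  induction h with
  | refl => exact Conn.refl _
  | tail _ h ih =>
    obtain ⟨hx, hy, s, hs, rfl⟩ := h
    exact ih.trans (Relation.ReflTransGen.single
      ⟨hP _ hx, hP _ hy, s, hs, by simp [mul_assoc]⟩)

theorem Conn.mono {T P P' : Set G} {a b : G} (hP : P ⊆ P') (h : Conn T P a b) :
    Conn T P' a b := by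
  simpa using h.translate 1 (P' := P') (fun x hx => by simpa using hP hx)

theorem Conn.symm {T P : Set G} (hT : ∀ s ∈ T, s⁻¹ ∈ T) {a b : G} (h : Conn T P a b) :
    Conn T P b a := by
  induction h with
  | refl => exact Conn.refl _
  | tail _ h ih =>
    obtain ⟨hx, hy, s, hs, rfl⟩ := h
    refine Conn.trans ?_ ih
    exact Relation.ReflTransGen.single ⟨hy, hx, s⁻¹, hT s hs, by simp⟩

theorem Conn.finite {T P : Set G} {a b : G} (h : Conn T P a b) :
    ∃ Q : Set G, Q.Finite ∧ Q ⊆ P ∧ Conn T Q a b := by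
  induction h with
  | refl => exact ⟨∅, Set.finite_empty, by simp, Conn.refl _⟩
  | @tail x y _ h ih =>
    obtain ⟨Q, hQ, hQP, hc⟩ := ih
    obtain ⟨hx, hy, s, hs, rfl⟩ := h
    refine ⟨insert x (insert (x * s) Q), (hQ.insert _).insert _, ?_, ?_⟩
    · intro z hz
      rcases hz with rfl | rfl | hz
      exacts [hx, hy, hQP hz]
    · exact (hc.mono (fun z hz => by simp [hz])).trans (Conn.edge hs (by simp) (by simp))

theorem symm_inv (S : Set G) : ∀ s ∈ S ∪ S⁻¹, s⁻¹ ∈ S ∪ S⁻¹ := by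
  intro s hs
  rcases hs with h | h
  · right; simpa using h
  · left; simpa using h

theorem conn_univ {S : Set G} (hS : Subgroup.closure S = ⊤) (g : G) :
    Conn (S ∪ S⁻¹) Set.univ 1 g := by
  have hg : g ∈ Subgroup.closure S := hS ▸ Subgroup.mem_top g
  induction hg using Subgroup.closure_induction with
  | mem x hx =>
    have h : x ∈ S ∪ S⁻¹ := Or.inl hx
    simpa using Conn.edge (a := (1 : G)) (P := Set.univ) h trivial trivial
  | one => exact Conn.refl _
  | mul x y _ _ h1 h2 =>
    exact h1.trans (by simpa using h2.translate x (P' := Set.univ) (fun _ _ => trivial))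
  | inv x _ h =>
    simpa using (h.translate x⁻¹ (P' := Set.univ) (fun _ _ => trivial)).symm (symm_inv S)

theorem cayley_iff {S : Set G} {χ : G → ℝ} (h1 : χ 1 = 0) :
    CayleyConnected S χ ↔ ∀ g, 0 ≤ χ g → Conn (S ∪ S⁻¹) {x | 0 ≤ χ x} 1 g := by
  refine forall_congr' fun g => imp_congr_right fun _ => ⟨?_, ?_⟩
  · rintro ⟨l, hl, rfl, hp⟩
    have key : ∀ i ≤ l.length, Conn (S ∪ S⁻¹) {x | 0 ≤ χ x} 1 (l.take i).prod := by
      intro i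
      induction i with
      | zero => intro _; simpa using Conn.refl _
      | succ i ih =>
        intro hi
        refine (ih (by omega)).trans ?_
        have e := List.prod_take_succ l i (by omega)
        have h2 := hp (i + 1) hi
        rw [e] at h2 ⊢
        exact Conn.edge (hl _ (List.getElem_mem _)) (hp i (by omega)) h2
    simpa using key l.length le_rfl
  · intro h
    induction h with
    | refl => exact ⟨[], by simp, by simp, by simp [h1]⟩
    | @tail x y _ h ih =>
      obtain ⟨hx, hy, s, hs, rfl⟩ := h
      obtain ⟨l, hl, rfl, hp⟩ := ih hx
      refine ⟨l ++ [s], ?_, by simp, ?_⟩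
      · intro z hz
        rw [List.mem_append, List.mem_singleton] at hz
        rcases hz with hz | rfl
        exacts [hl z hz, hs]
      · intro i hi
        rcases Nat.lt_or_ge l.length i with h | h
        · rw [List.take_of_length_le (by simpa using h)]
          simpa using hy
        · rw [List.take_append_of_le_length h]
          exact hp i h

variable {χ : G → ℝ}

theorem chi_one
    (hχ : ∀ a b : G, χ (a * b) = χ a + χ b) : χ 1 = 0 := by have := hχ 1 1; simp at this; exact this

theorem chi_inv
    (hχ : ∀ a b : G, χ (a * b) = χ a + χ b) (g : G) : χ g⁻¹ = - χ g := by
  have := hχ g g⁻¹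
  rw [mul_inv_cancel, chi_one hχ] at this
  linarith

theorem chi_pow
    (hχ : ∀ a b : G, χ (a * b) = χ a + χ b) (g : G) (n : ℕ) : χ (g ^ n) = n * χ g := by
  induction n with
  | zero => simp [chi_one hχ]
  | succ n ih => rw [pow_succ, hχ, ih]; push_cast; ring

theorem chi_comm
    (hχ : ∀ a b : G, χ (a * b) = χ a + χ b) {g : G} (hg : g ∈ commutator G) : χ g = 0 := by
  let f : G →* Multiplicative ℝ :=
    { toFun := fun g => Multiplicative.ofAdd (χ g)
      map_one' := by rw [chi_one hχ]; rfl
      map_mul' := fun a b => by rw [hχ]; rfl }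
  have : f g = 1 := Abelianization.commutator_subset_ker f hg
  exact this

theorem conn_two
    (hχ : ∀ a b : G, χ (a * b) = χ a + χ b) {S : Set G} (hc : CayleyConnected S χ) {c : ℝ} {a b : G} (ha : c ≤ χ a)
    (hb : c ≤ χ b) : Conn (S ∪ S⁻¹) {x | c ≤ χ x} a b := by
  rw [cayley_iff (chi_one hχ)] at hc
  have key : ∀ a b : G, c ≤ χ a → χ a ≤ χ b → Conn (S ∪ S⁻¹) {x | c ≤ χ x} a b := by
    intro a b ha hab
    have h := hc (a⁻¹ * b) (by rw [hχ, chi_inv hχ]; linarith)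
    have := h.translate a (P' := {x | c ≤ χ x}) (fun x hx => by
      simp only [Set.mem_ofPred_eq] at hx ⊢
      rw [hχ]; linarith)
    simpa using this
  rcases le_total (χ a) (χ b) with h | h
  · exact key a b ha h
  · exact (key b a hb h).symm (symm_inv S)

theorem forward
    (hχ : ∀ a b : G, χ (a * b) = χ a + χ b) {S : Set G} (hS : Subgroup.closure S = ⊤) (hfg : (commutator G).FG)
    (hne : ∃ g : G, χ g ≠ 0) : CayleyConnected S χ := by
  rw [cayley_iff (chi_one hχ)]
  set T := S ∪ S⁻¹ with hT
  set P := {x : G | 0 ≤ χ x} with hP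
  obtain ⟨t, htT, ht⟩ : ∃ t ∈ T, 0 < χ t := by
    by_contra! hcon
    obtain ⟨g, hg⟩ := hne
    apply hg
    have hz : ∀ s ∈ S, χ s = 0 := by
      intro s hs
      have h1 := hcon s (Or.inl hs)
      have h2 := hcon s⁻¹ (symm_inv S s (Or.inl hs))
      rw [chi_inv hχ] at h2
      linarith
    have hg : g ∈ Subgroup.closure S := hS ▸ Subgroup.mem_top g
    induction hg using Subgroup.closure_induction with
    | mem x hx => exact hz x hx
    | one => exact chi_one hχ
    | mul x y _ _ h1 h2 => 
      rw [hχ]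
      by_cases hx : χ x = 0 <;> by_cases hy : χ y = 0 <;> simp_all
    | inv x _ h => 
      rw [chi_inv hχ]
      by_cases hx : χ x = 0 <;> simp_all
  obtain ⟨Y, hY⟩ := hfg
  obtain ⟨m, hm⟩ : ∃ m : ℕ, ∀ y ∈ Y, Conn T P (t ^ m) (t ^ m * y) := by
    suffices h : ∀ᶠ m : ℕ in atTop, ∀ y ∈ Y, Conn T P (t ^ m) (t ^ m * y) from h.exists
    rw [eventually_all_finset]
    intro y _
    obtain ⟨Q, hQ, -, hc⟩ := (conn_univ hS y).finite
    have : ∀ᶠ m : ℕ in atTop, ∀ q ∈ Q, 0 ≤ (m : ℝ) * χ t + χ q := by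
      rw [eventually_all_finite hQ]
      intro q _
      have h1 : Tendsto (fun m : ℕ => (m : ℝ) * χ t + χ q) atTop atTop :=
        tendsto_atTop_add_const_right _ _
          (tendsto_natCast_atTop_atTop.atTop_mul_const ht)
      exact h1.eventually_ge_atTop 0
    filter_upwards [this] with m hm
    have := hc.translate (t ^ m) (P' := P) (fun x hx => by
      simp only [hP, Set.mem_ofPred_eq]
      rw [hχ, chi_pow hχ]; exact hm x hx)
    simpa using this
  have tr : ∀ {g a b : G}, χ g = 0 → Conn T P a b → Conn T P (g * a) (g * b) := by
    intro g a b hg h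
    refine h.translate g (fun x hx => ?_)
    simp only [hP, Set.mem_ofPred_eq] at hx ⊢
    rw [hχ, hg]; linarith
  have hN : ∀ n ∈ Subgroup.closure (Y : Set G), Conn T P (t ^ m) (t ^ m * n) := by
    intro n hn
    induction hn using Subgroup.closure_induction with
    | mem x hx => exact hm x hx
    | one => simpa using Conn.refl _
    | mul x y hx hy h1 h2 =>
      have hx0 : χ (t ^ m * x * (t ^ m)⁻¹) = 0 := by
        rw [hχ, hχ, chi_inv hχ, chi_comm hχ (g := x) (hY ▸ hx)]; ring
      have := tr hx0 h2
      refine h1.trans ?_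
      simpa [mul_assoc] using this
    | inv x hx h =>
      have hx0 : χ (t ^ m * x⁻¹ * (t ^ m)⁻¹) = 0 := by
        rw [hχ, hχ, chi_inv hχ, chi_inv hχ, chi_comm hχ (g := x) (hY ▸ hx)]; ring
      have := (tr hx0 h).symm (symm_inv S)
      simpa [mul_assoc] using this
  have hpow : ∀ k : ℕ, Conn T P 1 (t ^ k) := by
    intro k
    induction k with
    | zero => simpa using Conn.refl _
    | succ k ih =>
      refine ih.trans ?_
      have h0 : ∀ k : ℕ, t ^ k ∈ P := fun k => by
        simp only [hP, Set.mem_ofPred_eq]; rw [chi_pow hχ]; positivity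
      have := h0 (k + 1)
      rw [pow_succ] at this ⊢
      exact Conn.edge htT (h0 k) this
  have hcomm : ∀ n ∈ commutator G, Conn T P 1 n := by
    intro n hn
    have h1 : (t ^ m)⁻¹ * n * t ^ m ∈ commutator G := by
      have := (inferInstance : (commutator G).Normal).conj_mem n hn (t ^ m)⁻¹
      simpa using this
    have h2 := hN _ (hY ▸ h1)
    have h3 := (tr (chi_comm hχ hn) (hpow m)).symm (symm_inv S)
    refine ((hpow m).trans h2).trans ?_
    simpa [mul_assoc] using h3
  have hsplit : ∀ g x : G, Conn T Set.univ x g → x = 1 → ∃ a b : G, Conn T P 1 a ∧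
      Conn T {x | χ b ≤ χ x} 1 b ∧ χ b ≤ 0 ∧ g * (a * b)⁻¹ ∈ commutator G := by
    intro g x h hx1
    subst hx1
    have ab : ∀ g : G, g ∈ commutator G ↔ (Abelianization.of g) = 1 := by
      intro g
      rw [← MonoidHom.mem_ker, Abelianization.ker_of]
    induction h with
    | refl => exact ⟨1, 1, Conn.refl _, Conn.refl _, (chi_one hχ).le, by simp⟩
    | tail _ h ih =>
      obtain ⟨-, -, s, hs, rfl⟩ := h
      obtain ⟨a, b, ha, hb, hb0, hab⟩ := ih
      rw [ab] at hab
      rcases le_or_gt 0 (χ s) with h0 | h0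
      · refine ⟨a * s, b, ha.trans ?_, hb, hb0, ?_⟩
        · have haP : a ∈ P := ha.mem (by simp [hP, chi_one hχ])
          refine Conn.edge hs haP ?_
          simp only [hP, Set.mem_ofPred_eq] at haP ⊢
          rw [hχ]; linarith
        · rw [ab]
          rw [map_mul, map_inv, mul_inv_eq_one, map_mul] at hab ⊢
          simp only [map_mul] at hab ⊢
          rw [hab]
          first | exact mul_right_comm _ _ _ | exact mul_assoc _ _ _
      · refine ⟨a, b * s, ha, ?_, by rw [hχ]; linarith, ?_⟩
        · have hbb : χ (b * s) ≤ χ b := by rw [hχ]; linarith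
          refine (hb.mono ?_).trans (Conn.edge hs hbb (le_refl (χ (b * s))))
          intro z hz
          exact hbb.trans hz
        · rw [ab]
          rw [map_mul, map_inv, mul_inv_eq_one, map_mul] at hab ⊢
          simp only [map_mul] at hab ⊢
          rw [hab]
          first | exact mul_right_comm _ _ _ | exact mul_assoc _ _ _
  intro g hg
  obtain ⟨a, b, ha, hb, hb0, hab⟩ := hsplit g 1 (conn_univ hS g) rfl
  have hn := chi_comm hχ hab
  have hgab : χ g = χ a + χ b := by
    rw [hχ, chi_inv hχ, hχ] at hn; linarith
  have h1 : Conn T P a (a * b) := by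
    have := hb.translate a (P' := P) (fun x hx => by
      simp only [hP, Set.mem_ofPred_eq] at hx ⊢
      rw [hχ]; linarith)
    simpa using this
  have h2 := tr hn (ha.trans h1)
  refine (hcomm _ hab).trans ?_
  simpa [mul_assoc] using h2

end

section
variable {G : Type*} [Group G] {E : Type*} [NormedAddCommGroup E] [InnerProductSpace ℝ E]

theorem exists_dirs [ProperSpace E] {φ : G → E}
    (hφ : ∀ a b, φ (a * b) = φ a + φ b) (hne : ∀ v : E, v ≠ 0 → ∃ g, inner ℝ v (φ g) ≠ 0)
    (C : ℝ) : ∃ F : Finset G, ∀ v : E, ∃ t ∈ insert 1 (F : Set G),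
      C * ‖v‖ ≤ inner ℝ v (φ t) := by
  classical
  have key : ∃ F : Finset G, ∀ u ∈ Metric.sphere (0 : E) 1, ∃ t ∈ F, C ≤ inner ℝ u (φ t) := by
    refine (isCompact_sphere (0 : E) 1).induction_on
      (p := fun K => ∃ F : Finset G, ∀ u ∈ K, ∃ t ∈ F, C ≤ inner ℝ u (φ t)) ?_ ?_ ?_ ?_
    · exact ⟨∅, by simp⟩
    · rintro s t hst ⟨F, hF⟩
      exact ⟨F, fun u hu => hF u (hst hu)⟩
    · rintro s t ⟨F, hF⟩ ⟨F', hF'⟩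
      refine ⟨F ∪ F', ?_⟩
      rintro u (hu | hu)
      · obtain ⟨t, ht, h⟩ := hF u hu
        exact ⟨t, Finset.mem_union_left _ ht, h⟩
      · obtain ⟨t, ht, h⟩ := hF' u hu
        exact ⟨t, Finset.mem_union_right _ ht, h⟩
    · intro u hu
      have hu0 : u ≠ 0 := by
        rintro rfl
        simp at hu
      have hχ : ∀ a b : G, inner ℝ u (φ (a * b)) = inner ℝ u (φ a) + inner ℝ u (φ b) := by
        intro a b; rw [hφ, inner_add_right]
      obtain ⟨g, hg⟩ : ∃ g, 0 < inner ℝ u (φ g) := by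
        obtain ⟨g, hg⟩ := hne u hu0
        rcases lt_or_gt_of_ne hg with h | h
        · refine ⟨g⁻¹, ?_⟩
          have := chi_inv (χ := fun g => inner ℝ u (φ g)) hχ g
          linarith
        · exact ⟨g, h⟩
      obtain ⟨k, hk⟩ := exists_nat_gt (C / inner ℝ u (φ g))
      have hk' : C < inner ℝ u (φ (g ^ k)) := by
        have := chi_pow (χ := fun g => inner ℝ u (φ g)) hχ g k
        rw [this]
        rwa [div_lt_iff₀ hg] at hk
      refine ⟨{u' | C < inner ℝ u' (φ (g ^ k))}, ?_, {g ^ k}, ?_⟩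
      · apply mem_nhdsWithin_of_mem_nhds
        refine IsOpen.mem_nhds ?_ hk'
        exact isOpen_lt continuous_const (by fun_prop)
      · intro u' hu'
        exact ⟨g ^ k, by simp, le_of_lt hu'⟩
  obtain ⟨F, hF⟩ := key
  refine ⟨F, fun v => ?_⟩
  by_cases hv : v = 0
  · exact ⟨1, by simp, by simp [hv]⟩
  · have hv' : 0 < ‖v‖ := norm_pos_iff.2 hv
    obtain ⟨t, ht, h⟩ := hF (‖v‖⁻¹ • v) (by simp [norm_smul, hv'.ne'])
    refine ⟨t, Or.inr ht, ?_⟩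
    rw [real_inner_smul_left, inv_mul_eq_div, le_div_iff₀ hv'] at h
    exact h

theorem exists_len [ProperSpace E] {S : Set G} {φ : G → E}
    (hφ : ∀ a b, φ (a * b) = φ a + φ b)
    (hcon : ∀ v : E, v ≠ 0 → CayleyConnected S (fun g => inner ℝ v (φ g)))
    {M C : ℝ} (hC : 1 + M ≤ C) (t t' s : G) (hs : ‖φ s‖ ≤ M) :
    ∀ᶠ L : ℝ in atTop, ∀ v : E, v ≠ 0 → C * ‖v‖ ≤ inner ℝ v (φ t) →
      C * ‖v‖ ≤ inner ℝ v (φ t') →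
      Conn (S ∪ S⁻¹) {x | ‖v‖ / 2 ≤ inner ℝ v (φ x) ∧ ‖φ x‖ ≤ L} t (s * t') := by
  have key : ∀ᶠ L : ℝ in atTop, ∀ u ∈ Metric.sphere (0 : E) 1, C ≤ inner ℝ u (φ t) →
      C ≤ inner ℝ u (φ t') →
      Conn (S ∪ S⁻¹) {x | 1 / 2 ≤ inner ℝ u (φ x) ∧ ‖φ x‖ ≤ L} t (s * t') := by
    refine (isCompact_sphere (0 : E) 1).induction_on
      (p := fun K => ∀ᶠ L : ℝ in atTop, ∀ u ∈ K, C ≤ inner ℝ u (φ t) →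
      C ≤ inner ℝ u (φ t') →
      Conn (S ∪ S⁻¹) {x | 1 / 2 ≤ inner ℝ u (φ x) ∧ ‖φ x‖ ≤ L} t (s * t')) ?_ ?_ ?_ ?_
    · simp
    · intro K K' hK h
      filter_upwards [h] with L hL u hu
      exact hL u (hK hu)
    · intro K K' h h'
      filter_upwards [h, h'] with L hL hL' u hu
      rcases hu with hu | hu
      exacts [hL u hu, hL' u hu]
    · intro u hu
      have hun : ‖u‖ = 1 := by simpa using hu
      have hu0 : u ≠ 0 := by
        rintro rfl
        simp at hun
      by_cases h1 : C ≤ inner ℝ u (φ t)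
      swap
      · refine ⟨{u' | inner ℝ u' (φ t) < C}, ?_, ?_⟩
        · apply mem_nhdsWithin_of_mem_nhds
          exact IsOpen.mem_nhds (isOpen_lt (by fun_prop) continuous_const) (not_le.1 h1)
        · exact Eventually.of_forall fun L u' hu' h => absurd h (not_le.2 hu')
      by_cases h2 : C ≤ inner ℝ u (φ t')
      swap
      · refine ⟨{u' | inner ℝ u' (φ t') < C}, ?_, ?_⟩
        · apply mem_nhdsWithin_of_mem_nhds
          exact IsOpen.mem_nhds (isOpen_lt (by fun_prop) continuous_const) (not_le.1 h2)
        · exact Eventually.of_forall fun L u' hu' _ h => absurd h (not_le.2 hu')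
      have hM : 0 ≤ M := (norm_nonneg _).trans hs
      have hχ : ∀ a b : G, inner ℝ u (φ (a * b)) = inner ℝ u (φ a) + inner ℝ u (φ b) := by
        intro a b; rw [hφ, inner_add_right]
      have h3 : 1 ≤ inner ℝ u (φ (s * t')) := by
        have := neg_le_of_abs_le (abs_real_inner_le_norm u (φ s))
        rw [hun, one_mul] at this
        rw [hχ]
        linarith
      have hc := conn_two (χ := fun g => inner ℝ u (φ g)) hχ (hcon u hu0) (c := 1)
        (a := t) (b := s * t') (by linarith) h3
      obtain ⟨Q, hQ, hQP, hQc⟩ := hc.finite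
      refine ⟨{u' | ∀ q ∈ Q, 1 / 2 ≤ inner ℝ u' (φ q)}, ?_, ?_⟩
      · apply mem_nhdsWithin_of_mem_nhds
        change ∀ᶠ u' in 𝓝 u, ∀ q ∈ Q, 1 / 2 ≤ inner ℝ u' (φ q)
        rw [eventually_all_finite hQ]
        intro q hq
        have hlt : (1 / 2 : ℝ) < inner ℝ u (φ q) := by
          have : 1 ≤ inner ℝ u (φ q) := hQP hq
          linarith
        have hcont : Continuous fun u' : E => inner ℝ u' (φ q) := by fun_prop
        filter_upwards [hcont.continuousAt.eventually_const_lt hlt] with u' h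
        exact h.le
      · have : ∀ᶠ L : ℝ in atTop, ∀ q ∈ Q, ‖φ q‖ ≤ L := by
          rw [eventually_all_finite hQ]
          intro q _
          exact eventually_ge_atTop _
        filter_upwards [this] with L hL u' hu' _ _
        exact hQc.mono fun q hq => ⟨hu' q hq, hL q hq⟩
  filter_upwards [key] with L hL v hv h1 h2
  have hv' : 0 < ‖v‖ := norm_pos_iff.2 hv
  have e : ∀ (c : ℝ) (x : G), c ≤ inner ℝ (‖v‖⁻¹ • v) (φ x) ↔ c * ‖v‖ ≤ inner ℝ v (φ x) := by
    intro c x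
    rw [real_inner_smul_left, inv_mul_eq_div, le_div_iff₀ hv']
  refine (hL (‖v‖⁻¹ • v) (by simp [norm_smul, hv'.ne']) ((e _ _).2 h1) ((e _ _).2 h2)).mono ?_
  rintro x ⟨hx, hx'⟩
  refine ⟨?_, hx'⟩
  rw [e] at hx
  linarith

theorem core [ProperSpace E] {S : Set G} (hSf : S.Finite) (hS : Subgroup.closure S = ⊤)
    {φ : G → E}
    (hφ : ∀ a b, φ (a * b) = φ a + φ b) (hne : ∀ v : E, v ≠ 0 → ∃ g, inner ℝ v (φ g) ≠ 0)
    (hcon : ∀ v : E, v ≠ 0 → CayleyConnected S (fun g => inner ℝ v (φ g))) :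
    ∃ ρ : ℝ, ∀ n : G, φ n = 0 → Conn (S ∪ S⁻¹) {x | ‖φ x‖ ^ 2 ≤ ρ} 1 n := by
  classical
  set T := S ∪ S⁻¹ with hT
  have hTf : T.Finite := hSf.union hSf.inv
  have hTs : ∀ s ∈ T, s⁻¹ ∈ T := symm_inv S
  have hφ1 : φ 1 = 0 := by simpa using hφ 1 1
  obtain ⟨M, hM0, hM⟩ : ∃ M : ℝ, 0 ≤ M ∧ ∀ s ∈ T, ‖φ s‖ ≤ M := by
    have : ∀ᶠ M : ℝ in atTop, ∀ s ∈ T, ‖φ s‖ ≤ M := by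
      rw [eventually_all_finite hTf]
      exact fun q _ => eventually_ge_atTop _
    exact ((eventually_ge_atTop 0).and this).exists
  set C := 1 + M with hC
  obtain ⟨F0, hF0⟩ := exists_dirs hφ hne (C + 1)
  set F : Set G := insert 1 (F0 : Set G) with hF
  have hFf : F.Finite := F0.finite_toSet.insert 1
  obtain ⟨D, hD0, hD⟩ : ∃ D : ℝ, 0 ≤ D ∧ ∀ s ∈ F, ‖φ s‖ ≤ D := by
    have : ∀ᶠ M : ℝ in atTop, ∀ s ∈ F, ‖φ s‖ ≤ M := by
      rw [eventually_all_finite hFf]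
      exact fun q _ => eventually_ge_atTop _
    exact ((eventually_ge_atTop 0).and this).exists
  have ev1 : ∀ᶠ L : ℝ in atTop, ∀ t ∈ F, ∀ t' ∈ F, ∀ s ∈ T,
      ∀ v : E, v ≠ 0 → C * ‖v‖ ≤ inner ℝ v (φ t) → C * ‖v‖ ≤ inner ℝ v (φ t') →
      Conn T {x | ‖v‖ / 2 ≤ inner ℝ v (φ x) ∧ ‖φ x‖ ≤ L} t (s * t') := by
    rw [eventually_all_finite hFf]
    intro t _
    rw [eventually_all_finite hFf]
    intro t' _
    rw [eventually_all_finite hTf]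
    intro s hs
    exact exists_len hφ hcon le_rfl t t' s (hM s hs)
  have ev2 : ∀ᶠ L : ℝ in atTop, ∀ t ∈ F, Conn T {x | ‖φ x‖ ≤ L} 1 t := by
    rw [eventually_all_finite hFf]
    intro t _
    obtain ⟨Q, hQ, -, hQc⟩ := (conn_univ hS t).finite
    have : ∀ᶠ L : ℝ in atTop, ∀ q ∈ Q, ‖φ q‖ ≤ L := by
      rw [eventually_all_finite hQ]
      exact fun q _ => eventually_ge_atTop _
    filter_upwards [this] with L hL
    exact hQc.mono hL
  obtain ⟨L, hL0, hL1, hL2⟩ := ((eventually_ge_atTop 0).and (ev1.and ev2)).exists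
  obtain ⟨R, hR0, hR1, hR2⟩ : ∃ R : ℝ, 0 ≤ R ∧ L ^ 2 + 1 ≤ R ∧ (C + 1) * M + M * D ≤ R :=
    ((eventually_ge_atTop 0).and ((eventually_ge_atTop _).and (eventually_ge_atTop _))).exists
  set ρ := (R + M + L) ^ 2 with hρ
  choose τ hτF hτ using fun g : G => hF0 (-φ g)
  let f : G → G := fun g => if ‖φ g‖ ≤ R then g else g * τ g
  -- low-high edges
  have lowhigh : ∀ g h : G, StepIn T Set.univ g h → ‖φ g‖ ≤ R → ¬ ‖φ h‖ ≤ R →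
      Conn T {x | ‖φ x‖ ^ 2 ≤ ρ} g (h * τ h) := by
    rintro g h ⟨-, -, s, hs, rfl⟩ hg hh
    have hgs : ‖φ (g * s)‖ ≤ R + M := by
      rw [hφ]; exact (norm_add_le _ _).trans (add_le_add hg (hM s hs))
    have small : ∀ x : G, ‖φ x‖ ≤ R + M + L → x ∈ {x | ‖φ x‖ ^ 2 ≤ ρ} := by
      intro x hx
      exact pow_le_pow_left₀ (norm_nonneg _) hx 2
    refine (Conn.edge hs (small _ (by linarith)) (small _ (by linarith))).trans ?_
    have := (hL2 (τ (g * s)) (hτF _)).translate (g * s) (P' := {x | ‖φ x‖ ^ 2 ≤ ρ}) (by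
      intro x hx
      apply small
      rw [hφ]
      exact (norm_add_le _ _).trans (add_le_add hgs hx))
    simpa using this
  have highhigh : ∀ g h : G, StepIn T Set.univ g h → ¬ ‖φ g‖ ≤ R → ¬ ‖φ h‖ ≤ R →
      Conn T {x | ‖φ x‖ ^ 2 ≤ ‖φ g‖ ^ 2 - 1} (g * τ g) (h * τ h) := by
    rintro g h ⟨-, -, s, hs, rfl⟩ hg hh
    push Not at hg hh
    have hg0 : -φ g ≠ 0 := by
      intro h0
      rw [neg_eq_zero] at h0
      rw [h0, norm_zero] at hg
      linarith
    have a1 : C * ‖-φ g‖ ≤ inner ℝ (-φ g) (φ (τ g)) := by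
      refine le_trans ?_ (hτ g)
      have := norm_nonneg (-φ g)
      nlinarith
    have a2 : C * ‖-φ g‖ ≤ inner ℝ (-φ g) (φ (τ (g * s))) := by
      have h1 := hτ (g * s)
      have h2 : inner ℝ (-φ (g * s)) (φ (τ (g * s))) = inner ℝ (-φ g) (φ (τ (g * s))) -
          inner ℝ (φ s) (φ (τ (g * s))) := by
        rw [← inner_sub_left, hφ]
        congr 1
        abel
      have h3 := neg_le_of_abs_le (abs_real_inner_le_norm (φ s) (φ (τ (g * s))))
      have h4 : ‖φ s‖ * ‖φ (τ (g * s))‖ ≤ M * D :=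
        mul_le_mul (hM s hs) (hD _ (hτF _)) (norm_nonneg _) hM0
      have h5 : ‖φ g‖ ≤ ‖φ (g * s)‖ + M := by
        have : φ g = φ (g * s) - φ s := by rw [hφ]; abel
        rw [this]
        exact (norm_sub_le _ _).trans (add_le_add le_rfl (hM s hs))
      rw [norm_neg] at h1 ⊢
      have h6 : (C + 1) * ‖φ g‖ ≤ (C + 1) * (‖φ (g * s)‖ + M) :=
        mul_le_mul_of_nonneg_left h5 (by linarith)
      linarith
    have := (hL1 _ (hτF g) _ (hτF (g * s)) s hs _ hg0 a1 a2).translate g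
      (P' := {x | ‖φ x‖ ^ 2 ≤ ‖φ g‖ ^ 2 - 1}) (by
      rintro x ⟨hx1, hx2⟩
      simp only [Set.mem_ofPred_eq]
      rw [hφ, norm_add_sq_real]
      rw [norm_neg, inner_neg_left] at hx1
      have : ‖φ x‖ ^ 2 ≤ L ^ 2 := pow_le_pow_left₀ (norm_nonneg _) hx2 2
      linarith)
    simpa [mul_assoc] using this
  have push1 : ∀ r : ℝ, ρ ≤ r → ∀ a b : G, Conn T {x | ‖φ x‖ ^ 2 ≤ r + 1} a b →
      Conn T {x | ‖φ x‖ ^ 2 ≤ r} (f a) (f b) := by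
    intro r hr a b h
    have sub : {x | ‖φ x‖ ^ 2 ≤ ρ} ⊆ {x | ‖φ x‖ ^ 2 ≤ r} := fun x hx => le_trans hx hr
    induction h with
    | refl => exact Conn.refl _
    | @tail g h _ hst ih =>
      refine ih.trans ?_
      obtain ⟨hg, hh, s, hs, e⟩ := hst
      have st : StepIn T Set.univ g h := ⟨trivial, trivial, s, hs, e⟩
      have st' : StepIn T Set.univ h g := ⟨trivial, trivial, s⁻¹, hTs s hs, by simp [e]⟩
      by_cases h1 : ‖φ g‖ ≤ R <;> by_cases h2 : ‖φ h‖ ≤ R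
      · simp only [f, h1, h2, if_true]
        have small : ∀ x : G, ‖φ x‖ ≤ R → x ∈ {x | ‖φ x‖ ^ 2 ≤ ρ} := by
          intro x hx
          exact pow_le_pow_left₀ (norm_nonneg _) (by linarith) 2
        have s1 := small g h1
        have s2 := small h h2
        subst e
        exact (Conn.edge hs s1 s2).mono sub
      · simp only [f, h1, h2, if_true, if_false]
        exact (lowhigh g h st h1 h2).mono sub
      · simp only [f, h1, h2, if_true, if_false]
        exact ((lowhigh h g st' h2 h1).symm hTs).mono sub
      · simp only [f, h1, h2, if_false]
        refine (highhigh g h st h1 h2).mono ?_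
        intro x hx
        have hg' : ‖φ g‖ ^ 2 ≤ r + 1 := hg
        have hx' : ‖φ x‖ ^ 2 ≤ ‖φ g‖ ^ 2 - 1 := hx
        change ‖φ x‖ ^ 2 ≤ r
        linarith
  refine ⟨ρ, fun n hn => ?_⟩
  have fz : ∀ g, φ g = 0 → f g = g := by
    intro g hg
    simp [f, hg, hR0]
  have desc : ∀ k : ℕ, Conn T {x | ‖φ x‖ ^ 2 ≤ ρ + k} 1 n → Conn T {x | ‖φ x‖ ^ 2 ≤ ρ} 1 n := by
    intro k
    induction k with
    | zero => intro h; simpa using h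
    | succ k ih =>
      intro h
      apply ih
      have := push1 (ρ + k) (by simp) 1 n (by simpa [add_assoc] using h)
      rwa [fz 1 hφ1, fz n hn] at this
  obtain ⟨Q, hQ, -, hQc⟩ := (conn_univ hS n).finite
  have : ∀ᶠ k : ℕ in atTop, ∀ q ∈ Q, ‖φ q‖ ^ 2 ≤ ρ + k := by
    rw [eventually_all_finite hQ]
    intro q _
    have h1 : Tendsto (fun k : ℕ => ρ + (k : ℝ)) atTop atTop :=
      tendsto_atTop_add_const_left _ _ tendsto_natCast_atTop_atTop
    exact h1.eventually_ge_atTop _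
  obtain ⟨k, hk⟩ := this.exists
  exact desc k (hQc.mono hk)

end

theorem exists_phi (A : Type*) [AddCommGroup A] [AddGroup.FG A] :
    ∃ (n : ℕ) (φ : A →+ EuclideanSpace ℝ (Fin n)),
      (∀ ρ : ℝ, {a | ‖φ a‖ ^ 2 ≤ ρ}.Finite) ∧
      ∀ v : EuclideanSpace ℝ (Fin n), v ≠ 0 → ∃ a, inner ℝ v (φ a) ≠ 0 := by
  classical
  obtain ⟨n, ι, _, p, hp, e, ⟨f⟩⟩ := AddCommGroup.equiv_free_prod_directSum_zmod A
  have : ∀ i, NeZero (p i ^ e i) := fun i => ⟨pow_ne_zero _ (hp i).ne_zero⟩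
  have : Finite (DirectSum ι fun i => ZMod (p i ^ e i)) :=
    Finite.of_equiv _ DFinsupp.equivFunOnFintype.symm
  let φ : A →+ EuclideanSpace ℝ (Fin n) :=
    { toFun := fun a => WithLp.toLp 2 fun i => (((f a).1 i : ℤ) : ℝ)
      map_zero' := by ext i; simp
      map_add' := fun a b => by ext i; simp }
  have hφ : ∀ a i, φ a i = (((f a).1 i : ℤ) : ℝ) := fun a i => rfl
  refine ⟨n, φ, ?_, ?_⟩
  · intro ρ
    obtain ⟨m, hm⟩ := exists_nat_gt ρ
    have hfin : ((fun x : (Fin n →₀ ℤ) × (DirectSum ι fun i => ZMod (p i ^ e i)) =>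
        ((fun i => x.1 i : Fin n → ℤ), x.2)) ⁻¹'
          ((Set.Icc (fun _ => -(m : ℤ)) (fun _ => (m : ℤ))) ×ˢ Set.univ)).Finite := by
      refine Set.Finite.preimage ?_ ((Set.finite_Icc _ _).prod Set.finite_univ)
      rintro ⟨x, y⟩ _ ⟨x', y'⟩ _ h
      simp only [Prod.mk.injEq] at h ⊢
      exact ⟨DFunLike.coe_injective h.1, h.2⟩
    refine (hfin.preimage (f.injective.injOn)).subset ?_
    intro a ha
    have ha' : ‖φ a‖ ^ 2 ≤ ρ := ha
    have hi : ∀ i, |(f a).1 i| ≤ (m : ℤ) := by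
      intro i
      have h1 : ‖φ a i‖ ≤ ‖φ a‖ := PiLp.norm_apply_le _ i
      have h2 : ‖φ a i‖ ^ 2 ≤ m := (pow_le_pow_left₀ (norm_nonneg _) h1 2).trans (by linarith)
      rw [hφ, Real.norm_eq_abs, sq_abs] at h2
      have h3 : ((f a).1 i) ^ 2 ≤ (m : ℤ) := by exact_mod_cast h2
      have h4 : |(f a).1 i| ≤ ((f a).1 i) ^ 2 := by
        rw [← sq_abs]
        exact Int.le_self_sq _
      exact h4.trans h3
    refine ⟨⟨fun i => (abs_le.1 (hi i)).1, fun i => (abs_le.1 (hi i)).2⟩, trivial⟩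
  · intro v hv
    obtain ⟨i, hi⟩ : ∃ i, v i ≠ 0 := by
      by_contra! h
      exact hv (by ext i; simpa using h i)
    refine ⟨f.symm (Finsupp.single i 1, 0), ?_⟩
    rw [PiLp.inner_apply, Finset.sum_eq_single i]
    · rw [hφ]; simpa using hi
    · intro j _ hj
      rw [hφ]; simp [Finsupp.single_apply, hj.symm]
    · simp

theorem backward {G : Type*} [Group G] {S : Set G} (hSf : S.Finite)
    (hS : Subgroup.closure S = ⊤)
    (h : ∀ (χ : G → ℝ), (∀ a b : G, χ (a * b) = χ a + χ b) →
      (∃ g : G, χ g ≠ 0) → CayleyConnected S χ) : (commutator G).FG := by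
  classical
  have hG : Group.FG G := Group.fg_iff.2 ⟨S, hS, hSf⟩
  have hA : Group.FG (Abelianization G) :=
    Group.fg_of_surjective (f := (Abelianization.of : G →* Abelianization G))
      (QuotientGroup.mk_surjective)
  obtain ⟨n, φ, hfin, hne⟩ := exists_phi (Additive (Abelianization G))
  let ψ : G → EuclideanSpace ℝ (Fin n) := fun g => φ (Additive.ofMul (Abelianization.of g))
  have hψ : ∀ a b, ψ (a * b) = ψ a + ψ b := fun a b => by simp [ψ]
  have hsurj : ∀ a : Abelianization G, ∃ g, Abelianization.of g = a :=
    QuotientGroup.mk_surjective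
  have hne' : ∀ v : EuclideanSpace ℝ (Fin n), v ≠ 0 → ∃ g, inner ℝ v (ψ g) ≠ 0 := by
    intro v hv
    obtain ⟨a, ha⟩ := hne v hv
    obtain ⟨g, hg⟩ := hsurj a.toMul
    refine ⟨g, ?_⟩
    simpa [ψ, hg] using ha
  obtain ⟨ρ, hρ⟩ := core hSf hS hψ hne' (fun v hv => h _
    (fun a b => by rw [hψ, inner_add_right]) (hne' v hv))
  set T := S ∪ S⁻¹ with hT
  have hTf : T.Finite := hSf.union hSf.inv
  have ab : ∀ g : G, g ∈ commutator G ↔ (Abelianization.of g) = 1 := by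
    intro g
    rw [← MonoidHom.mem_ker, Abelianization.ker_of]
  obtain ⟨σ, hσ, hσ1⟩ : ∃ σ : Abelianization G → G,
      (∀ a, Abelianization.of (σ a) = a) ∧ σ 1 = 1 := by
    choose σ hσ using hsurj
    refine ⟨Function.update σ 1 1, ?_, by simp⟩
    intro a
    by_cases ha : a = 1
    · subst ha; simp
    · rw [Function.update_of_ne ha, hσ]
  let B : Set (Abelianization G) := Additive.ofMul ⁻¹' {a | ‖φ a‖ ^ 2 ≤ ρ}
  have hB : B.Finite := (hfin ρ).preimage Additive.ofMul.injective.injOn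
  have hBm : ∀ g : G, g ∈ {x | ‖ψ x‖ ^ 2 ≤ ρ} → Abelianization.of g ∈ B := fun g hg => hg
  let w : Abelianization G × G → G := fun x => σ x.1 * x.2 * (σ (x.1 * Abelianization.of x.2))⁻¹
  have hY : (w '' (B ×ˢ T)).Finite := (hB.prod hTf).image w
  rw [Subgroup.fg_iff]
  refine ⟨w '' (B ×ˢ T), le_antisymm ?_ ?_, hY⟩
  · rw [Subgroup.closure_le]
    rintro _ ⟨⟨a, s⟩, -, rfl⟩
    change _ ∈ commutator G
    rw [ab]
    simp [w, hσ]
  · intro n hn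
    rw [ab] at hn
    have key : ∀ g, Conn T {x | ‖ψ x‖ ^ 2 ≤ ρ} 1 g →
        g * (σ (Abelianization.of g))⁻¹ ∈ Subgroup.closure (w '' (B ×ˢ T)) := by
      intro g hg
      induction hg with
      | refl => simp [hσ1]
      | @tail g h _ hst ih =>
        obtain ⟨hg, -, s, hs, rfl⟩ := hst
        have hw : w (Abelianization.of g, s) ∈ Subgroup.closure (w '' (B ×ˢ T)) :=
          Subgroup.subset_closure (Set.mem_image_of_mem w (Set.mk_mem_prod (hBm g hg) hs))
        have := mul_mem ih hw
        simpa [w, mul_assoc] using this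
    have := key n (hρ n (by simp [ψ, hn]))
    simpa [hn, hσ1] using this

end BNSAux

/-- The commutator subgroup `G' = [G, G]` of a finitely generated group `G` is finitely
generated iff `C_χ` is connected for every nontrivial homomorphism `χ : G → ℝ`,
i.e. iff `Σ(G) = S(G)`. -/
theorem commutator_fg_iff_bns_full
    {G : Type*} [Group G] (S : Finset G) (hS : Subgroup.closure (S : Set G) = ⊤) :
    (commutator G).FG ↔ ∀ (χ : G → ℝ), (∀ a b : G, χ (a * b) = χ a + χ b) →
      (∃ g : G, χ g ≠ 0) → CayleyConnected (S : Set G) χ := by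
  constructor
  · intro hfg χ hχ hne
    exact BNSAux.forward hχ hS hfg hne
  · intro h
    exact BNSAux.backward S.finite_toSet hS h
end

section
/- Let G be a group, let χ : G → (ℝ, +) be a nontrivial homomorphism, and let v : G → ℝ ∪ {∞} be an HNN valuation with respect to χ. Then the restriction of v to the set {g ∈ G : χ(g) ≤ 0} does not attain a minimal value if and only if the restriction of v to the kernel ker(χ) is not bounded below. -/
/-- `v : G → ℝ ∪ {∞}` is an HNN valuation with respect to the homomorphism
`χ : G → (ℝ, +)`: (a) `v (g⁻¹) = v g + χ g`, and (b) `v (g * h) ≥ min (v g) (v h - χ g)`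
(the subtraction of the real number `χ g` is written as addition of `-(χ g)`). -/
def IsHNNValuation {G : Type*} [Group G] (χ : G → ℝ) (v : G → WithTop ℝ) : Prop :=
  (∀ g : G, v g⁻¹ = v g + ((χ g : ℝ) : WithTop ℝ)) ∧
  (∀ g h : G, min (v g) (v h + ((-(χ g) : ℝ) : WithTop ℝ)) ≤ v (g * h))

/-- A nontrivial HNN valuation: in addition (c) the restriction of `v` to
`{g : χ g ≤ 0}` does not attain a minimal value. -/
def IsNontrivialHNNValuation {G : Type*} [Group G] (χ : G → ℝ) (v : G → WithTop ℝ) : Prop :=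
  IsHNNValuation χ v ∧ ¬ ∃ g₀ : G, χ g₀ ≤ 0 ∧ ∀ g : G, χ g ≤ 0 → v g₀ ≤ v g

theorem hnn_le_aux (x y : WithTop ℝ) (h : ∀ a : ℝ, (a : WithTop ℝ) ≤ x → (a : WithTop ℝ) ≤ y) :
    x ≤ y := by
  induction y using WithTop.recTopCoe with
  | top => exact le_top
  | coe y =>
    induction x using WithTop.recTopCoe with
    | top =>
      have := WithTop.coe_le_coe.1 (h (y + 1) le_top)
      linarith
    | coe x => exact h x le_rfl

theorem hnn_shift_aux (x : WithTop ℝ) (a b : ℝ) :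
    (a : WithTop ℝ) ≤ x + (b : WithTop ℝ) ↔ ((a - b : ℝ) : WithTop ℝ) ≤ x := by
  induction x using WithTop.recTopCoe with
  | top => simp
  | coe x =>
    rw [← WithTop.coe_add, WithTop.coe_le_coe, WithTop.coe_le_coe]
    constructor <;> intro h <;> linarith

theorem hnn_exists_aux (x : WithTop ℝ) : ∃ b : ℝ, (b : WithTop ℝ) ≤ x := by
  induction x using WithTop.recTopCoe with
  | top => exact ⟨0, le_top⟩
  | coe x => exact ⟨x, le_rfl⟩

theorem hnn_iter_aux (P : ℝ → Prop) (hmono : ∀ a b, a ≤ b → P b → P a) (a b d : ℝ)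
    (hd : 0 < d) (h0 : P b) (hs : ∀ b, P b → P (min a (b + d))) : P a := by
  have key : ∀ k : ℕ, P (min a (b + k * d)) := by
    intro k
    induction k with
    | zero => exact hmono _ b (by simp) h0
    | succ k ih =>
      refine hmono _ _ ?_ (hs _ ih)
      push_cast
      refine le_min (min_le_left _ _) ?_
      rw [← min_add_add_right]
      exact le_min ((min_le_left _ _).trans (by linarith))
        ((min_le_right _ _).trans (by linarith))
  obtain ⟨k, hk⟩ := exists_nat_ge ((a - b) / d)
  rw [div_le_iff₀ hd] at hk
  exact hmono _ _ (le_min le_rfl (by linarith)) (key k)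

/-- For a nontrivial homomorphism `χ : G → ℝ` and an HNN valuation `v` with respect to `χ`,
the restriction of `v` to `{g : χ g ≤ 0}` does not attain a minimal value iff the
restriction of `v` to `ker χ` is not bounded below. -/
theorem hnn_valuation_no_min_iff_unbounded_on_kernel
    {G : Type*} [Group G] (χ : G → ℝ) (hχ : ∀ a b : G, χ (a * b) = χ a + χ b)
    (hne : ∃ g : G, χ g ≠ 0) (v : G → WithTop ℝ) (hv : IsHNNValuation χ v) :
    (¬ ∃ g₀ : G, χ g₀ ≤ 0 ∧ ∀ g : G, χ g ≤ 0 → v g₀ ≤ v g) ↔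
    (¬ ∃ c : ℝ, ∀ g : G, χ g = 0 → (c : WithTop ℝ) ≤ v g) := by
  obtain ⟨hinv, hmul⟩ := hv
  have mono : ∀ g : G, ∀ a b : ℝ, a ≤ b → (b : WithTop ℝ) ≤ v g → (a : WithTop ℝ) ≤ v g :=
    fun g a b h h' => (WithTop.coe_le_coe.2 h).trans h'
  have hM : ∀ (g h : G) (a : ℝ), (a : WithTop ℝ) ≤ v g → ((a + χ g : ℝ) : WithTop ℝ) ≤ v h →
      (a : WithTop ℝ) ≤ v (g * h) := by
    intro g h a h1 h2
    refine (le_min h1 ?_).trans (hmul g h)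
    rw [hnn_shift_aux, sub_neg_eq_add]
    exact h2
  have hI : ∀ (g : G) (a : ℝ), ((a - χ g : ℝ) : WithTop ℝ) ≤ v g → (a : WithTop ℝ) ≤ v g⁻¹ := by
    intro g a h
    rw [hinv, hnn_shift_aux]
    exact h
  have h1 : χ 1 = 0 := by
    have := hχ 1 1
    rw [mul_one] at this
    linarith
  have hχi : ∀ g, χ g⁻¹ = - χ g := by
    intro g
    have := hχ g g⁻¹
    rw [mul_inv_cancel, h1] at this
    linarith
  apply not_congr
  constructor
  · rintro ⟨g₀, -, h⟩
    obtain ⟨b, hb⟩ := hnn_exists_aux (v g₀)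
    exact ⟨b, fun g hg => hb.trans (h g hg.le)⟩
  · rintro ⟨c, hc⟩
    have claim1 : ∀ s : G, χ s < 0 → ∀ a : ℝ, (a : WithTop ℝ) ≤ v s →
        ∀ n : G, χ n = 0 → (a : WithTop ℝ) ≤ v n := by
      intro s hs a ha
      refine hnn_iter_aux (fun b => ∀ n : G, χ n = 0 → (b : WithTop ℝ) ≤ v n) ?_ a c (-χ s)
        (by linarith) hc ?_
      · exact fun a b hab h n hn => mono n a b hab (h n hn)
      · intro b hb n hn
        have e : n = s * ((s⁻¹ * n * s) * s⁻¹) := by group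
        have hm : χ (s⁻¹ * n * s) = 0 := by rw [hχ, hχ, hχi, hn]; ring
        have l1 := min_le_left a (b + -χ s)
        have l2 := min_le_right a (b + -χ s)
        rw [e]
        apply hM
        · exact mono _ _ _ l1 ha
        · apply hM
          · exact mono _ _ _ (by linarith) (hb _ hm)
          · apply hI
            exact mono _ _ _ (by rw [hm]; linarith) ha
    have claim2 : ∀ s s' : G, χ s < 0 → χ s' < 0 → ∀ a : ℝ, (a : WithTop ℝ) ≤ v s' →
        (a : WithTop ℝ) ≤ v s := by
      intro s s' hs hs' a ha
      obtain ⟨b, hb⟩ := hnn_exists_aux (v s)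
      refine hnn_iter_aux (fun b => (b : WithTop ℝ) ≤ v s) (mono s) a b (-χ s')
        (by linarith) hb ?_
      intro b hb
      have l1 := min_le_left a (b + -χ s')
      have l2 := min_le_right a (b + -χ s')
      have e : s = ((s * s' * s⁻¹ * s'⁻¹) * (s' * s)) * s'⁻¹ := by group
      have hm : χ (s * s' * s⁻¹ * s'⁻¹) = 0 := by simp only [hχ, hχi]; ring
      rw [e]
      apply hM
      · apply hM
        · exact mono _ _ _ l1 (claim1 s' hs' a ha _ hm)
        · apply hM
          · exact mono _ _ _ (by rw [hm]; linarith) ha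
          · exact mono _ _ _ (by rw [hm]; linarith) hb
      · apply hI
        refine mono _ _ _ ?_ ha
        rw [hχ, hm, hχ]
        linarith
    have hex : ∃ s, χ s < 0 := by
      obtain ⟨g, hg⟩ := hne
      rcases lt_or_gt_of_ne hg with h | h
      · exact ⟨g, h⟩
      · exact ⟨g⁻¹, by rw [hχi]; linarith⟩
    obtain ⟨s, hs⟩ := hex
    refine ⟨s, hs.le, fun g hg => hnn_le_aux _ _ fun a ha => ?_⟩
    rcases hg.lt_or_eq with h | h
    · exact claim2 g s h hs a ha
    · exact claim1 s hs a ha g h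
end

section
/- Let G be a finitely generated group and χ : G → ℤ a surjective homomorphism. Then the following are equivalent: (1) there exist a finitely generated subgroup B ≤ G and an element t ∈ G such that χ(t) = 1, χ(b) = 0 for all b ∈ B, G is generated by B ∪ {t}, and tBt⁻¹ ⊆ B (i.e., G admits a descending HNN decomposition with finitely generated base group and with χ as the associated homomorphism); (3) there is no nontrivial HNN valuation on G with respect to the composition of χ with the inclusion ℤ ↪ ℝ. -/
namespace HNNAux

section basic
variable {G : Type*} [Group G] {χ : G → ℤ}

theorem chi_one (hχ : ∀ a b : G, χ (a * b) = χ a + χ b) : χ 1 = 0 := by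
  have := hχ 1 1
  simp at this
  exact this

theorem chi_inv (hχ : ∀ a b : G, χ (a * b) = χ a + χ b) (g : G) : χ g⁻¹ = - χ g := by
  have := hχ g g⁻¹
  rw [mul_inv_cancel, chi_one hχ] at this
  omega

theorem chi_zpow (hχ : ∀ a b : G, χ (a * b) = χ a + χ b) {t : G} (ht : χ t = 1) (k : ℤ) :
    χ (t ^ k) = k := by
  induction k using Int.induction_on with
  | zero => simpa using chi_one hχ
  | succ i ih => rw [zpow_add_one, hχ, ih, ht]
  | pred i ih => rw [zpow_sub_one, hχ, ih, chi_inv hχ, ht]; ring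

theorem normal_form (B : Subgroup G) (t : G)
    (hgen : Subgroup.closure ((B : Set G) ∪ {t}) = ⊤) (hB : ∀ b ∈ B, t * b * t⁻¹ ∈ B) (g : G) :
    ∃ (i j : ℕ) (b : G), b ∈ B ∧ g = (t⁻¹) ^ i * b * t ^ j := by
  have hpow : ∀ (i : ℕ) (b : G), b ∈ B → t ^ i * b * (t⁻¹) ^ i ∈ B := by
    intro i
    induction i with
    | zero => intro b hb; simpa using hb
    | succ i ih =>
      intro b hb
      have := hB _ (ih b hb)
      rw [pow_succ' t, pow_succ t⁻¹]
      simpa [mul_assoc] using this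
  have hg : g ∈ Subgroup.closure ((B : Set G) ∪ {t}) := by rw [hgen]; trivial
  induction hg using Subgroup.closure_induction_left with
  | one => exact ⟨0, 0, 1, B.one_mem, by simp⟩
  | mul_left x hx y hy ih =>
    obtain ⟨i, j, b, hb, rfl⟩ := ih
    rcases hx with hx | hx
    · refine ⟨i, j, (t ^ i * x * (t⁻¹) ^ i) * b, B.mul_mem (hpow i x hx) hb, ?_⟩
      simp [mul_assoc]
    · rw [Set.mem_singleton_iff] at hx
      subst hx
      cases i with
      | zero => exact ⟨0, j + 1, _, hB b hb, by simp [pow_succ', mul_assoc]⟩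
      | succ i => exact ⟨i, j, b, hb, by simp [pow_succ', mul_assoc]⟩
  | inv_mul_cancel x hx y hy ih =>
    obtain ⟨i, j, b, hb, rfl⟩ := ih
    rcases hx with hx | hx
    · refine ⟨i, j, (t ^ i * x⁻¹ * (t⁻¹) ^ i) * b,
        B.mul_mem (hpow i _ (B.inv_mem hx)) hb, ?_⟩
      simp [mul_assoc]
    · rw [Set.mem_singleton_iff] at hx
      subst hx
      exact ⟨i + 1, j, b, hb, by simp [pow_succ', mul_assoc]⟩

theorem le_add_nonneg {m a : WithTop ℝ} {c : ℝ} (h : m ≤ a) (hc : 0 ≤ c) :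
    m ≤ a + (c : WithTop ℝ) := by
  have : (0 : WithTop ℝ) ≤ (c : WithTop ℝ) := by exact_mod_cast hc
  calc m ≤ a := h
    _ = a + 0 := by simp
    _ ≤ _ := by gcongr

theorem forward (hχ : ∀ a b : G, χ (a * b) = χ a + χ b) (B : Subgroup G) (t : G)
    (hfg : B.FG) (ht : χ t = 1) (hB0 : ∀ b ∈ B, χ b = 0)
    (hgen : Subgroup.closure ((B : Set G) ∪ {t}) = ⊤) (hB : ∀ b ∈ B, t * b * t⁻¹ ∈ B)
    (v : G → WithTop ℝ) (hv : IsHNNValuation (fun g => ((χ g : ℤ) : ℝ)) v) :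
    ∃ g₀ : G, ((χ g₀ : ℤ) : ℝ) ≤ 0 ∧ ∀ g : G, ((χ g : ℤ) : ℝ) ≤ 0 → v g₀ ≤ v g := by
  classical
  obtain ⟨ha, hb⟩ := hv
  simp only at ha hb
  obtain ⟨S, hS⟩ := hfg
  have hSB : ∀ s ∈ S, s ∈ B := fun s hs => by rw [← hS]; exact Subgroup.subset_closure hs
  obtain ⟨g₀, hg₀, hmin⟩ := Finset.exists_min_image (insert t⁻¹ (insert 1 S)) v ⟨t⁻¹, by simp⟩
  have hti : v g₀ ≤ v t⁻¹ := hmin _ (by simp)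
  have hchiti : χ t⁻¹ = -1 := by rw [chi_inv hχ, ht]
  refine ⟨g₀, ?_, ?_⟩
  · have : χ g₀ ≤ 0 := by
      simp only [Finset.mem_insert] at hg₀
      rcases hg₀ with h | h | h
      · rw [h, hchiti]; norm_num
      · rw [h, chi_one hχ]
      · rw [hB0 _ (hSB _ h)]
    exact_mod_cast this
  have hmul : ∀ x y, χ x ≤ 0 → v g₀ ≤ v x → v g₀ ≤ v y → v g₀ ≤ v (x * y) := by
    intro x y hx h1 h2
    refine le_trans (le_min h1 (le_add_nonneg h2 ?_)) (hb x y)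
    have : ((χ x : ℤ) : ℝ) ≤ 0 := by exact_mod_cast hx
    linarith
  have hBm : ∀ b ∈ B, v g₀ ≤ v b := by
    intro b hbB
    rw [← hS] at hbB
    induction hbB using Subgroup.closure_induction with
    | mem x hx => exact hmin _ (by simp only [Finset.mem_insert]; right; right; exact hx)
    | one => exact hmin _ (by simp)
    | mul x y hx hy h1 h2 => exact hmul x y (by rw [hB0 x (hS ▸ hx)]) h1 h2
    | inv x hx h => rw [ha, hB0 x (hS ▸ hx)]; simpa using h
  have hconj : ∀ x, χ x ≤ 0 → v g₀ ≤ v x → v g₀ ≤ v (t⁻¹ * (x * t)) := by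
    intro x hx h1
    refine le_trans (le_min hti ?_) (hb t⁻¹ (x * t))
    rw [hchiti]
    have h2 := hb x t
    have h3 := ha t
    rw [ht] at h3
    have hx' : ((χ x : ℤ) : ℝ) ≤ 0 := by exact_mod_cast hx
    calc v g₀ ≤ min (v x) (v t + ((-((χ x : ℤ) : ℝ) : ℝ) : WithTop ℝ)) +
          ((1 : ℝ) : WithTop ℝ) := by
          rcases min_choice (v x) (v t + ((-((χ x : ℤ) : ℝ) : ℝ) : WithTop ℝ)) with h | h <;> rw [h]
          · exact le_add_nonneg h1 (by norm_num)
          · rw [add_right_comm]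
            apply le_add_nonneg _ (by linarith)
            have : v t⁻¹ = v t + ((1 : ℝ) : WithTop ℝ) := by rw [h3]; norm_num
            rw [← this]; exact hti
      _ ≤ v (x * t) + ((1 : ℝ) : WithTop ℝ) := by gcongr
      _ = _ := by norm_num
  intro g hg
  have hg' : χ g ≤ 0 := by exact_mod_cast hg
  obtain ⟨i, j, b, hbB, rfl⟩ := normal_form B t hgen hB g
  have hc : ∀ k : ℕ, χ ((t⁻¹) ^ k * b * t ^ k) = 0 ∧ v g₀ ≤ v ((t⁻¹) ^ k * b * t ^ k) := by
    intro k
    induction k with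
    | zero => simpa using ⟨hB0 b hbB, hBm b hbB⟩
    | succ k ih =>
      have e : (t⁻¹) ^ (k + 1) * b * t ^ (k + 1) = t⁻¹ * (((t⁻¹) ^ k * b * t ^ k) * t) := by
        rw [pow_succ' t⁻¹, pow_succ t]; group
      rw [e]
      refine ⟨?_, hconj _ ih.1.le ih.2⟩
      rw [hχ, hχ, ih.1, ht, hchiti]; norm_num
  have hij : j ≤ i := by
    have e : (t⁻¹) ^ i * b * t ^ j = t ^ (-(i : ℤ)) * b * t ^ (j : ℤ) := by simp
    rw [e, hχ, hχ, chi_zpow hχ ht, chi_zpow hχ ht, hB0 b hbB] at hg'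
    omega
  obtain ⟨d, rfl⟩ := Nat.exists_eq_add_of_le' hij
  clear hg hg' hij
  induction d with
  | zero => simpa using (hc j).2
  | succ d ih =>
    have e : (t⁻¹) ^ (d + 1 + j) * b * t ^ j = t⁻¹ * ((t⁻¹) ^ (d + j) * b * t ^ j) := by
      rw [show d + 1 + j = (d + j) + 1 by ring, pow_succ']; group
    rw [e]
    exact hmul _ _ (by rw [hchiti]; norm_num) hti ih

end basic

section back
variable {G : Type*} [Group G]

/-- The subgroup generated by all `t ^ i * s * t ^ (-i)` with `i ≤ k`, `s ∈ S`. -/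
def A (S : Set G) (t : G) (k : ℤ) : Subgroup G :=
  Subgroup.closure {x | ∃ i ≤ k, ∃ s ∈ S, x = t ^ i * s * t ^ (-i)}

/-- The subgroup generated by all `t ^ (-i) * s * t ^ i` with `i ≤ m`, `s ∈ S`. -/
def Bm (S : Set G) (t : G) (m : ℕ) : Subgroup G :=
  Subgroup.closure {x | ∃ i ≤ m, ∃ s ∈ S, x = t ^ (-(i : ℤ)) * s * t ^ (i : ℤ)}

theorem A_mono (S : Set G) (t : G) {k l : ℤ} (h : k ≤ l) : A S t k ≤ A S t l := by
  apply Subgroup.closure_mono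
  rintro x ⟨i, hi, s, hs, rfl⟩
  exact ⟨i, hi.trans h, s, hs, rfl⟩

theorem Bm_mono (S : Set G) (t : G) {k l : ℕ} (h : k ≤ l) : Bm S t k ≤ Bm S t l := by
  apply Subgroup.closure_mono
  rintro x ⟨i, hi, s, hs, rfl⟩
  exact ⟨i, hi.trans h, s, hs, rfl⟩

theorem A_conj (S : Set G) (t : G) {k : ℤ} (j : ℤ) {x : G} (hx : x ∈ A S t k) :
    t ^ j * x * t ^ (-j) ∈ A S t (k + j) := by
  unfold A at hx
  induction hx using Subgroup.closure_induction with
  | mem x hx =>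
    obtain ⟨i, hi, s, hs, rfl⟩ := hx
    refine Subgroup.subset_closure ⟨i + j, by omega, s, hs, ?_⟩
    group
  | one => simp
  | mul x y _ _ h1 h2 =>
    have := Subgroup.mul_mem _ h1 h2
    convert this using 1
    group
  | inv x _ h =>
    have := Subgroup.inv_mem _ h
    convert this using 1
    group

theorem A_conj_iff (S : Set G) (t : G) (k j : ℤ) (x : G) :
    t ^ j * x * t ^ (-j) ∈ A S t (k + j) ↔ x ∈ A S t k := by
  refine ⟨fun h => ?_, A_conj S t j⟩
  have := A_conj S t (-j) h
  convert this using 1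
  · congr 1; ring
  · simp [mul_assoc]

theorem A_sub_Bm (S : Set G) (t : G) {x : G} (hx : x ∈ A S t 0) : ∃ m, x ∈ Bm S t m := by
  unfold A at hx
  induction hx using Subgroup.closure_induction with
  | mem x hx =>
    obtain ⟨i, hi, s, hs, rfl⟩ := hx
    obtain ⟨n, rfl⟩ : ∃ n : ℕ, i = -(n : ℤ) := ⟨i.natAbs, by omega⟩
    exact ⟨n, Subgroup.subset_closure ⟨n, le_rfl, s, hs, by simp⟩⟩
  | one => exact ⟨0, Subgroup.one_mem _⟩
  | mul x y _ _ h1 h2 =>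
    obtain ⟨m, h1⟩ := h1
    obtain ⟨n, h2⟩ := h2
    exact ⟨max m n, Subgroup.mul_mem _ (Bm_mono S t (le_max_left _ _) h1)
      (Bm_mono S t (le_max_right _ _) h2)⟩
  | inv x _ h =>
    obtain ⟨m, h⟩ := h
    exact ⟨m, Subgroup.inv_mem _ h⟩

theorem Bm_fg (S : Finset G) (t : G) (m : ℕ) : (Bm (S : Set G) t m).FG := by
  classical
  refine ⟨(Finset.range (m + 1) ×ˢ S).image
    (fun p => t ^ (-(p.1 : ℤ)) * p.2 * t ^ (p.1 : ℤ)), ?_⟩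
  unfold Bm
  congr 1
  ext x
  simp only [Finset.coe_image, Set.mem_image, Finset.mem_coe, Finset.mem_product,
    Finset.mem_range, Set.mem_ofPred_eq, Prod.exists]
  constructor
  · rintro ⟨i, s, ⟨hi, hs⟩, rfl⟩
    exact ⟨i, by omega, s, hs, rfl⟩
  · rintro ⟨i, hi, s, hs, rfl⟩
    exact ⟨i, s, ⟨by omega, hs⟩, rfl⟩

theorem Bm_conj (S : Set G) (t : G) (m : ℕ) (h : ∀ s ∈ S, t * s * t⁻¹ ∈ Bm S t m) :
    ∀ b ∈ Bm S t m, t * b * t⁻¹ ∈ Bm S t m := by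
  intro b hb
  have hb' := hb
  unfold Bm at hb'
  induction hb' using Subgroup.closure_induction with
  | mem x hx =>
    obtain ⟨i, hi, s, hs, rfl⟩ := hx
    cases i with
    | zero => simpa using h s hs
    | succ i =>
      refine Subgroup.subset_closure ⟨i, by omega, s, hs, ?_⟩
      push_cast
      group
  | one => simp
  | mul x y hx hy h1 h2 =>
    have := Subgroup.mul_mem _ (h1 hx) (h2 hy)
    convert this using 1
    group
  | inv x hx h =>
    have := Subgroup.inv_mem _ (h (by exact hx))
    convert this using 1
    group

theorem exists_sup (K : ℤ → Prop) (hmono : ∀ k l, k ≤ l → K k → K l) (hne : ∃ k, K k) :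
    ∃ w : WithTop ℤ, ∀ k : ℤ, (k : WithTop ℤ) ≤ w ↔ K (-k) := by
  by_cases hall : ∀ k, K k
  · exact ⟨⊤, fun k => by simp [hall]⟩
  · push Not at hall
    obtain ⟨b, hb⟩ := hall
    obtain ⟨l, hl, hmin⟩ := Int.exists_least_of_bdd (P := K)
      ⟨b, fun z hz => by
        by_contra hlt
        exact hb (hmono z b (by omega) hz)⟩ hne
    refine ⟨((-l : ℤ) : WithTop ℤ), fun k => ?_⟩
    rw [WithTop.coe_le_coe]
    constructor
    · intro h; exact hmono l _ (by omega) hl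
    · intro h; have := hmin _ h; omega

theorem le_of_forall_int {a b : WithTop ℤ} (h : ∀ k : ℤ, (k : WithTop ℤ) ≤ a → (k : WithTop ℤ) ≤ b) :
    a ≤ b := by
  induction a using WithTop.recTopCoe with
  | top =>
    induction b using WithTop.recTopCoe with
    | top => exact le_rfl
    | coe b =>
      have := h (b + 1) le_top
      rw [WithTop.coe_le_coe] at this
      omega
  | coe a => exact h a le_rfl

theorem coe_le_add {a : WithTop ℤ} {k c : ℤ} :
    (k : WithTop ℤ) ≤ a + (c : WithTop ℤ) ↔ ((k - c : ℤ) : WithTop ℤ) ≤ a := by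
  induction a using WithTop.recTopCoe with
  | top => simp
  | coe a => rw [← WithTop.coe_add, WithTop.coe_le_coe, WithTop.coe_le_coe]; omega

/-- Cast `WithTop ℤ` to `WithTop ℝ`. -/
noncomputable def toR (a : WithTop ℤ) : WithTop ℝ := a.map (fun k : ℤ => (k : ℝ))

theorem toR_add (a : WithTop ℤ) (c : ℤ) :
    toR (a + (c : WithTop ℤ)) = toR a + (((c : ℤ) : ℝ) : WithTop ℝ) := by
  induction a using WithTop.recTopCoe with
  | top => simp [toR]
  | coe a =>
    rw [← WithTop.coe_add]
    simp only [toR, WithTop.map_coe]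
    rw [← WithTop.coe_add]
    push_cast
    rfl

theorem toR_le {a b : WithTop ℤ} : toR a ≤ toR b ↔ a ≤ b := by
  induction a using WithTop.recTopCoe with
  | top =>
    induction b using WithTop.recTopCoe with
    | top => simp
    | coe b => simp [toR]
  | coe a =>
    induction b using WithTop.recTopCoe with
    | top => simp [toR]
    | coe b => simp only [toR, WithTop.map_coe, WithTop.coe_le_coe]; exact Int.cast_le

theorem toR_min (a b : WithTop ℤ) : toR (min a b) = min (toR a) (toR b) := by
  have : Monotone toR := fun a b h => toR_le.2 h
  exact this.map_min

theorem backward (hfg : Group.FG G)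
    (χ : G → ℤ) (hχ : ∀ a b : G, χ (a * b) = χ a + χ b) (hsurj : Function.Surjective χ)
    (hno : ¬ ∃ (B : Subgroup G) (t : G), B.FG ∧ χ t = 1 ∧ (∀ b ∈ B, χ b = 0) ∧
        Subgroup.closure ((B : Set G) ∪ {t}) = ⊤ ∧ (∀ b ∈ B, t * b * t⁻¹ ∈ B)) :
    ∃ v : G → WithTop ℝ, IsNontrivialHNNValuation (fun g => ((χ g : ℤ) : ℝ)) v := by
  classical
  obtain ⟨t, ht⟩ := hsurj 1
  have hz := chi_zpow hχ ht
  obtain ⟨X, hX⟩ := Group.fg_def.1 hfg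
  set S : Finset G := X.image (fun x => x * t ^ (-χ x)) with hSdef
  have hS0 : ∀ s ∈ S, χ s = 0 := by
    intro s hs
    obtain ⟨x, _, rfl⟩ := Finset.mem_image.1 hs
    rw [hχ, hz]; ring
  have hex : ∀ g : G, ∃ k, g * t ^ (-χ g) ∈ A (S : Set G) t k := by
    intro g
    have hg : g ∈ Subgroup.closure (X : Set G) := by rw [hX]; trivial
    induction hg using Subgroup.closure_induction with
    | mem x hx =>
      refine ⟨0, Subgroup.subset_closure ⟨0, le_rfl, x * t ^ (-χ x), ?_, by simp⟩⟩
      exact Finset.mem_coe.2 (Finset.mem_image_of_mem _ hx)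
    | one => exact ⟨0, by rw [chi_one hχ]; simp⟩
    | mul x y _ _ h1 h2 =>
      obtain ⟨k, h1⟩ := h1
      obtain ⟨l, h2⟩ := h2
      refine ⟨max k (l + χ x), ?_⟩
      have h3 := Subgroup.mul_mem _ (A_mono _ t (le_max_left k (l + χ x)) h1)
        (A_mono _ t (le_max_right k (l + χ x)) (A_conj _ t (χ x) h2))
      rw [hχ]
      convert h3 using 1
      rw [neg_add_rev, zpow_add]
      simp [mul_assoc]
    | inv x _ h =>
      obtain ⟨k, h⟩ := h
      refine ⟨k + -χ x, ?_⟩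
      have h3 := A_conj _ t (-χ x) (Subgroup.inv_mem _ h)
      rw [chi_inv hχ]
      convert h3 using 1
      simp [mul_assoc]
  have hA0 : ∀ k, ∀ x ∈ A (S : Set G) t k, χ x = 0 := by
    intro k x hx
    unfold A at hx
    induction hx using Subgroup.closure_induction with
    | mem x hx =>
      obtain ⟨i, hi, s, hs, rfl⟩ := hx
      rw [hχ, hχ, hz, hz, hS0 s hs]; ring
    | one => exact chi_one hχ
    | mul x y _ _ h1 h2 => rw [hχ, h1, h2]; ring
    | inv x _ h => rw [chi_inv hχ, h]; ring
  -- the filtration is strict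
  have hstrict : ∃ n ∈ A (S : Set G) t 1, n ∉ A (S : Set G) t 0 := by
    by_contra! hle
    apply hno
    have h1 : ∀ s : G, ∃ m, s ∈ S → t * s * t⁻¹ ∈ Bm (S : Set G) t m := by
      intro s
      by_cases hs : s ∈ S
      · obtain ⟨m, hm⟩ := A_sub_Bm (S : Set G) t (hle (t * s * t⁻¹)
          (Subgroup.subset_closure ⟨1, le_rfl, s, hs, by simp⟩))
        exact ⟨m, fun _ => hm⟩
      · exact ⟨0, fun h => absurd h hs⟩
    choose f hf using h1
    have h2 : ∀ s ∈ (S : Set G), t * s * t⁻¹ ∈ Bm (S : Set G) t (S.sup f) :=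
      fun s hs => Bm_mono _ t (Finset.le_sup (f := f) hs) (hf s hs)
    refine ⟨Bm (S : Set G) t (S.sup f), t, Bm_fg S t _, ht, ?_, ?_, Bm_conj _ t _ h2⟩
    · intro b hb
      unfold Bm at hb
      induction hb using Subgroup.closure_induction with
      | mem x hx =>
        obtain ⟨i, hi, s, hs, rfl⟩ := hx
        rw [hχ, hχ, hz, hz, hS0 s hs]; ring
      | one => exact chi_one hχ
      | mul x y _ _ h1 h2 => rw [hχ, h1, h2]; ring
      | inv x _ h => rw [chi_inv hχ, h]; ring
    · rw [eq_top_iff, ← hX, Subgroup.closure_le]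
      intro x hx
      have hs : x * t ^ (-χ x) ∈ Bm (S : Set G) t (S.sup f) :=
        Subgroup.subset_closure ⟨0, Nat.zero_le _, x * t ^ (-χ x),
          Finset.mem_coe.2 (Finset.mem_image_of_mem _ hx), by simp⟩
      have e : x = (x * t ^ (-χ x)) * t ^ (χ x) := by simp
      have htm : t ∈ Subgroup.closure ((Bm (S : Set G) t (S.sup f) : Set G) ∪ {t}) :=
        Subgroup.subset_closure (Or.inr (Set.mem_singleton t))
      have hsm : x * t ^ (-χ x) ∈
          Subgroup.closure ((Bm (S : Set G) t (S.sup f) : Set G) ∪ {t}) :=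
        Subgroup.subset_closure (Or.inl hs)
      rw [SetLike.mem_coe, e]
      exact Subgroup.mul_mem _ hsm (Subgroup.zpow_mem _ htm _)
  have hW : ∀ g : G, ∃ w : WithTop ℤ, ∀ k : ℤ,
      (k : WithTop ℤ) ≤ w ↔ g * t ^ (-χ g) ∈ A (S : Set G) t (-k) := fun g =>
    exists_sup (fun k => g * t ^ (-χ g) ∈ A (S : Set G) t k)
      (fun k l hkl h => A_mono _ t hkl h) (hex g)
  choose W hW using hW
  have hWa : ∀ g, W g⁻¹ = W g + (χ g : WithTop ℤ) := by
    intro g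
    have key : ∀ k : ℤ, (k : WithTop ℤ) ≤ W g⁻¹ ↔ (k : WithTop ℤ) ≤ W g + (χ g : WithTop ℤ) := by
      intro k
      rw [coe_le_add, hW, hW, ← Subgroup.inv_mem_iff (x := g * t ^ (-χ g)),
        ← A_conj_iff _ t _ (-χ g) (g * t ^ (-χ g))⁻¹, chi_inv hχ]
      have e1 : t ^ (-χ g) * (g * t ^ (-χ g))⁻¹ * t ^ (- -χ g) = g⁻¹ * t ^ (- -χ g) := by
        simp [mul_assoc]
      have e2 : -(k - χ g) + -χ g = -k := by ring
      rw [e1, e2]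
    exact le_antisymm (le_of_forall_int fun k => (key k).1) (le_of_forall_int fun k => (key k).2)
  have hWb : ∀ g h, min (W g) (W h + ((-χ g : ℤ) : WithTop ℤ)) ≤ W (g * h) := by
    intro g h
    apply le_of_forall_int
    intro k hk
    rw [le_min_iff, coe_le_add, hW, hW] at hk
    obtain ⟨h1, h2⟩ := hk
    rw [hW]
    have h3 := A_conj _ t (χ g) h2
    rw [show -(k - -χ g) + χ g = -k - χ g + χ g by ring, sub_add_cancel] at h3
    have h4 := Subgroup.mul_mem _ h1 h3
    rw [hχ]
    convert h4 using 1
    rw [neg_add_rev, zpow_add]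
    simp [mul_assoc]
  refine ⟨fun g => toR (W g), ⟨fun g => ?_, fun g h => ?_⟩, ?_⟩
  · simp only
    rw [hWa, toR_add]
  · have := toR_le.2 (hWb g h)
    rw [toR_min, toR_add] at this
    simpa using this
  · rintro ⟨g₀, -, hmin⟩
    obtain ⟨k, hk⟩ := hex g₀
    obtain ⟨n, hn1, hn0⟩ := hstrict
    have h1 := A_conj _ t k hn1
    have h0 : t ^ k * n * t ^ (-k) ∉ A (S : Set G) t (0 + k) := fun h =>
      hn0 ((A_conj_iff _ t 0 k n).1 h)
    rw [zero_add] at h0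
    have hc := hA0 _ _ h1
    have h2 := toR_le.1 (hmin (t ^ k * n * t ^ (-k)) (by simp only; rw [hc]; simp))
    have h3 : ((-k : ℤ) : WithTop ℤ) ≤ W g₀ := (hW g₀ (-k)).2 (by rwa [neg_neg])
    have h4 := (hW _ (-k)).1 (h3.trans h2)
    rw [hc, neg_neg, neg_zero, zpow_zero, mul_one] at h4
    exact h0 h4

end back
end HNNAux

/-- Brown's criterion, (1) ↔ (3): a finitely generated group `G` with a surjective
homomorphism `χ : G → ℤ` admits a descending HNN decomposition with finitely generated base
group and with `χ` as the associated homomorphism iff there is no nontrivial HNN valuation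
on `G` with respect to `χ` (viewed as a real-valued homomorphism). -/
theorem descending_hnn_iff_no_nontrivial_valuation
    {G : Type*} [Group G] (hfg : Group.FG G)
    (χ : G → ℤ) (hχ : ∀ a b : G, χ (a * b) = χ a + χ b) (hsurj : Function.Surjective χ) :
    (∃ (B : Subgroup G) (t : G), B.FG ∧ χ t = 1 ∧ (∀ b ∈ B, χ b = 0) ∧
        Subgroup.closure ((B : Set G) ∪ {t}) = ⊤ ∧ (∀ b ∈ B, t * b * t⁻¹ ∈ B)) ↔
    ¬ ∃ v : G → WithTop ℝ, IsNontrivialHNNValuation (fun g => ((χ g : ℤ) : ℝ)) v := by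
  constructor
  · rintro ⟨B, t, hB, ht, hB0, hgen, hconj⟩ ⟨v, hv, hnt⟩
    exact hnt (HNNAux.forward hχ B t hB ht hB0 hgen hconj v hv)
  · intro h
    by_contra hno
    exact h (HNNAux.backward hfg χ hχ hsurj hno)
end

section
/- Let G be a finitely generated group and χ : G → ℤ a surjective homomorphism. Then the following are equivalent: (1) there exist a finitely generated subgroup B ≤ G and an element t ∈ G such that χ(t) = 1, χ(b) = 0 for all b ∈ B, G is generated by B ∪ {t}, and tBt⁻¹ ⊆ B (i.e., G admits a descending HNN decomposition with finitely generated base group and with χ as the associated homomorphism); (2) there do NOT exist a subgroup B ≤ G and an element t ∈ G such that χ(t) = 1, χ(b) = 0 for all b ∈ B, G is generated by B ∪ {t}, and t⁻¹Bt is a proper subgroup of B (i.e., G does not admit a properly ascending HNN decomposition with χ as the associated homomorphism). -/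
open Filter in
lemma hnn_aux {G : Type*} [Group G] (χ : G → ℤ) (hχ : ∀ a b : G, χ (a * b) = χ a + χ b)
    (B : Subgroup G) (s : G) (hs : χ s = 1) (hB : ∀ b ∈ B, χ b = 0)
    (hgen : ∀ H : Subgroup G, B ≤ H → s ∈ H → ∀ g, g ∈ H)
    (hasc : ∀ b ∈ B, s⁻¹ * b * s ∈ B) (g : G) (hg : χ g = 0) :
    ∀ᶠ m : ℤ in atTop, s ^ (-m) * g * s ^ m ∈ B := by
  have h1 : χ 1 = 0 := by have := hχ 1 1; simp at this; exact this
  have hinv : ∀ a, χ a⁻¹ = - χ a := by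
    intro a
    have := hχ a a⁻¹
    rw [mul_inv_cancel, h1] at this
    omega
  have hnat : ∀ n : ℕ, ∀ b ∈ B, s ^ (-(n : ℤ)) * b * s ^ (n : ℤ) ∈ B := by
    intro n
    induction n with
    | zero => intro b hb; simpa using hb
    | succ n ih =>
      intro b hb
      have := ih _ (hasc b hb)
      have e : s ^ (-((n + 1 : ℕ) : ℤ)) * b * s ^ ((n + 1 : ℕ) : ℤ)
          = s ^ (-(n : ℤ)) * (s⁻¹ * b * s) * s ^ (n : ℤ) := by
        push_cast
        group
      rw [e]; exact this
  let H : Subgroup G :=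
    { carrier := {g | ∀ᶠ m : ℤ in atTop, s ^ (-m) * (g * s ^ (-χ g)) * s ^ m ∈ B}
      one_mem' := by
        simp [h1]
      mul_mem' := by
        intro a b ha hb
        have hb' := (tendsto_atTop_add_const_right atTop (-χ a) (tendsto_id (α := ℤ))).eventually hb
        filter_upwards [ha, hb'] with m h2 h3
        have := B.mul_mem h2 h3
        have e : s ^ (-m) * (a * b * s ^ (-χ (a * b))) * s ^ m
          = s ^ (-m) * (a * s ^ (-χ a)) * s ^ m *
            (s ^ (-(id m + -χ a)) * (b * s ^ (-χ b)) * s ^ (id m + -χ a)) := by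
          rw [hχ]
          simp only [id]
          group
        rw [e]; exact this
      inv_mem' := by
        intro a ha
        have ha' := (tendsto_atTop_add_const_right atTop (χ a) (tendsto_id (α := ℤ))).eventually ha
        filter_upwards [ha'] with m h2
        have := B.inv_mem h2
        have e : s ^ (-m) * (a⁻¹ * s ^ (-χ a⁻¹)) * s ^ m
          = (s ^ (-(id m + χ a)) * (a * s ^ (-χ a)) * s ^ (id m + χ a))⁻¹ := by
          rw [hinv]
          simp only [id]
          group
        rw [e]; exact this }
  have key : g ∈ H := by
    apply hgen H
    · intro b hb
      change ∀ᶠ m : ℤ in atTop, s ^ (-m) * (b * s ^ (-χ b)) * s ^ m ∈ B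
      filter_upwards [eventually_ge_atTop 0] with m hm
      lift m to ℕ using hm
      rw [hB b hb]
      simpa using hnat m b hb
    · change ∀ᶠ m : ℤ in atTop, s ^ (-m) * (s * s ^ (-χ s)) * s ^ m ∈ B
      rw [hs]
      simp
  have key' : ∀ᶠ m : ℤ in atTop, s ^ (-m) * (g * s ^ (-χ g)) * s ^ m ∈ B := key
  rw [hg] at key'
  simpa using key'

lemma hnn_top {G : Type*} [Group G] {B : Subgroup G} {t : G}
    (h : Subgroup.closure ((B : Set G) ∪ {t}) = ⊤) (H : Subgroup G) (hB : B ≤ H) (ht : t ∈ H)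
    (g : G) : g ∈ H := by
  have : Subgroup.closure ((B : Set G) ∪ {t}) ≤ H := by
    rw [Subgroup.closure_le]
    rintro x (hx | hx)
    · exact hB hx
    · rw [Set.mem_singleton_iff.1 hx]; exact ht
  rw [h] at this
  exact this trivial

/-- Brown's criterion, (1) ↔ (2): a finitely generated group `G` with a surjective
homomorphism `χ : G → ℤ` admits a descending HNN decomposition with finitely generated base
group and with `χ` as the associated homomorphism iff `G` does not admit a properly
ascending HNN decomposition with `χ` as the associated homomorphism. -/
theorem descending_hnn_iff_not_properly_ascending
    {G : Type*} [Group G] (hfg : Group.FG G)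
    (χ : G → ℤ) (hχ : ∀ a b : G, χ (a * b) = χ a + χ b) (hsurj : Function.Surjective χ) :
    (∃ (B : Subgroup G) (t : G), B.FG ∧ χ t = 1 ∧ (∀ b ∈ B, χ b = 0) ∧
        Subgroup.closure ((B : Set G) ∪ {t}) = ⊤ ∧ (∀ b ∈ B, t * b * t⁻¹ ∈ B)) ↔
    ¬ ∃ (B : Subgroup G) (t : G), χ t = 1 ∧ (∀ b ∈ B, χ b = 0) ∧
        Subgroup.closure ((B : Set G) ∪ {t}) = ⊤ ∧ (∀ b ∈ B, t⁻¹ * b * t ∈ B) ∧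
        ∃ b₀ ∈ B, ∀ b ∈ B, t⁻¹ * b * t ≠ b₀ := by
  have h1 : χ 1 = 0 := by have := hχ 1 1; simp at this; exact this
  have hinv : ∀ a, χ a⁻¹ = - χ a := by
    intro a
    have := hχ a a⁻¹
    rw [mul_inv_cancel, h1] at this
    omega
  have hconj : ∀ a b, χ (a * b * a⁻¹) = χ b := by
    intro a b; rw [hχ, hχ, hinv]; ring
  constructor
  · rintro ⟨B, t, ⟨T, hT⟩, ht, hB, hgen, hdesc⟩ ⟨C, s, hs, hC, hCgen, hasc, b₀, hb₀, hne⟩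
    have hCK := hnn_aux χ hχ C s hs hC (hnn_top hCgen) hasc
    have e1 : ∀ᶠ m : ℤ in Filter.atTop, ∀ x ∈ T, s ^ (-m) * x * s ^ m ∈ C := by
      rw [Filter.eventually_all_finset]
      intro x hx
      apply hCK
      apply hB
      rw [← hT]
      exact Subgroup.subset_closure hx
    have e2 := hCK (s⁻¹ * t) (by rw [hχ, hinv, hs, ht]; rfl)
    obtain ⟨N, hN1, hN2⟩ := (e1.and e2).exists
    let D : Subgroup G := C.comap (MulAut.conj (s ^ (-N))).toMonoidHom
    have hD : ∀ g, g ∈ D ↔ s ^ (-N) * g * s ^ N ∈ C := by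
      intro g
      have e : s ^ (-N) * g * s ^ N = s ^ (-N) * g * (s ^ (-N))⁻¹ := by rw [zpow_neg, inv_inv]
      rw [e]
      exact Iff.rfl
    have hBD : B ≤ D := by
      rw [← hT, Subgroup.closure_le]
      intro x hx
      exact (hD x).2 (hN1 x hx)
    have hk : s⁻¹ * t ∈ D := (hD _).2 hN2
    have hsD : ∀ d ∈ D, s⁻¹ * d * s ∈ D := by
      intro d hd
      rw [hD] at hd ⊢
      have := hasc _ hd
      have e : s ^ (-N) * (s⁻¹ * d * s) * s ^ N = s⁻¹ * (s ^ (-N) * d * s ^ N) * s := by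
        group
      rw [e]; exact this
    have htD : ∀ d ∈ D, t⁻¹ * d * t ∈ D := by
      intro d hd
      have := D.mul_mem (D.mul_mem (D.inv_mem hk) (hsD d hd)) hk
      have e : t⁻¹ * d * t = (s⁻¹ * t)⁻¹ * (s⁻¹ * d * s) * (s⁻¹ * t) := by group
      rw [e]; exact this
    have htn : ∀ n : ℕ, ∀ g, t ^ n * g * (t ^ n)⁻¹ ∈ D → g ∈ D := by
      intro n
      induction n with
      | zero => intro g hg; simpa using hg
      | succ n ih =>
        intro g hg
        apply ih
        have := htD _ hg
        have e : t⁻¹ * (t ^ (n + 1) * g * (t ^ (n + 1))⁻¹) * t = t ^ n * g * (t ^ n)⁻¹ := by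
          rw [pow_succ']; group
        rw [← e]; exact this
    have hKD : ∀ g, χ g = 0 → g ∈ D := by
      intro g hg
      have h := hnn_aux (fun g => - χ g) (by intro a b; simp only [hχ]; ring) B t⁻¹
        (by simp only [hinv, ht]; rfl) (by intro b hb; simp only [hB b hb]; rfl)
        (fun H h2 h3 => hnn_top hgen H h2 (by simpa using h3))
        (by intro b hb; simpa using hdesc b hb) g (by simp only [hg]; rfl)
      obtain ⟨m, hm, hm0⟩ := (h.and (Filter.eventually_ge_atTop 0)).exists
      lift m to ℕ using hm0
      apply htn m
      apply hBD
      simpa using hm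
    have hfin := hKD (s ^ N * (s * b₀ * s⁻¹) * (s ^ N)⁻¹) (by
      rw [hconj, hconj]; exact hC _ hb₀)
    rw [hD] at hfin
    refine hne (s * b₀ * s⁻¹) ?_ (by group)
    have e : s ^ (-N) * (s ^ N * (s * b₀ * s⁻¹) * (s ^ N)⁻¹) * s ^ N = s * b₀ * s⁻¹ := by group
    rw [e] at hfin; exact hfin
  · intro hno
    obtain ⟨t, ht⟩ := hsurj 1
    obtain ⟨S, hS⟩ := hfg.out
    classical
    let X : Finset G := S.image (fun g => g * t ^ (-χ g))
    have hpow : ∀ n : ℤ, χ (t ^ n) = n := by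
      intro n
      let f : G →* Multiplicative ℤ := MonoidHom.mk' (fun g => Multiplicative.ofAdd (χ g))
        (by intro a b; rw [hχ]; rfl)
      have := map_zpow f t n
      have h2 := congrArg Multiplicative.toAdd this
      simpa [f, ht] using h2
    have hX : ∀ x ∈ X, χ x = 0 := by
      intro x hx
      obtain ⟨g, -, rfl⟩ := Finset.mem_image.1 hx
      rw [hχ, hpow]; ring
    have hXgen : ∀ H : Subgroup G, (∀ x ∈ X, x ∈ H) → t ∈ H → H = ⊤ := by
      intro H h2 h3
      rw [eq_top_iff, ← hS, Subgroup.closure_le]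
      intro g hg
      have := H.mul_mem (h2 _ (Finset.mem_image_of_mem _ hg)) (H.zpow_mem h3 (χ g))
      simpa using this
    let Bn : ℕ → Subgroup G := fun n =>
      Subgroup.closure ((fun p : ℕ × G => (t ^ p.1)⁻¹ * p.2 * t ^ p.1) ''
        ((Finset.range (n + 1) ×ˢ X : Finset (ℕ × G)) : Set (ℕ × G)))
    have hmemB : ∀ n i x, i ≤ n → x ∈ X → (t ^ i)⁻¹ * x * t ^ i ∈ Bn n := by
      intro n i x hi hx
      apply Subgroup.subset_closure
      refine ⟨(i, x), ?_, rfl⟩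
      simp [hx]; omega
    have hleB : ∀ n (H : Subgroup G), (∀ i x, i ≤ n → x ∈ X → (t ^ i)⁻¹ * x * t ^ i ∈ H) →
        Bn n ≤ H := by
      intro n H h
      rw [Subgroup.closure_le]
      rintro _ ⟨⟨i, x⟩, hp, rfl⟩
      simp at hp
      exact h i x (by omega) hp.2
    have hmono : Monotone Bn := by
      intro n m hnm
      exact hleB n _ (fun i x hi hx => hmemB m i x (by omega) hx)
    let C : Subgroup G := ⨆ n, Bn n
    have hCmem : ∀ g, g ∈ C ↔ ∃ n, g ∈ Bn n := by
      intro g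
      exact Subgroup.mem_iSup_of_directed hmono.directed_le
    have hker : ∀ n, ∀ b ∈ Bn n, χ b = 0 := by
      intro n
      let K : Subgroup G :=
        { carrier := {g | χ g = 0}
          one_mem' := h1
          mul_mem' := by intro a b ha hb; simp only [Set.mem_ofPred_eq] at *; rw [hχ, ha, hb]; rfl
          inv_mem' := by intro a ha; simp only [Set.mem_ofPred_eq] at *; rw [hinv, ha]; rfl }
      have : Bn n ≤ K := by
        apply hleB
        intro i x _ hx
        change χ _ = 0
        have := hconj (t ^ i)⁻¹ x
        rw [inv_inv] at this
        rw [this, hX x hx]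
      exact fun b hb => this hb
    have hgenB : ∀ n, ∀ H : Subgroup G, Bn n ≤ H → Subgroup.closure ((H : Set G) ∪ {t}) = ⊤ := by
      intro n H h
      apply hXgen
      · intro x hx
        apply Subgroup.subset_closure
        left
        apply h
        simpa using hmemB n 0 x (by omega) hx
      · apply Subgroup.subset_closure
        right; rfl
    have hshift : ∀ n, ∀ b ∈ Bn n, t⁻¹ * b * t ∈ Bn (n + 1) := by
      intro n
      have : Bn n ≤ (Bn (n + 1)).comap (MulAut.conj t⁻¹).toMonoidHom := by
        apply hleB
        intro i x hi hx
        have := hmemB (n + 1) (i + 1) x (by omega) hx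
        have e : (t ^ (i + 1))⁻¹ * x * t ^ (i + 1) = t⁻¹ * ((t ^ i)⁻¹ * x * t ^ i) * t := by
          rw [pow_succ]; group
        rw [e] at this
        simpa [Subgroup.mem_comap] using this
      intro b hb
      simpa [Subgroup.mem_comap] using this hb
    have hCC : ∀ b ∈ C, t * b * t⁻¹ ∈ C := by
      intro b hb
      by_contra hcon
      apply hno
      refine ⟨C, t, ht, ?_, hgenB 0 C (le_iSup Bn 0), ?_, b, hb, ?_⟩
      · intro c hc
        obtain ⟨n, hn⟩ := (hCmem c).1 hc
        exact hker n c hn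
      · intro c hc
        obtain ⟨n, hn⟩ := (hCmem c).1 hc
        exact (hCmem _).2 ⟨n + 1, hshift n c hn⟩
      · rintro c hc rfl
        apply hcon
        have e : t * (t⁻¹ * c * t) * t⁻¹ = c := by group
        rw [e]; exact hc
    have hev : ∀ᶠ n : ℕ in Filter.atTop, ∀ x ∈ X, t * x * t⁻¹ ∈ Bn n := by
      rw [Filter.eventually_all_finset]
      intro x hx
      have hxC : x ∈ C := (hCmem x).2 ⟨0, by simpa using hmemB 0 0 x le_rfl hx⟩
      obtain ⟨n, hn⟩ := (hCmem _).1 (hCC x hxC)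
      filter_upwards [Filter.eventually_ge_atTop n] with m hm
      exact hmono hm hn
    obtain ⟨n, hn⟩ := hev.exists
    refine ⟨Bn n, t, ?_, ht, hker n, hgenB n _ le_rfl, ?_⟩
    · rw [Subgroup.fg_iff]
      exact ⟨_, rfl, (Finset.finite_toSet _).image _⟩
    · have : Bn n ≤ (Bn n).comap (MulAut.conj t).toMonoidHom := by
        apply hleB
        intro i x hi hx
        rw [Subgroup.mem_comap]
        change t * ((t ^ i)⁻¹ * x * t ^ i) * t⁻¹ ∈ Bn n
        cases i with
        | zero => simpa using hn x hx
        | succ i =>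
          have e : t * ((t ^ (i + 1))⁻¹ * x * t ^ (i + 1)) * t⁻¹ = (t ^ i)⁻¹ * x * t ^ i := by
            rw [pow_succ]; group
          rw [e]
          exact hmemB n i x (by omega) hx
      intro b hb
      exact this hb
end

section
/- Let G be a finitely generated group admitting a properly ascending HNN decomposition with base group B ≤ G, stable letter t ∈ G, and associated homomorphism χ : G → ℤ; that is, χ is surjective, χ(t) = 1, χ(b) = 0 for all b ∈ B, G is generated by B ∪ {t}, and t⁻¹Bt is a proper subgroup of B. Then there exists a nontrivial HNN valuation on G with respect to the composition of χ with the inclusion ℤ ↪ ℝ. -/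
/-- If a finitely generated group `G` admits a properly ascending HNN decomposition with
associated homomorphism `χ : G → ℤ`, then there exists a nontrivial HNN valuation on `G`
with respect to `χ` (viewed as a real-valued homomorphism). -/
theorem exists_nontrivial_valuation_of_properly_ascending
    {G : Type*} [Group G] (hfg : Group.FG G) (B : Subgroup G) (t : G)
    (χ : G → ℤ) (hχ : ∀ a b : G, χ (a * b) = χ a + χ b) (hsurj : Function.Surjective χ)
    (ht : χ t = 1) (hB : ∀ b ∈ B, χ b = 0)
    (hgen : Subgroup.closure ((B : Set G) ∪ {t}) = ⊤)
    (hsub : ∀ b ∈ B, t⁻¹ * b * t ∈ B) (hproper : ∃ b₀ ∈ B, ∀ b ∈ B, t⁻¹ * b * t ≠ b₀) :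
    ∃ v : G → WithTop ℝ, IsNontrivialHNNValuation (fun g => ((χ g : ℤ) : ℝ)) v := by
  obtain ⟨b₀, hb₀, hb₀'⟩ := hproper
  have h1 : χ 1 = 0 := by have := hχ 1 1; simp at this; exact this
  have hinv : ∀ g, χ g⁻¹ = -χ g := by
    intro g; have := hχ g g⁻¹; simp only [mul_inv_cancel, h1] at this; omega
  let Q : G → ℤ → Prop := fun g k => 0 ≤ k ∧ χ g ≤ k ∧ t ^ (-k) * g * t ^ (k - χ g) ∈ B
  have Qup1 : ∀ g k, Q g k → Q g (k + 1) := by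
    rintro g k ⟨h0, hk, hm⟩
    refine ⟨by omega, by omega, ?_⟩
    have := hsub _ hm
    convert this using 1
    rw [show -(k + 1) = -1 + -k by ring, show k + 1 - χ g = (k - χ g) + 1 by ring,
      zpow_add, zpow_add]
    simp [mul_assoc]
  have Qup : ∀ g k l, k ≤ l → Q g k → Q g l := by
    intro g k l hkl h
    induction l, hkl using Int.leInduction with
    | base => exact h
    | succ l _ ih => exact Qup1 g l ih
  have Qinv : ∀ g k, Q g (k + χ g) → Q g⁻¹ k := by
    rintro g k ⟨h0, hk, hm⟩
    refine ⟨by omega, by rw [hinv]; omega, ?_⟩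
    have := B.inv_mem hm
    convert this using 1
    rw [hinv, zpow_neg t (k + χ g)]
    simp [mul_assoc]
  have Qmul : ∀ g h k, Q g k → Q h (k - χ g) → Q (g * h) k := by
    rintro g h k ⟨h0, hk, hm⟩ ⟨h0', hk', hm'⟩
    refine ⟨h0, by rw [hχ]; omega, ?_⟩
    have := B.mul_mem hm hm'
    convert this using 1
    rw [hχ, sub_add_eq_sub_sub, zpow_neg t (k - χ g)]
    group
  have Qex : ∀ g, ∃ k, Q g k := by
    intro g
    have hg : g ∈ Subgroup.closure ((B : Set G) ∪ {t}) := by rw [hgen]; trivial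
    induction hg using Subgroup.closure_induction with
    | mem x hx =>
      rcases hx with hx | hx
      · refine ⟨0, le_refl _, (hB x hx).le, ?_⟩
        simpa [hB x hx] using hx
      · obtain rfl : x = t := hx
        refine ⟨1, by norm_num, ht.le, ?_⟩
        simp [ht, B.one_mem]
    | one => exact ⟨0, le_refl _, h1.le, by simp [h1, B.one_mem]⟩
    | mul x y _ _ hx hy =>
      obtain ⟨k, hk⟩ := hx
      obtain ⟨l, hl⟩ := hy
      exact ⟨max k (l + χ x), Qmul _ _ _ (Qup _ _ _ (le_max_left _ _) hk)
        (Qup _ l _ (by have := le_max_right k (l + χ x); omega) hl)⟩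
    | inv x _ hx =>
      obtain ⟨k, hk⟩ := hx
      exact ⟨k - χ x, Qinv _ _ (by simpa using hk)⟩
  have hN : ∀ g, ∃ n, Q g n ∧ ∀ k, Q g k → n ≤ k := fun g =>
    Int.exists_least_of_bdd ⟨0, fun k hk => hk.1⟩ (Qex g)
  choose N hNQ hNle using hN
  have Nmul : ∀ g h, N (g * h) ≤ max (N g) (N h + χ g) := by
    intro g h
    apply hNle
    exact Qmul _ _ _ (Qup _ _ _ (le_max_left _ _) (hNQ g))
      (Qup _ _ _ (by have := le_max_right (N g) (N h + χ g); omega) (hNQ h))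
  have Ninv1 : ∀ g, N g⁻¹ ≤ N g - χ g := fun g =>
    hNle _ _ (Qinv _ _ (by simpa using hNQ g))
  have Ninv : ∀ g, N g⁻¹ = N g - χ g := by
    intro g
    have a := Ninv1 g
    have b := Ninv1 g⁻¹
    rw [inv_inv, hinv] at b
    omega
  refine ⟨fun g => ((-(N g : ℝ) : ℝ) : WithTop ℝ), ⟨?_, ?_⟩, ?_⟩
  · intro g
    beta_reduce
    rw [← WithTop.coe_add, Ninv]
    congr 1
    push_cast; ring
  · intro g h
    rw [← WithTop.coe_add, ← WithTop.coe_min, WithTop.coe_le_coe, min_le_iff]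
    rcases le_max_iff.1 (Nmul g h) with H | H
    · left
      have : (N (g * h) : ℝ) ≤ N g := by exact_mod_cast H
      linarith
    · right
      have : (N (g * h) : ℝ) ≤ N h + χ g := by exact_mod_cast H
      linarith
  · rintro ⟨g₀, -, hmin⟩
    set n : ℤ := N g₀ + 1 with hn
    have hc : χ (t ^ n * b₀ * t ^ (-n)) = 0 := by
      have : χ (t ^ n * b₀ * (t ^ n)⁻¹) = 0 := by
        rw [hχ, hχ, hinv, hB b₀ hb₀]; ring
      simpa using this
    have h2 := hmin (t ^ n * b₀ * t ^ (-n)) (by simp only [hc]; simp)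
    rw [WithTop.coe_le_coe] at h2
    have h3 : N (t ^ n * b₀ * t ^ (-n)) ≤ N g₀ := by
      have : (N (t ^ n * b₀ * t ^ (-n)) : ℝ) ≤ N g₀ := by linarith
      exact_mod_cast this
    obtain ⟨-, -, hm⟩ := Qup _ _ _ h3 (hNQ _)
    rw [hc] at hm
    refine hb₀' _ hm ?_
    rw [hn]
    group
end

section
/- Let G be a group, B ≤ G a subgroup, and t ∈ G, such that G is generated by B ∪ {t}, tBt⁻¹ ⊆ B, and there exists a homomorphism χ : G → ℤ with χ(t) = 1 and χ(b) = 0 for all b ∈ B. Let c : B → B be the (injective) homomorphism c(b) = t b t⁻¹, regarded as an isomorphism from B onto its image c(B) ≤ B. Then the canonical homomorphism Φ from the HNN extension B∗_c = ⟨B, s | s b s⁻¹ = c(b) for all b ∈ B⟩ to G, determined by Φ(b) = b for b ∈ B and Φ(s) = t, is an isomorphism of groups. -/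
/-- If `G` is generated by a subgroup `B` together with `t`, with `t B t⁻¹ ⊆ B` and some
homomorphism `χ : G → ℤ` with `χ t = 1` and `χ|_B = 0`, then `G` is the (descending) HNN
extension of `B` along the conjugation monomorphism `c : B → B`, `b ↦ t b t⁻¹`:
the canonical homomorphism `Φ : B∗_c → G` with `Φ ∘ of = incl B` and `Φ s = t` is an
isomorphism. -/
theorem descending_hnn_extension_structure
    {G : Type*} [Group G] (B : Subgroup G) (t : G)
    (hgen : Subgroup.closure ((B : Set G) ∪ {t}) = ⊤)
    (hconj : ∀ b ∈ B, t * b * t⁻¹ ∈ B)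
    (χ : G → ℤ) (hχ : ∀ a b : G, χ (a * b) = χ a + χ b) (ht : χ t = 1)
    (hB : ∀ b ∈ B, χ b = 0) :
    ∀ (c : ↥B →* ↥B), (∀ b : ↥B, (c b : G) = t * (b : G) * t⁻¹) →
    ∀ (φ : (⊤ : Subgroup ↥B) ≃* c.range), (∀ a : (⊤ : Subgroup ↥B), (φ a : ↥B) = c (a : ↥B)) →
    ∀ (Φ : HNNExtension ↥B ⊤ c.range φ →* G),
      (∀ b : ↥B, Φ (HNNExtension.of b) = (b : G)) → Φ HNNExtension.t = t →
      Function.Bijective Φ := by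
  intro c hc φ hφ Φ hof hΦt
  have hk : ∀ (k : ℕ) (b : ↥B), ∃ b' : ↥B,
      (HNNExtension.t : HNNExtension ↥B ⊤ c.range φ) ^ k * HNNExtension.of b
        = HNNExtension.of b' * HNNExtension.t ^ k := by
    intro k
    induction k with
    | zero => intro b; exact ⟨b, by simp⟩
    | succ k ih =>
      intro b
      obtain ⟨b', hb'⟩ := ih b
      refine ⟨(φ ⟨b', Subgroup.mem_top _⟩ : ↥B), ?_⟩
      have h := HNNExtension.t_mul_of (φ := φ) ⟨b', Subgroup.mem_top _⟩
      simp only at h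
      rw [pow_succ', mul_assoc, hb', ← mul_assoc, h, mul_assoc]
  have hform : ∀ x : HNNExtension ↥B ⊤ c.range φ, ∃ (m n : ℕ) (b : ↥B),
      x = (HNNExtension.t ^ m)⁻¹ * HNNExtension.of b * HNNExtension.t ^ n := by
    intro x
    induction x using HNNExtension.induction_on with
    | of g => exact ⟨0, 0, g, by simp⟩
    | t => exact ⟨0, 1, 1, by simp⟩
    | inv x hx =>
      obtain ⟨m, n, b, rfl⟩ := hx
      exact ⟨n, m, b⁻¹, by simp [mul_assoc]⟩
    | mul x y hx hy =>
      obtain ⟨m, n, b, rfl⟩ := hx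
      obtain ⟨p, q, d, rfl⟩ := hy
      rcases le_total p n with h | h
      · obtain ⟨k, rfl⟩ := Nat.exists_eq_add_of_le' h
        obtain ⟨d', hd'⟩ := hk k d
        refine ⟨m, k + q, b * d', ?_⟩
        have e : HNNExtension.of d' =
            (HNNExtension.t : HNNExtension ↥B ⊤ c.range φ) ^ k * HNNExtension.of d
              * (HNNExtension.t ^ k)⁻¹ := by rw [hd']; group
        rw [map_mul, e, pow_add, pow_add]
        simp [mul_assoc]
      · obtain ⟨k, rfl⟩ := Nat.exists_eq_add_of_le' h
        obtain ⟨b', hb'⟩ := hk k b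
        refine ⟨k + m, q, b' * d, ?_⟩
        have e : HNNExtension.of b' =
            (HNNExtension.t : HNNExtension ↥B ⊤ c.range φ) ^ k * HNNExtension.of b
              * (HNNExtension.t ^ k)⁻¹ := by rw [hb']; group
        rw [map_mul, e, pow_add, pow_add]
        simp [mul_assoc]
  let X : G →* Multiplicative ℤ := MonoidHom.mk' (fun g => Multiplicative.ofAdd (χ g))
    (fun a b => by rw [hχ, ofAdd_add])
  constructor
  · rw [injective_iff_map_eq_one]
    intro x hx
    obtain ⟨m, n, b, rfl⟩ := hform x
    simp only [map_mul, map_inv, map_pow, hof, hΦt] at hx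
    have h1 : X t = Multiplicative.ofAdd 1 := by simp [X, ht]
    have h2 : X b = 1 := by simp [X, hB b b.2]
    have h3 := congrArg X hx
    simp only [map_mul, map_inv, map_pow, h1, h2, map_one, mul_one] at h3
    have h4 := congrArg Multiplicative.toAdd h3
    simp at h4
    have h5 : m = n := by omega
    subst h5
    have h6 : (b : G) = 1 := by
      have : (b : G) = t ^ m * ((t ^ m)⁻¹ * b * t ^ m) * (t ^ m)⁻¹ := by group
      rw [this, hx]; simp
    have h7 : b = 1 := Subtype.ext h6
    simp [h7]
  · rw [← MonoidHom.range_eq_top, eq_top_iff, ← hgen, Subgroup.closure_le]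
    rintro g (hg | hg)
    · exact ⟨HNNExtension.of ⟨g, hg⟩, hof _⟩
    · rw [Set.mem_singleton_iff] at hg
      exact ⟨HNNExtension.t, by rw [hΦt, hg]⟩
end
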